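/- The greatest side length of a square admitting a prime dissection of order at most 15 is 41: the 41×41 square admits a prime dissection into 15 integer-sided squares, and for every n > 41 every prime dissection of the n×n square has order at least 16. -/

import Mathlib

/-- The closed square with lower-left corner `(q.1, q.2.1)` and side `q.2.2`,
as a subset of the plane. -/
def closedSq (q : ℕ × ℕ × ℕ) : Set (ℝ × ℝ) :=
  Set.Icc (q.1 : ℝ) (q.1 + q.2.2) ×ˢ Set.Icc (q.2.1 : ℝ) (q.2.1 + q.2.2)

/-- The interior (open square) of the placed square `q`. -/
def openSq (q : ℕ × ℕ × ℕ) : Set (ℝ × ℝ) :=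
  Set.Ioo (q.1 : ℝ) (q.1 + q.2.2) ×ˢ Set.Ioo (q.2.1 : ℝ) (q.2.1 + q.2.2)

/-- `D` is a dissection of the `n × n` square: a finite family of axis-aligned
squares with positive integer side lengths and integer lower-left corners, whose
interiors are pairwise disjoint and whose union is `[0,n] × [0,n]`.  Its order is
`D.card`. -/
def IsDissection (n : ℕ) (D : Finset (ℕ × ℕ × ℕ)) : Prop :=
  (∀ q ∈ D, 0 < q.2.2) ∧
  (⋃ q ∈ D, closedSq q) = Set.Icc (0 : ℝ) (n : ℝ) ×ˢ Set.Icc (0 : ℝ) (n : ℝ) ∧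
  (∀ q ∈ D, ∀ q' ∈ D, q ≠ q' → openSq q ∩ openSq q' = ∅)

/-- A dissection is prime if the gcd of the side lengths of its squares is 1. -/
def IsPrimeDissection (n : ℕ) (D : Finset (ℕ × ℕ × ℕ)) : Prop :=
  IsDissection n D ∧ D.gcd (fun q => q.2.2) = 1

set_option linter.unusedSimpArgs false
set_option linter.unusedVariables false
set_option linter.unusedSectionVars false
open Real (log log_mul log_le_sub_one_of_pos log_div log_pow log_two_gt_d9 log_two_lt_d9 log_three_gt_d9 log_three_lt_d9)
open Fintype (card sum_prod_type)
open Finset (sum_le_sum sum_add_distrib mul_sum sum_ite_eq' mem_univ dvd_sum sum_congr sum_comm sum_eq_single sum_eq_zero sum_mul card_bij mem_filter card_eq_zero sum_sub_distrib sum_subtype card_le_card card_univ mem_insert mem_singleton card_pair card_singleton sum_const card_filter_add_card_filter_not card_filter)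
open Set (mem_ofPred_eq mem_iUnion)
open List (mem_map length_map mem_cons not_mem_nil exists_mem_cons_iff length_cons map_cons sum_cons count_cons nodup_cons map_map map_congr_left range_succ reverse_append reverse_singleton singleton_append)
open Nat (mod_lt mod_add_div cast_nonneg ble_eq_true_of_le add_mod_right mod_eq_of_lt)
open Bool (and_eq_true)
open Function (comp)
open Option (ne_none_iff_exists)
notation:max "Cn" Q:max => Q × Fin 4
set_option linter.unusedSimpArgs false
set_option linter.unusedVariables false
open Matrix in
theorem sp_logdet {κ : Type*} [Fintype κ] [DecidableEq κ] (M : Matrix κ κ ℝ) (hM : M.PosDef)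
    (q0 q1 q2 q3 : ℝ) (hq : ∀ x : ℝ, 0 < x → log x ≤ q0 + q1 * x + q2 * x ^ 2 + q3 * x ^ 3) :
    log M.det ≤ q0 * card κ + q1 * M.trace + q2 * (M * M).trace
      + q3 * (M * M * M).trace := by
  have hH := hM.isHermitian
  have key : ∀ k : ℕ, (M ^ k).trace = ∑ i, (hH.eigenvalues i) ^ k := by
    intro k
    have h1 := hH.spectral_theorem
    set U := hH.eigenvectorUnitary with hU
    set D : Matrix κ κ ℝ := diagonal (RCLike.ofReal ∘ hH.eigenvalues) with hD
    have h2 : M ^ k = Unitary.conjStarAlgAut ℝ _ U (D ^ k) := by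
      rw [map_pow, ← h1]
    rw [h2, Unitary.conjStarAlgAut_apply, Matrix.trace_mul_cycle]
    simp [hD, Matrix.diagonal_pow, Matrix.trace_diagonal]
  have h1 := key 1
  have h2 := key 2
  have h3 := key 3
  rw [pow_one] at h1
  rw [pow_two] at h2
  rw [pow_succ, pow_two] at h3
  have hdet : M.det = ∏ i, hH.eigenvalues i := by
    simpa using hH.det_eq_prod_eigenvalues
  rw [hdet, Real.log_prod (fun i _ => (hM.eigenvalues_pos i).ne'), h1, h2, h3]
  calc ∑ i, log (hH.eigenvalues i)
      ≤ ∑ i, (q0 + q1 * hH.eigenvalues i + q2 * hH.eigenvalues i ^ 2 + q3 * hH.eigenvalues i ^ 3) :=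
        sum_le_sum fun i _ => hq _ (hM.eigenvalues_pos i)
    _ = _ := by
        simp [sum_add_distrib, mul_sum, mul_comm]
open Matrix in
theorem det_add_const {κ : Type*} [Fintype κ] [DecidableEq κ] (L : Matrix κ κ ℝ) (r : κ)
    (hr : ∀ i, ∑ j, L i j = 0) (hc : ∀ j, ∑ i, L i j = 0) (c : ℝ) :
    (L + Matrix.of fun _ _ => c).det
      = c * (card κ) ^ 2 * (L.toSquareBlockProp (fun v => v ≠ r)).det := by
  set M := L + Matrix.of fun _ _ => c with hMdef
  have hMij : ∀ i j, M i j = L i j + c := fun i j => rfl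
  have s1 : M.det = (M.updateRow r (∑ i, (1 : ℝ) • M i)).det := by
    have := det_updateRow_sum M r (fun _ => (1 : ℝ))
    rw [this]; simp
  have e1 : (∑ i, (1 : ℝ) • M i) = (c * card κ) • (fun _ => (1 : ℝ)) := by
    funext j
    have : (∑ i, (1 : ℝ) • M i) j = ∑ i, M i j := by
      simp only [one_smul]
      exact Finset.sum_apply j Finset.univ (fun i => M i)
    rw [this]
    simp [hMij, sum_add_distrib, hc, mul_comm]
  rw [s1, e1, det_updateRow_smul]
  have s2 : (M.updateRow r (fun _ => (1 : ℝ))).det = (L.updateRow r (fun _ => (1 : ℝ))).det := by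
    apply det_eq_of_forall_row_eq_smul_add_const (fun i => if i = r then 0 else c) r (by simp)
    intro i j
    by_cases h : i = r
    · subst h; simp
    · simp [h, hMij, updateRow_apply]
  rw [s2]
  set N := L.updateRow r (fun _ => (1 : ℝ)) with hN
  obtain ⟨K, hK⟩ : ∃ K : Matrix κ κ ℝ, K = N.updateCol r (fun k => ∑ j, (1 : ℝ) • N k j) := ⟨_, rfl⟩
  have s3 : N.det = K.det := by
    have := det_updateCol_sum N r (fun _ => (1 : ℝ))
    rw [hK, this]; simp
  have hKr : ∀ i, K i r = if i = r then (card κ : ℝ) else 0 := by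
    intro i
    rw [hK]
    by_cases h : i = r
    · subst h; simp [hN]
    · simp [hN, h, updateRow_apply, hr]
  have hKo : ∀ i j, i ≠ r → j ≠ r → K i j = L i j := by
    intro i j hi hj
    rw [hK]
    simp [hN, updateCol_apply, updateRow_apply, hi, hj]
  rw [s3, twoBlockTriangular_det _ (fun v => v = r)]
  · have a1 : (K.toSquareBlockProp fun v => v = r).det = card κ := by
      rw [Matrix.det_unique]
      have := (default : {v // v = r}).2
      simp only [toSquareBlockProp, toBlock, submatrix_apply, of_apply]
      rw [this, hKr, if_pos rfl]
    have a2 : (K.toSquareBlockProp fun v => ¬ v = r) = L.toSquareBlockProp (fun v => v ≠ r) := by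
      ext ⟨i, hi⟩ ⟨j, hj⟩
      exact hKo i j hi hj
    rw [a2]
    have a3 : ∀ z w : ℝ, z = card κ →
        c * card κ * (z * w) = c * (card κ) ^ 2 * w := by
      intro z w hz; rw [hz]; ring
    apply a3
    convert a1
  · intro i hi j hj
    rw [hj, hKr, if_neg hi]
open Matrix in
theorem det_dvd {κ : Type*} [Fintype κ] [DecidableEq κ] (L : Matrix κ κ ℤ) (hsym : L.IsSymm)
    (y : κ → ℤ) (t : κ) (n : ℤ)
    (hy : L *ᵥ y = fun i => if i = t then 2 * n else 0) (ht : y t = n)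
    (hg : ∃ a : κ → ℤ, ∑ i, a i * y i = 1) : 2 * n ^ 2 ∣ L.det := by
  obtain ⟨a, ha⟩ := hg
  have hyL : y ᵥ* L = fun i => if i = t then 2 * n else 0 := by
    rw [← hy, ← mulVec_transpose, hsym.eq]
  have cr : ∀ i, L.det * y i = 2 * n * (L.updateCol i (Pi.single t 1)).det := by
    intro i
    have h1 : L.adjugate *ᵥ (L *ᵥ y) = L.det • y := by
      rw [mulVec_mulVec, adjugate_mul, smul_mulVec, one_mulVec]
    have h2 := congrFun h1 i
    rw [hy] at h2
    simp only [Pi.smul_apply, smul_eq_mul] at h2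
    rw [← h2]
    simp only [mulVec, dotProduct, mul_ite, mul_zero]
    rw [sum_ite_eq' ]
    simp only [mem_univ, if_true]
    have : L.adjugate i t = (L.updateCol i (Pi.single t 1)).det := by
      have h3 : L.adjugate i t = L.adjugate t i := by
        have := congrFun (congrFun (adjugate_transpose L) i) t
        rw [hsym.eq] at this
        rw [← this]; rfl
      rw [h3, adjugate_def, of_apply, cramer_apply, hsym.eq]
    rw [this, mul_comm]
  have dv : ∀ i, n ∣ (L.updateCol i (Pi.single t 1)).det := by
    intro i
    set N := L.updateCol i (Pi.single t 1) with hN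
    have h1 : (y ᵥ* N) ᵥ* N.adjugate = N.det • y := by
      rw [vecMul_vecMul, mul_adjugate, vecMul_smul, vecMul_one]
    have h2 : ∀ j, n ∣ (y ᵥ* N) j := by
      intro j
      by_cases hj : j = i
      · subst hj
        simp [vecMul, dotProduct, hN, updateCol_apply, Pi.single_apply, ht]
      · have : (y ᵥ* N) j = (y ᵥ* L) j := by
          simp [vecMul, dotProduct, hN, updateCol_apply, hj]
        rw [this, hyL]
        dsimp only
        split_ifs
        · exact Dvd.intro_left _ rfl
        · exact dvd_zero _
    have h3 : ∀ j, n ∣ N.det * y j := by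
      intro j
      have := congrFun h1 j
      simp only [Pi.smul_apply, smul_eq_mul] at this
      rw [← this]
      exact dvd_sum fun k _ => Dvd.dvd.mul_right (h2 k) _
    have : N.det = ∑ j, a j * (N.det * y j) := by
      calc N.det = N.det * ∑ j, a j * y j := by rw [ha, mul_one]
        _ = _ := by rw [mul_sum]; exact sum_congr rfl fun j _ => by ring
    rw [this]
    exact dvd_sum fun k _ => Dvd.dvd.mul_left (h3 k) _
  have fin : L.det = ∑ j, a j * (L.det * y j) := by
      calc L.det = L.det * ∑ j, a j * y j := by rw [ha, mul_one]
        _ = _ := by rw [mul_sum]; exact sum_congr rfl fun j _ => by ring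
  rw [fin]
  refine dvd_sum fun k _ => Dvd.dvd.mul_left ?_ _
  rw [cr]
  obtain ⟨z, hz⟩ := dv k
  exact ⟨z, by rw [hz]; ring⟩
def nx {Q : Type} (c : Cn Q) : Cn Q := (c.1, c.2 + 1)
def pv {Q : Type} (c : Cn Q) : Cn Q := (c.1, c.2 + 3)
def rv {Q : Type} (c : Cn Q) : Cn Q := (c.1, c.2 + 2)
def isE {Q : Type} (c : Cn Q) : Prop := c.2 = 0 ∨ c.2 = 2
instance {Q : Type} (c : Cn Q) : Decidable (isE c) := by unfold isE; infer_instance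
def crX {Q : Type} (x w : Q → ℤ) (c : Cn Q) : ℤ :=
  if c.2 = 0 ∨ c.2 = 1 then x c.1 + w c.1 else x c.1
def crY {Q : Type} (y h : Q → ℤ) (c : Cn Q) : ℤ :=
  if c.2 = 1 ∨ c.2 = 2 then y c.1 + h c.1 else y c.1
theorem isE_nx {Q : Type} (c : Cn Q) : isE (nx c) ↔ ¬ isE c := by
  obtain ⟨q, i⟩ := c; simp only [isE, nx]; revert i; decide
theorem isE_pv {Q : Type} (c : Cn Q) : isE (pv c) ↔ ¬ isE c := by
  obtain ⟨q, i⟩ := c; simp only [isE, pv]; revert i; decide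
theorem isE_rv {Q : Type} (c : Cn Q) : isE (rv c) ↔ isE c := by
  obtain ⟨q, i⟩ := c; simp only [isE, rv]; revert i; decide
theorem pv_nx {Q : Type} (c : Cn Q) : pv (nx c) = c := by
  obtain ⟨q, i⟩ := c; simp only [pv, nx, Prod.mk.injEq, true_and]; revert i; decide
theorem nx_pv {Q : Type} (c : Cn Q) : nx (pv c) = c := by
  obtain ⟨q, i⟩ := c; simp only [pv, nx, Prod.mk.injEq, true_and]; revert i; decide
theorem rv_rv {Q : Type} (c : Cn Q) : rv (rv c) = c := by
  obtain ⟨q, i⟩ := c; simp only [rv, Prod.mk.injEq, true_and]; revert i; decide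
theorem nx_nx {Q : Type} (c : Cn Q) : nx (nx c) = rv c := by
  obtain ⟨q, i⟩ := c; simp only [nx, rv, Prod.mk.injEq, true_and]; revert i; decide
theorem rv_nx {Q : Type} (c : Cn Q) : rv (nx c) = nx (rv c) := by
  obtain ⟨q, i⟩ := c; simp only [nx, rv, Prod.mk.injEq, true_and]; revert i; decide
theorem nx_rv_pv {Q : Type} (c : Cn Q) : nx (rv c) = pv c := by
  obtain ⟨q, i⟩ := c; simp only [nx, pv, rv, Prod.mk.injEq, true_and]; revert i; decide
structure SqMap (n : ℕ) (Q : Type) where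
  b : Q
  io : Cn Q → Cn Q
  inv : ∀ c, io (io c) = c
  par : ∀ c, isE (io c) ↔ ¬ isE c
  x : Q → ℤ
  y : Q → ℤ
  w : Q → ℤ
  h : Q → ℤ
  ptX : ∀ c, crX x w (io c) = crX x w c
  ptY : ∀ c, crY y h (io c) = crY y h c
  hbw : w b = - (n : ℤ)
  hbh : h b = n
  hpos : ∀ q, 0 < h q
  hwh : ∀ q, q ≠ b → w q = h q
  hgcd : ∀ d : ℕ, (∀ q, (d : ℤ) ∣ h q) → d = 1
  conn : ∀ S : Set Q, S.Nonempty → (∀ c : Cn Q, c.1 ∈ S → (io c).1 ∈ S) → S = Set.univ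
namespace SqMap
variable {n : ℕ} {Q : Type} (M : SqMap n Q)
def rho : Equiv.Perm (Cn Q) where
  toFun c := nx (M.io c)
  invFun c := M.io (pv c)
  left_inv c := by simp [pv_nx, M.inv]
  right_inv c := by simp [M.inv, nx_pv]
theorem rho_apply (c : Cn Q) : M.rho c = nx (M.io c) := rfl
theorem rho_io (c : Cn Q) : M.rho (M.io c) = nx c := by rw [rho_apply, M.inv]
theorem isE_rho (c : Cn Q) : isE (M.rho c) ↔ isE c := by
  rw [rho_apply, isE_nx, M.par, not_not]
def W : Type := Quotient (Equiv.Perm.SameCycle.setoid M.rho)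
def vert (c : Cn Q) : M.W := Quotient.mk _ c
theorem vert_eq {c d : Cn Q} : M.vert c = M.vert d ↔ M.rho.SameCycle c d :=
  ⟨fun h => Quotient.exact h, fun h => Quotient.sound h⟩
theorem vert_rho (c : Cn Q) : M.vert (M.rho c) = M.vert c := by
  rw [vert_eq]; exact Equiv.Perm.sameCycle_apply_left.2 (Equiv.Perm.SameCycle.refl _ _)
theorem vert_io (c : Cn Q) : M.vert (M.io c) = M.vert (nx c) := by
  rw [← M.rho_io c, vert_rho]
theorem isE_of_vert {c d : Cn Q} (hcd : M.vert c = M.vert d) : isE c ↔ isE d := by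
  rw [vert_eq] at hcd
  obtain ⟨k, hk⟩ := hcd
  have key : ∀ k : ℕ, ∀ c, isE ((M.rho ^ k) c) ↔ isE c := by
    intro k
    induction k with
    | zero => intro c; simp
    | succ k ih => intro c; rw [pow_succ, Equiv.Perm.mul_apply, ih, isE_rho]
  cases k with
  | ofNat k => rw [← hk]; simpa using (key k c).symm
  | negSucc k =>
    have : c = (M.rho ^ (k + 1)) d := by
      rw [← hk, zpow_negSucc, ← Equiv.Perm.mul_apply, mul_inv_cancel, Equiv.Perm.one_apply]
    rw [this]; exact key _ _
theorem inv_of_rho {α : Type*} (f : Cn Q → α) (P : Cn Q → Prop)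
    (hP : ∀ c, P (M.rho c) ↔ P c) (hf : ∀ c, P c → f (M.rho c) = f c)
    {c d : Cn Q} (hc : P c) (hcd : M.vert c = M.vert d) : f c = f d := by
  rw [vert_eq] at hcd
  obtain ⟨k, hk⟩ := hcd
  have key : ∀ k : ℕ, ∀ c, (P ((M.rho ^ k) c) ↔ P c) ∧ (P c → f ((M.rho ^ k) c) = f c) := by
    intro k
    induction k with
    | zero => intro c; simp
    | succ k ih =>
      intro c
      rw [pow_succ, Equiv.Perm.mul_apply]
      refine ⟨(ih _).1.trans (hP c), fun h => ?_⟩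
      rw [(ih _).2 ((hP c).2 h), hf c h]
  cases k with
  | ofNat k => rw [← hk]; simpa using ((key k c).2 hc).symm
  | negSucc k =>
    have : c = (M.rho ^ (k + 1)) d := by
      rw [← hk, zpow_negSucc, ← Equiv.Perm.mul_apply, mul_inv_cancel, Equiv.Perm.one_apply]
    rw [this] at hc ⊢
    exact (key _ _).2 ((key _ _).1.1 hc)
def cX (c : Cn Q) : ℤ := crX M.x M.w c
def cY (c : Cn Q) : ℤ := crY M.y M.h c
theorem cY_nx {c : Cn Q} (hc : ¬ isE c) : M.cY (nx c) = M.cY c := by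
  obtain ⟨q, i⟩ := c
  fin_cases i <;> simp_all [isE, cY, crY, nx]
theorem cY_rho {c : Cn Q} (hc : isE c) : M.cY (M.rho c) = M.cY c := by
  rw [rho_apply, cY_nx, cY, M.ptY, cY]
  rw [M.par]; exact not_not.2 hc
theorem cY_vert {c d : Cn Q} (hc : isE c) (hcd : M.vert c = M.vert d) : M.cY c = M.cY d :=
  M.inv_of_rho M.cY isE M.isE_rho (fun c hc => M.cY_rho hc) hc hcd
theorem cX_pv_rho (c : Cn Q) : M.cX (pv (M.rho c)) = M.cX c := by
  rw [rho_apply, pv_nx, cX, M.ptX, cX]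
theorem cX_diff {c : Cn Q} (hc : isE c) :
    M.cX c - M.cX (pv c) = if c.2 = 0 then M.w c.1 else - M.w c.1 := by
  obtain ⟨q, i⟩ := c
  fin_cases i <;> simp_all [isE, cX, crX, pv]
theorem cY_diff {c : Cn Q} (hc : isE c) :
    M.cY c - M.cY (rv c) = if c.2 = 0 then - M.h c.1 else M.h c.1 := by
  obtain ⟨q, i⟩ := c
  fin_cases i <;> simp_all [isE, cY, crY, rv]
theorem vert_ne_rv {c : Cn Q} (hc : isE c) : M.vert c ≠ M.vert (rv c) := by
  intro h
  have h1 := M.cY_vert hc h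
  have h2 := M.cY_diff hc
  have := M.hpos c.1
  split_ifs at h2 <;> omega
theorem cXY_pv (c : Cn Q) : ¬ (M.cX c = M.cX (pv c) ∧ M.cY c = M.cY (pv c)) := by
  obtain ⟨q, i⟩ := c
  have h1 := M.hpos q
  have h2 : M.w q ≠ 0 := by
    by_cases hq : q = M.b
    · subst hq
      have := M.hbw; have := M.hbh
      omega
    · have := M.hwh q hq; omega
  fin_cases i <;> simp [cX, cY, crX, crY, pv] <;> omega
theorem rho_ne (c : Cn Q) : M.rho c ≠ c := by
  intro h
  rw [rho_apply] at h
  have h1 : M.io c = pv c := by rw [← h, pv_nx, h]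
  refine M.cXY_pv c ⟨?_, ?_⟩
  · rw [← h1, cX, cX, M.ptX]
  · rw [← h1, cY, cY, M.ptY]
section Fin
open Classical
variable [Fintype Q]
noncomputable instance : Fintype M.W := Quotient.fintype _
noncomputable instance : DecidableEq M.W := Classical.decEq _
def HV : Type := {w : M.W // ∃ c, M.vert c = w ∧ isE c}
noncomputable instance : Fintype M.HV := by unfold HV; infer_instance
noncomputable instance : DecidableEq M.HV := Classical.decEq _
noncomputable def sz (w : M.W) : ℕ := (Finset.univ.filter fun c => M.vert c = w).card
theorem HV_isE (u : M.HV) {c : Cn Q} (hc : M.vert c = u.1) : isE c := by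
  obtain ⟨d, hd, he⟩ := u.2
  exact (M.isE_of_vert (hc.trans hd.symm)).2 he
def mkH (c : Cn Q) (hc : isE c) : M.HV := ⟨M.vert c, c, rfl, hc⟩
theorem sum_HV {R : Type*} [AddCommMonoid R] (f : M.W → (Cn Q) → R) :
    ∑ u : M.HV, ∑ c, (if M.vert c = u.1 then f u.1 c else 0)
      = ∑ c, if isE c then f (M.vert c) c else 0 := by
  rw [sum_comm]
  refine sum_congr rfl fun c _ => ?_
  split_ifs with hc
  · rw [sum_eq_single (M.mkH c hc)]
    · simp [mkH]
    · intro u _ hu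
      rw [if_neg]
      intro h
      exact hu (Subtype.ext h.symm)
    · simp
  · refine sum_eq_zero fun u _ => ?_
    rw [if_neg]
    intro h; exact hc (M.HV_isE u h)
noncomputable def A (u v : M.W) : ℕ :=
  (Finset.univ.filter fun c => M.vert c = u ∧ M.vert (rv c) = v).card
theorem A_cast {R : Type*} [CommRing R] (u v : M.W) :
    (M.A u v : R) = ∑ c, if M.vert c = u ∧ M.vert (rv c) = v then 1 else 0 := by
  unfold A; simp
theorem sz_cast {R : Type*} [CommRing R] (u : M.W) :
    (M.sz u : R) = ∑ c, if M.vert c = u then 1 else 0 := by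
  unfold sz; simp
theorem sum_A {R : Type*} [CommRing R] (u : M.HV) (f : M.W → R) :
    ∑ v : M.HV, (M.A u.1 v.1 : R) * f v.1
      = ∑ c, if M.vert c = u.1 then f (M.vert (rv c)) else 0 := by
  simp only [A_cast, sum_mul]
  rw [sum_comm]
  refine sum_congr rfl fun c _ => ?_
  split_ifs with hc
  · have he : isE (rv c) := (isE_rv c).2 (M.HV_isE u hc)
    rw [sum_eq_single (M.mkH _ he)]
    · simp [mkH, hc]
    · intro v _ hv
      rw [if_neg, zero_mul]
      rintro ⟨_, h⟩
      exact hv (Subtype.ext h.symm)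
    · simp
  · simp [hc]
theorem A_symm (u v : M.W) : M.A u v = M.A v u := by
  unfold A
  apply card_bij (fun c _ => rv c)
  · intro c hc; simp only [mem_filter, mem_univ, true_and] at hc ⊢
    rw [rv_rv]; exact ⟨hc.2, hc.1⟩
  · intro c _ d _ h
    rw [← rv_rv c, h, rv_rv]
  · intro d hd
    simp only [mem_filter, mem_univ, true_and] at hd
    refine ⟨rv d, ?_, rv_rv d⟩
    simp only [mem_filter, mem_univ, true_and]
    rw [rv_rv]; exact ⟨hd.2, hd.1⟩
theorem A_self (u : M.HV) : M.A u.1 u.1 = 0 := by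
  unfold A
  rw [card_eq_zero, Finset.filter_eq_empty_iff]
  rintro c - ⟨h1, h2⟩
  exact M.vert_ne_rv (M.HV_isE u h1) (h1.trans h2.symm)
noncomputable def L (R : Type*) [CommRing R] : Matrix M.HV M.HV R :=
  Matrix.of fun u v => (if u = v then (M.sz u.1 : R) else 0) - (M.A u.1 v.1 : R)
theorem L_mulVec {R : Type*} [CommRing R] (f : M.W → R) (u : M.HV) :
    ∑ v : M.HV, M.L R u v * f v.1
      = ∑ c, if M.vert c = u.1 then f (M.vert c) - f (M.vert (rv c)) else 0 := by
  simp only [L, Matrix.of_apply, sub_mul, sum_sub_distrib, sum_A, ite_mul, zero_mul,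
    Finset.sum_ite_eq, mem_univ, if_true]
  rw [sz_cast, sum_mul, ← sum_sub_distrib]
  refine sum_congr rfl fun c _ => ?_
  split_ifs with h
  · rw [h]; ring
  · ring
theorem L_symm (R : Type*) [CommRing R] : (M.L R).IsSymm := by
  ext u v
  simp only [L, Matrix.transpose_apply, Matrix.of_apply, M.A_symm v.1 u.1]
  by_cases h : u = v
  · subst h; rfl
  · rw [if_neg h, if_neg (Ne.symm h)]
theorem L_row (R : Type*) [CommRing R] (u : M.HV) : ∑ v, M.L R u v = 0 := by
  have := M.L_mulVec (fun _ => (1 : R)) u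
  simpa using this
theorem L_col (R : Type*) [CommRing R] (v : M.HV) : ∑ u, M.L R u v = 0 := by
  rw [← M.L_row R v]
  refine sum_congr rfl fun u _ => ?_
  exact congrFun (congrFun (M.L_symm R) v) u
theorem kirch (w : M.W) : ∑ c, (if M.vert c = w then M.cX c - M.cX (pv c) else 0) = 0 := by
  have h1 : ∑ c, (if M.vert c = w then M.cX (pv c) else 0)
      = ∑ c, (if M.vert c = w then M.cX c else 0) := by
    rw [← Equiv.sum_comp M.rho]
    refine sum_congr rfl fun c _ => ?_
    rw [M.vert_rho, M.cX_pv_rho]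
  have : ∀ c, (if M.vert c = w then M.cX c - M.cX (pv c) else 0)
    = (if M.vert c = w then M.cX c else 0) - (if M.vert c = w then M.cX (pv c) else 0) := by
    intro c; split_ifs <;> ring
  simp only [this]
  rw [sum_sub_distrib, h1, sub_self]
theorem lap_y (u : M.HV) :
    ∑ c, (if M.vert c = u.1 then M.cY c - M.cY (rv c) else 0)
      = (if M.vert (M.b, 2) = u.1 then 2 * (n : ℤ) else 0)
        - (if M.vert (M.b, 0) = u.1 then 2 * (n : ℤ) else 0) := by
  have h := M.kirch u.1
  have key : ∀ c, (if M.vert c = u.1 then M.cY c - M.cY (rv c) else 0)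
      + (if M.vert c = u.1 then M.cX c - M.cX (pv c) else 0)
      = (if c = (M.b, 2) then (if M.vert (M.b, 2) = u.1 then 2 * (n : ℤ) else 0) else 0)
       + (if c = (M.b, 0) then - (if M.vert (M.b, 0) = u.1 then 2 * (n : ℤ) else 0) else 0) := by
    rintro ⟨q, i⟩
    by_cases hc : M.vert (q, i) = u.1
    · have he := M.HV_isE u hc
      rw [if_pos hc, if_pos hc, M.cX_diff he, M.cY_diff he]
      by_cases hq : q = M.b
      · subst hq
        rcases he with he | he
        · simp only at he
          subst he
          simp [hc, M.hbw, M.hbh]; ring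
        · simp only at he
          subst he
          simp [hc, M.hbw, M.hbh]; ring
      · have := M.hwh q hq
        have n1 : ((q, i) : Cn Q) ≠ (M.b, 2) := fun h => hq (congrArg Prod.fst h)
        have n2 : ((q, i) : Cn Q) ≠ (M.b, 0) := fun h => hq (congrArg Prod.fst h)
        simp only [this, n1, n2, if_false]
        split_ifs <;> ring
    · rw [if_neg hc, if_neg hc]
      split_ifs with h1 h2 h3 h4 h5 <;> simp_all
  have h2 := sum_congr (rfl : (Finset.univ : Finset (Cn Q)) = Finset.univ) (fun c _ => key c)
  rw [sum_add_distrib, h, sum_add_distrib, sum_ite_eq', sum_ite_eq'] at h2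
  simp only [mem_univ, if_true, add_zero] at h2
  rw [h2]; ring
end Fin
end SqMap
theorem sum_ne {κ R : Type*} [Fintype κ] [AddCommMonoid R] (r : κ) [Fintype {v // v ≠ r}]
    (g : κ → R) (hg : g r = 0) : ∑ v, g v = ∑ v : {v // v ≠ r}, g v.1 := by
  classical
  rw [← Finset.add_sum_erase _ _ (mem_univ r), hg, zero_add]
  exact sum_subtype (Finset.univ.erase r) (p := fun v => v ≠ r) (by simp) g
namespace SqMap
open Matrix
variable {n : ℕ} {Q : Type} (M : SqMap n Q)
theorem conn_const {α : Type*} (f : M.W → α)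
    (hf : ∀ c, isE c → f (M.vert c) = f (M.vert (rv c))) {c d : Cn Q}
    (hc : isE c) (hd : isE d) : f (M.vert c) = f (M.vert d) := by
  have h1 : ∀ c : Cn Q, isE c → f (M.vert c) = f (M.vert (c.1, 0)) := by
    rintro ⟨q, i⟩ (h | h)
    · simp only at h; subst h; rfl
    · simp only at h; subst h
      rw [hf _ (Or.inr rfl)]; rfl
  have h2 : ∀ c : Cn Q, ¬ isE c → f (M.vert ((M.io c).1, 0)) = f (M.vert (c.1, 0)) := by
    intro c hc
    have e1 : isE (M.io c) := (M.par c).2 hc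
    have e2 : isE (nx c) := (isE_nx c).2 hc
    rw [← h1 _ e1, M.vert_io, h1 _ e2]; rfl
  have h3 : ∀ c : Cn Q, f (M.vert ((M.io c).1, 0)) = f (M.vert (c.1, 0)) := by
    intro c
    by_cases hc : isE c
    · have := h2 (M.io c) (by rw [M.par]; exact not_not.2 hc)
      rw [M.inv] at this; exact this.symm
    · exact h2 c hc
  have := M.conn {q | f (M.vert (q, 0)) = f (M.vert (c.1, 0))} ⟨c.1, rfl⟩ (by
    intro e he
    simp only [mem_ofPred_eq] at he ⊢
    rw [h3, he])
  have hd1 : d.1 ∈ (Set.univ : Set Q) := trivial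
  rw [← this] at hd1
  rw [h1 c hc, h1 d hd]; exact hd1.symm
section Fin
open Classical
variable [Fintype Q]
noncomputable def ext {R : Type*} [Zero R] (x : M.HV → R) (w : M.W) : R :=
  if h : ∃ c, M.vert c = w ∧ isE c then x ⟨w, h⟩ else 0
theorem ext_val {R : Type*} [Zero R] (x : M.HV → R) (u : M.HV) : M.ext x u.1 = x u := by
  unfold ext; rw [dif_pos u.2]; rfl
theorem quad (x : M.HV → ℝ) : x ⬝ᵥ (M.L ℝ *ᵥ x)
    = (∑ c, if isE c then (M.ext x (M.vert c) - M.ext x (M.vert (rv c))) ^ 2 else 0) / 2 := by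
  have h1 : x ⬝ᵥ (M.L ℝ *ᵥ x)
      = ∑ c, if isE c then M.ext x (M.vert c) * (M.ext x (M.vert c) - M.ext x (M.vert (rv c))) else 0 := by
    rw [← M.sum_HV (fun u c => M.ext x u * (M.ext x (M.vert c) - M.ext x (M.vert (rv c))))]
    unfold dotProduct
    refine sum_congr rfl fun u _ => ?_
    have := M.L_mulVec (M.ext x) u
    have h2 : (M.L ℝ *ᵥ x) u = ∑ v : M.HV, M.L ℝ u v * M.ext x v.1 := by
      unfold mulVec dotProduct
      simp only [M.ext_val]
    rw [h2, this, mul_sum, M.ext_val]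
    refine sum_congr rfl fun c _ => ?_
    split_ifs <;> simp
  have h2 : x ⬝ᵥ (M.L ℝ *ᵥ x)
      = ∑ c, if isE c then M.ext x (M.vert (rv c)) * (M.ext x (M.vert (rv c)) - M.ext x (M.vert c)) else 0 := by
    rw [h1]
    rw [← Equiv.sum_comp (Function.Involutive.toPerm (rv : Cn Q → Cn Q) rv_rv)]
    refine sum_congr rfl fun c _ => ?_
    change (if isE (rv c) then M.ext x (M.vert (rv c)) * (M.ext x (M.vert (rv c)) - M.ext x (M.vert (rv (rv c)))) else 0) = _
    rw [rv_rv]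
    exact if_congr (isE_rv c) rfl rfl
  have h3 : 2 * (x ⬝ᵥ (M.L ℝ *ᵥ x)) = (∑ c, if isE c then (M.ext x (M.vert c) - M.ext x (M.vert (rv c))) ^ 2 else 0) := by
    rw [two_mul]
    nth_rw 1 [h1]
    rw [h2, ← sum_add_distrib]
    refine sum_congr rfl fun c _ => ?_
    split_ifs <;> ring
  linarith
theorem quad_nonneg (x : M.HV → ℝ) : 0 ≤ x ⬝ᵥ (M.L ℝ *ᵥ x) := by
  rw [M.quad]
  apply div_nonneg _ (by norm_num)
  refine Finset.sum_nonneg fun c _ => ?_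
  split_ifs <;> positivity
theorem quad_zero (x : M.HV → ℝ) (h : x ⬝ᵥ (M.L ℝ *ᵥ x) = 0) (u v : M.HV) : x u = x v := by
  rw [M.quad] at h
  have h1 : (∑ c, if isE c then (M.ext x (M.vert c) - M.ext x (M.vert (rv c))) ^ 2 else 0) = 0 := by
    linarith
  rw [Finset.sum_eq_zero_iff_of_nonneg (fun c _ => by split_ifs <;> positivity)] at h1
  have h2 : ∀ c, isE c → M.ext x (M.vert c) = M.ext x (M.vert (rv c)) := by
    intro c hc
    have := h1 c (mem_univ _)
    rw [if_pos hc] at this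
    have := pow_eq_zero_iff (two_ne_zero) |>.1 this
    linarith
  obtain ⟨c, hc, ec⟩ := u.2
  obtain ⟨d, hd, ed⟩ := v.2
  have := M.conn_const (M.ext x) h2 ec ed
  rw [hc, hd, M.ext_val, M.ext_val] at this
  exact this
theorem posdef_add (c : ℝ) (hc : 0 < c) : (M.L ℝ + Matrix.of fun _ _ => c).PosDef := by
  refine Matrix.PosDef.of_dotProduct_mulVec_pos ?_ ?_
  · ext u v
    simp only [conjTranspose_apply, Matrix.add_apply, Matrix.of_apply, star_trivial]
    rw [show M.L ℝ v u = M.L ℝ u v from congrFun (congrFun (M.L_symm ℝ) u) v]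
  · intro x hx
    have e : star x ⬝ᵥ ((M.L ℝ + Matrix.of fun _ _ => c) *ᵥ x) = x ⬝ᵥ (M.L ℝ *ᵥ x) + c * (∑ i, x i) ^ 2 := by
      rw [Matrix.add_mulVec, dotProduct_add, star_trivial]
      congr 1
      simp only [dotProduct, mulVec, Matrix.of_apply, ← mul_sum]
      rw [← sum_mul]; ring
    rw [e]
    have h1 := M.quad_nonneg x
    rcases h1.lt_or_eq with h1 | h1
    · have : 0 ≤ c * (∑ i, x i) ^ 2 := by positivity
      linarith
    · have h2 := M.quad_zero x h1.symm
      obtain ⟨u, hu⟩ : ∃ u, x u ≠ 0 := by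
        by_contra hcon; push Not at hcon; exact hx (funext hcon)
      have h3 : ∑ i, x i = card M.HV * x u := by
        rw [sum_congr rfl (fun i _ => h2 i u)]; simp
      have h4 : (0 : ℝ) < card M.HV := by exact_mod_cast Fintype.card_pos_iff.2 ⟨u⟩
      rw [← h1, h3, zero_add]
      have : (card M.HV : ℝ) * x u ≠ 0 := mul_ne_zero h4.ne' hu
      positivity
theorem posdef_red (r : M.HV) : ((M.L ℝ).toSquareBlockProp (fun v => v ≠ r)).PosDef := by
  refine Matrix.PosDef.of_dotProduct_mulVec_pos ?_ ?_
  · ext u v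
    simp only [conjTranspose_apply, toSquareBlockProp_def, Matrix.of_apply, star_trivial]
    exact congrFun (congrFun (M.L_symm ℝ) u.1) v.1
  · intro x hx
    let z : M.HV → ℝ := fun v => if h : v ≠ r then x ⟨v, h⟩ else 0
    have zr : z r = 0 := by simp [z]
    have zx : ∀ u : {v // v ≠ r}, z u.1 = x u := fun u => by simp only [z]; rw [dif_pos u.2]
    have hs : ∀ g : M.HV → ℝ, g r = 0 → ∑ v, g v = ∑ v : {v // v ≠ r}, g v.1 := fun g hg => sum_ne r g hg
    have e : star x ⬝ᵥ (((M.L ℝ).toSquareBlockProp (fun v => v ≠ r)) *ᵥ x) = z ⬝ᵥ (M.L ℝ *ᵥ z) := by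
      rw [star_trivial]
      unfold dotProduct
      rw [hs _ (by rw [zr, zero_mul])]
      refine sum_congr rfl fun u _ => ?_
      rw [zx]
      congr 1
      unfold mulVec dotProduct
      rw [hs _ (by rw [zr, mul_zero])]
      refine sum_congr rfl fun v _ => ?_
      rw [zx]; rfl
    rw [e]
    rcases (M.quad_nonneg z).lt_or_eq with h1 | h1
    · exact h1
    · exfalso
      apply hx
      funext u
      rw [← zx, M.quad_zero z h1.symm u.1 r, zr]; rfl
theorem trace_red (r : M.HV) : ((M.L ℝ).toSquareBlockProp (fun v => v ≠ r)).trace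
    = (M.L ℝ).trace - M.L ℝ r r := by
  unfold trace
  simp only [diag_apply, toSquareBlockProp_def, Matrix.of_apply]
  rw [eq_sub_iff_add_eq, ← Finset.sum_erase_add _ _ (mem_univ r)]
  congr 1
  exact (sum_subtype _ (p := fun v => v ≠ r) (by simp) (fun v => M.L ℝ v v)).symm
noncomputable def r0 : M.HV := M.mkH (M.b, 0) (Or.inl rfl)
noncomputable def t0 : M.HV := M.mkH (M.b, 2) (Or.inr rfl)
theorem t0_ne : M.t0 ≠ M.r0 := by
  intro h
  exact M.vert_ne_rv (c := (M.b, 2)) (Or.inr rfl) (congrArg Subtype.val h)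
noncomputable def Yv (u : M.HV) : ℤ := M.cY (Classical.choose u.2)
theorem ext_Yv {c : Cn Q} (hc : isE c) : M.ext M.Yv (M.vert c) = M.cY c := by
  have := M.ext_val M.Yv (M.mkH c hc)
  change M.ext M.Yv (M.vert c) = _ at this
  rw [this]
  have hs := Classical.choose_spec (M.mkH c hc).2
  exact (M.cY_vert hc hs.1.symm).symm
noncomputable def tau : ℤ := ((M.L ℤ).toSquareBlockProp (fun v => v ≠ M.r0)).det
theorem L_map (R : Type*) [CommRing R] (u v : M.HV) : M.L R u v = ((M.L ℤ u v : ℤ) : R) := by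
  simp only [L, Matrix.of_apply]; push_cast
  split_ifs <;> simp
theorem tau_cast (R : Type*) [CommRing R] :
    ((M.L R).toSquareBlockProp (fun v => v ≠ M.r0)).det = (M.tau : R) := by
  unfold tau
  have := (RingHom.map_det (Int.castRingHom R) ((M.L ℤ).toSquareBlockProp (fun v => v ≠ M.r0))).symm
  simp only [eq_intCast] at this
  rw [← this]
  congr 1
  ext u v
  simp only [toSquareBlockProp_def, Matrix.of_apply, RingHom.mapMatrix_apply, Matrix.map_apply, eq_intCast]
  exact M.L_map R u.1 v.1
theorem det_add (c : ℝ) : (M.L ℝ + Matrix.of fun _ _ => c).det = c * (card M.HV) ^ 2 * (M.tau : ℝ) := by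
  rw [det_add_const _ M.r0 (M.L_row ℝ) (M.L_col ℝ), M.tau_cast]
theorem card_pos : 0 < card M.HV := Fintype.card_pos_iff.2 ⟨M.r0⟩
theorem det_red (r : M.HV) : ((M.L ℝ).toSquareBlockProp (fun v => v ≠ r)).det = (M.tau : ℝ) := by
  have h1 := M.det_add 1
  rw [det_add_const _ r (M.L_row ℝ) (M.L_col ℝ)] at h1
  have h4 : (0 : ℝ) < card M.HV := by exact_mod_cast M.card_pos
  have : (1 : ℝ) * (card M.HV : ℝ) ^ 2 ≠ 0 := by positivity
  exact mul_left_cancel₀ this h1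
theorem tau_pos : 0 < M.tau := by
  have h := (M.posdef_red M.r0).det_pos
  rw [M.det_red] at h
  exact_mod_cast h
theorem tau_dvd : 2 * (n : ℤ) ^ 2 ∣ M.tau := by
  unfold tau
  let y : {v : M.HV // v ≠ M.r0} → ℤ := fun v => M.Yv v.1 - M.cY (M.b, 0)
  have hY0 : M.Yv M.r0 = M.cY (M.b, 0) := by
    have := M.ext_Yv (c := (M.b, 0)) (Or.inl rfl)
    rw [← this]; exact (M.ext_val M.Yv M.r0).symm
  have hYt : M.Yv M.t0 = M.cY (M.b, 2) := by
    have := M.ext_Yv (c := (M.b, 2)) (Or.inr rfl)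
    rw [← this]; exact (M.ext_val M.Yv M.t0).symm
  refine det_dvd _ ?_ y ⟨M.t0, M.t0_ne⟩ n ?_ ?_ ?_
  · ext u v
    exact congrFun (congrFun (M.L_symm ℤ) u.1) v.1
  · funext u
    have h1 := M.L_mulVec (fun w => M.ext M.Yv w - M.cY (M.b, 0)) u.1
    have h2 : ∑ c, (if M.vert c = u.1.1 then (M.ext M.Yv (M.vert c) - M.cY (M.b, 0)) - (M.ext M.Yv (M.vert (rv c)) - M.cY (M.b, 0)) else 0)
       = ∑ c, (if M.vert c = u.1.1 then M.cY c - M.cY (rv c) else 0) := by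
      refine sum_congr rfl fun c _ => ?_
      split_ifs with h
      · have he := M.HV_isE u.1 h
        rw [M.ext_Yv he, M.ext_Yv ((isE_rv c).2 he)]; ring
      · rfl
    rw [h2, M.lap_y] at h1
    have h3 : ∑ v : M.HV, M.L ℤ u.1 v * (M.ext M.Yv v.1 - M.cY (M.b, 0))
       = (((M.L ℤ).toSquareBlockProp (fun v => v ≠ M.r0)) *ᵥ y) u := by
      unfold mulVec dotProduct
      rw [sum_ne M.r0]
      · refine sum_congr rfl fun v _ => ?_
        rw [M.ext_val]; rfl
      · rw [M.ext_val, hY0, sub_self, mul_zero]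
    rw [← h3, h1]
    have h4 : M.vert (M.b, 0) ≠ u.1.1 := fun h => u.2 (Subtype.ext h.symm)
    rw [if_neg h4, sub_zero]
    by_cases h5 : u = ⟨M.t0, M.t0_ne⟩
    · rw [if_pos h5, if_pos]; rw [h5]; rfl
    · rw [if_neg h5, if_neg]
      intro h; exact h5 (Subtype.ext (Subtype.ext h.symm))
  · simp only [y]
    rw [hYt]
    have := M.cY_diff (c := (M.b, 2)) (Or.inr rfl)
    simp only [M.hbh] at this
    exact this
  · have hd : ∀ d : ℤ, (∀ v, d ∣ y v) → d.natAbs = 1 := by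
      intro d hd
      apply M.hgcd
      have h1 : ∀ u : M.HV, d ∣ M.Yv u - M.cY (M.b, 0) := by
        intro u
        by_cases hu : u = M.r0
        · rw [hu, hY0, sub_self]; exact dvd_zero _
        · exact hd ⟨u, hu⟩
      intro q
      rw [Int.natAbs_dvd]
      have h2 := M.cY_diff (c := (q, 2)) (Or.inr rfl)
      have h3 := h1 (M.mkH (q, 2) (Or.inr rfl))
      have h4 := h1 (M.mkH (q, 0) (Or.inl rfl))
      have e3 : M.Yv (M.mkH (q, 2) (Or.inr rfl)) = M.cY (q, 2) := by
        rw [← M.ext_Yv (c := (q, 2)) (Or.inr rfl)]; exact (M.ext_val M.Yv _).symm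
      have e4 : M.Yv (M.mkH (q, 0) (Or.inl rfl)) = M.cY (q, 0) := by
        rw [← M.ext_Yv (c := (q, 0)) (Or.inl rfl)]; exact (M.ext_val M.Yv _).symm
      rw [e3] at h3; rw [e4] at h4
      have h5 := dvd_sub h3 h4
      have h6 : M.h q = M.cY (q, 2) - M.cY (M.b, 0) - (M.cY (q, 0) - M.cY (M.b, 0)) := by
        simp only [rv] at h2
        have : ((2 : Fin 4) + 2) = 0 := rfl
        rw [this] at h2
        simp at h2
        linarith
      rw [h6]; exact h5
    have hp := (IsPrincipalIdealRing.principal (Ideal.span (Set.range y))).principal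
    obtain ⟨g, hg⟩ := hp
    have h1 : ∀ v, g ∣ y v := by
      intro v
      have : y v ∈ Ideal.span (Set.range y) := Ideal.subset_span ⟨v, rfl⟩
      rw [hg] at this
      exact Ideal.mem_span_singleton.1 this
    have h2 := hd g h1
    have h3 : (1 : ℤ) ∈ Ideal.span (Set.range y) := by
      rw [hg]
      exact Ideal.mem_span_singleton.2 (Int.isUnit_iff_natAbs_eq.2 h2).dvd
    exact Ideal.mem_span_range_iff_exists_fun.1 h3
theorem tau_ge : 2 * (n : ℤ) ^ 2 ≤ M.tau := Int.le_of_dvd M.tau_pos M.tau_dvd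
theorem exists_ker (p : ℕ) [Fact p.Prime] (hp : (p : ℤ) ∣ M.tau) :
    ∃ f : M.W → ZMod p, (∀ u : M.HV, ∑ c, (if M.vert c = u.1 then f (M.vert c) - f (M.vert (rv c)) else 0) = 0)
      ∧ ∃ c d, isE c ∧ isE d ∧ f (M.vert c) ≠ f (M.vert d) := by
  have h0 : ((M.L (ZMod p)).toSquareBlockProp (fun v => v ≠ M.r0)).det = 0 := by
    rw [M.tau_cast]; exact (ZMod.intCast_zmod_eq_zero_iff_dvd _ _).2 hp
  obtain ⟨x, hx, hx2⟩ := Matrix.exists_mulVec_eq_zero_iff.2 h0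
  let z : M.HV → ZMod p := fun v => if h : v ≠ M.r0 then x ⟨v, h⟩ else 0
  have zr : z M.r0 = 0 := by simp [z]
  have zx : ∀ u : {v // v ≠ M.r0}, z u.1 = x u := fun u => by simp only [z]; rw [dif_pos u.2]
  have k1 : ∀ u : M.HV, u ≠ M.r0 → ∑ v, M.L (ZMod p) u v * z v = 0 := by
    intro u hu
    have := congrFun hx2 ⟨u, hu⟩
    unfold mulVec dotProduct at this
    rw [sum_ne M.r0 _ (by rw [zr, mul_zero])]
    simp only [zx]; exact this
  have k2 : ∀ u : M.HV, ∑ v, M.L (ZMod p) u v * z v = 0 := by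
    intro u
    by_cases hu : u = M.r0
    · have e : ∑ u, ∑ v, M.L (ZMod p) u v * z v = 0 := by
        rw [sum_comm]
        refine sum_eq_zero fun v _ => ?_
        rw [← sum_mul, M.L_col, zero_mul]
      rw [← Finset.sum_erase_add _ _ (mem_univ M.r0), sum_eq_zero, zero_add] at e
      · rw [hu]; exact e
      · intro v hv; exact k1 v (Finset.ne_of_mem_erase hv)
    · exact k1 u hu
  refine ⟨M.ext z, ?_, ?_⟩
  · intro u
    rw [← M.L_mulVec (M.ext z) u, ← k2 u]
    simp only [M.ext_val]
  · obtain ⟨u, hu⟩ : ∃ u, x u ≠ 0 := by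
      by_contra hcon; push Not at hcon; exact hx (funext hcon)
    obtain ⟨c, hc, ec⟩ := u.1.2
    refine ⟨c, (M.b, 0), ec, Or.inl rfl, ?_⟩
    have e1 : M.ext z (M.vert (M.b, 0)) = 0 := by rw [← zr]; exact M.ext_val z M.r0
    rw [hc, M.ext_val, e1, zx]; exact hu
theorem exists_ker' (p : ℕ) [Fact p.Prime] :
    ∃ f : M.W → ZMod p, (∀ u : M.HV, ∑ c, (if M.vert c = u.1 then
        (if c.1 = M.b then -1 else 1) * (f (M.vert c) - f (M.vert (rv c))) else 0) = 0)
      ∧ ∃ c d, isE c ∧ isE d ∧ f (M.vert c) ≠ f (M.vert d) := by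
  refine ⟨fun w => ((M.ext M.Yv w : ℤ) : ZMod p), ?_, ?_⟩
  · intro u
    have h := M.kirch u.1
    have h2 : ∑ c, (if M.vert c = u.1 then
        (if c.1 = M.b then -1 else 1) * (M.ext M.Yv (M.vert c) - M.ext M.Yv (M.vert (rv c))) else 0) = 0 := by
      rw [← neg_eq_zero, ← Finset.sum_neg_distrib]
      refine Eq.trans ?_ h
      refine sum_congr rfl fun c _ => ?_
      by_cases hc : M.vert c = u.1
      · have he := M.HV_isE u hc
        rw [if_pos hc, if_pos hc, M.ext_Yv he, M.ext_Yv ((isE_rv c).2 he), M.cX_diff he, M.cY_diff he]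
        by_cases hb : c.1 = M.b
        · rw [if_pos hb, hb, M.hbw, M.hbh]; split_ifs <;> ring
        · rw [if_neg hb, M.hwh _ hb]; split_ifs <;> ring
      · rw [if_neg hc, if_neg hc, neg_zero]
    have h3 := congrArg (Int.cast : ℤ → ZMod p) h2
    push_cast at h3
    exact h3
  · by_contra hcon
    push Not at hcon
    have : p = 1 := by
      apply M.hgcd
      intro q
      have h1 := hcon (q, 2) (q, 0) (Or.inr rfl) (Or.inl rfl)
      rw [M.ext_Yv (c := (q, 2)) (Or.inr rfl), M.ext_Yv (c := (q, 0)) (Or.inl rfl)] at h1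
      have h2 := M.cY_diff (c := (q, 2)) (Or.inr rfl)
      simp only [rv] at h2
      have e : ((2 : Fin 4) + 2) = 0 := rfl
      rw [e] at h2
      simp at h2
      rw [← h2, ← ZMod.intCast_zmod_eq_zero_iff_dvd]
      push_cast
      rw [h1, sub_self]
    have := (Fact.out : p.Prime).one_lt
    omega
end Fin
end SqMap
namespace SqMap
open Matrix
variable {n : ℕ} {Q : Type} (M : SqMap n Q)
def kap (c : Cn Q) : Cn Q := M.io (nx c)
theorem nx_inj {c d : Cn Q} (h : nx c = nx d) : c = d := by
  rw [← pv_nx c, h, pv_nx]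
theorem vert_kap (c : Cn Q) : M.vert (M.kap c) = M.vert (rv c) := by
  unfold kap; rw [M.vert_io, nx_nx]
theorem nx_kap (c : Cn Q) : nx (M.kap c) = M.rho (nx c) := rfl
theorem kap_ne_rv (c : Cn Q) : M.kap c ≠ rv c := by
  intro h
  have h1 : M.rho (nx c) = nx (rv c) := by rw [← nx_kap, h]
  have h2 : M.io (nx c) = rv c := h
  refine M.cXY_pv (rv c) ⟨?_, ?_⟩
  · have : pv (rv c) = nx c := by rw [← nx_nx, pv_nx]
    rw [this, ← h2, cX, cX, M.ptX]
  · have : pv (rv c) = nx c := by rw [← nx_nx, pv_nx]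
    rw [this, ← h2, cY, cY, M.ptY]
theorem four_cases (c : Cn Q) (i : Fin 4) :
    (c.1, i) = c ∨ (c.1, i) = nx c ∨ (c.1, i) = rv c ∨ (c.1, i) = nx (rv c) := by
  obtain ⟨q, j⟩ := c
  simp only [nx, rv, Prod.mk.injEq, true_and]
  revert i j; decide
section Fin
open Classical
variable [Fintype Q]
theorem small_closed (l : List (Cn Q)) (hl : l ≠ [])
    (h : ∀ c ∈ l, ∀ i, ∃ d ∈ l, (M.io (c.1, i)).1 = d.1) : card Q ≤ l.length := by
  have := M.conn {q | q ∈ l.map Prod.fst} (by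
    obtain ⟨c, t, rfl⟩ := List.exists_cons_of_ne_nil hl
    exact ⟨c.1, by simp⟩) (by
    rintro ⟨q, i⟩ hq
    simp only [mem_ofPred_eq, mem_map] at hq ⊢
    obtain ⟨c, hc, rfl⟩ := hq
    obtain ⟨d, hd, e⟩ := h c hc i
    exact ⟨d, hd, e.symm⟩)
  have h2 : (Finset.univ : Finset Q) ⊆ (l.map Prod.fst).toFinset := by
    intro q _
    have : q ∈ (Set.univ : Set Q) := trivial
    rw [← ‹{q | q ∈ l.map Prod.fst} = Set.univ›] at this
    simpa using this
  have h3 := card_le_card h2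
  have h4 := List.toFinset_card_le (l.map Prod.fst)
  rw [length_map] at h4
  exact (card_univ (α := Q) ▸ h3).trans h4
theorem kap_rev2 (hm : 4 ≤ card Q) (c : Cn Q) (h1 : M.kap (M.kap c) = c)
    (h2 : M.kap (M.kap (rv c)) = rv c) : M.kap c ≠ rv (M.kap (rv c)) := by
  intro h
  have h' : M.kap (rv c) = rv (M.kap c) := by rw [h, rv_rv]
  have := M.small_closed [c, M.kap c] (by simp) (by
    have i1 : M.io (nx c) = M.kap c := rfl
    have i2 : M.io (nx (M.kap c)) = c := h1
    have i3 : M.io (nx (rv c)) = rv (M.kap c) := h'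
    have i4 : M.io (nx (rv (M.kap c))) = rv c := by rw [← h']; exact h2
    have j1 := M.inv (nx c); rw [i1] at j1
    have j2 := M.inv (nx (M.kap c)); rw [i2] at j2
    have j3 := M.inv (nx (rv c)); rw [i3] at j3
    have j4 := M.inv (nx (rv (M.kap c))); rw [i4] at j4
    intro d hd i
    simp only [mem_cons, not_mem_nil, or_false] at hd
    simp only [mem_cons, not_mem_nil, or_false, exists_eq_or_imp, exists_eq_left]
    rcases hd with rfl | rfl
    · rcases four_cases d i with h | h | h | h <;> rw [h]
      · rw [j2]; exact Or.inr rfl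
      · rw [i1]; exact Or.inr rfl
      · rw [j4]; exact Or.inr rfl
      · rw [i3]; exact Or.inr rfl
    · rcases four_cases (M.kap c) i with h | h | h | h <;> rw [h]
      · rw [j1]; exact Or.inl rfl
      · rw [i2]; exact Or.inl rfl
      · rw [j3]; exact Or.inl rfl
      · rw [i4]; exact Or.inl rfl)
  simp at this
  omega
theorem kap_rev3 (hm : 4 ≤ card Q) (c : Cn Q) (h1 : M.kap (M.kap (M.kap c)) = c)
    (h2 : M.kap (M.kap (M.kap (rv c))) = rv c) (h3 : M.kap c = rv (M.kap (M.kap (rv c))))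
    (h4 : M.kap (M.kap c) = rv (M.kap (rv c))) : False := by
  have a1 : M.kap (rv c) = rv (M.kap (M.kap c)) := by rw [h4, rv_rv]
  have a2 : M.kap (M.kap (rv c)) = rv (M.kap c) := by rw [h3, rv_rv]
  have := M.small_closed [c, M.kap c, M.kap (M.kap c)] (by simp) (by
    have i1 : M.io (nx c) = M.kap c := rfl
    have i2 : M.io (nx (M.kap c)) = M.kap (M.kap c) := rfl
    have i3 : M.io (nx (M.kap (M.kap c))) = c := h1
    have i4 : M.io (nx (rv c)) = rv (M.kap (M.kap c)) := a1
    have i5 : M.io (nx (rv (M.kap (M.kap c)))) = rv (M.kap c) := by rw [← a1]; exact a2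
    have i6 : M.io (nx (rv (M.kap c))) = rv c := by rw [← a2]; exact h2
    have j1 := M.inv (nx c); rw [i1] at j1
    have j2 := M.inv (nx (M.kap c)); rw [i2] at j2
    have j3 := M.inv (nx (M.kap (M.kap c))); rw [i3] at j3
    have j4 := M.inv (nx (rv c)); rw [i4] at j4
    have j5 := M.inv (nx (rv (M.kap (M.kap c)))); rw [i5] at j5
    have j6 := M.inv (nx (rv (M.kap c))); rw [i6] at j6
    intro d hd i
    simp only [mem_cons, not_mem_nil, or_false] at hd
    simp only [mem_cons, not_mem_nil, or_false, exists_eq_or_imp, exists_eq_left]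
    rcases hd with rfl | rfl | rfl
    · rcases four_cases d i with h | h | h | h <;> rw [h]
      · rw [j3]; exact Or.inr (Or.inr rfl)
      · rw [i1]; exact Or.inr (Or.inl rfl)
      · rw [j6]; exact Or.inr (Or.inl rfl)
      · rw [i4]; exact Or.inr (Or.inr rfl)
    · rcases four_cases (M.kap c) i with h | h | h | h <;> rw [h]
      · rw [j1]; exact (Or.inl rfl)
      · rw [i2]; exact Or.inr (Or.inr rfl)
      · rw [j5]; exact Or.inr (Or.inr rfl)
      · rw [i6]; exact (Or.inl rfl)
    · rcases four_cases (M.kap (M.kap c)) i with h | h | h | h <;> rw [h]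
      · rw [j2]; exact Or.inr (Or.inl rfl)
      · rw [i3]; exact (Or.inl rfl)
      · rw [j4]; exact (Or.inl rfl)
      · rw [i5]; exact Or.inr (Or.inl rfl))
  simp at this
  omega
noncomputable def e2 (c : Cn Q) : ℝ := if M.kap (M.kap c) = c then 1 else 0
noncomputable def e3 (c : Cn Q) : ℝ := if M.kap (M.kap (M.kap c)) = c then 1 else 0
theorem A_ge (hm : 4 ≤ card Q) (c : Cn Q) :
    1 + M.e2 c + M.e2 (rv c) ≤ (M.A (M.vert (rv c)) (M.vert c) : ℝ) := by
  have key : ∀ s : Finset (Cn Q), (∀ d ∈ s, M.vert d = M.vert (rv c) ∧ M.vert (rv d) = M.vert c) →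
      (s.card : ℝ) ≤ (M.A (M.vert (rv c)) (M.vert c) : ℝ) := by
    intro s hs
    unfold A
    exact_mod_cast card_le_card (fun d hd => by
      simp only [mem_filter, mem_univ, true_and]; exact hs d hd)
  have g1 : M.vert (rv c) = M.vert (rv c) ∧ M.vert (rv (rv c)) = M.vert c := ⟨rfl, by rw [rv_rv]⟩
  have g2 : M.kap (M.kap c) = c → M.vert (M.kap c) = M.vert (rv c) ∧ M.vert (rv (M.kap c)) = M.vert c := by
    intro h; exact ⟨M.vert_kap c, by rw [← M.vert_kap, h]⟩
  have g3 : M.kap (M.kap (rv c)) = rv c → M.vert (rv (M.kap (rv c))) = M.vert (rv c) ∧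
      M.vert (rv (rv (M.kap (rv c)))) = M.vert c := by
    intro h; exact ⟨by rw [← M.vert_kap, h], by rw [rv_rv, M.vert_kap, rv_rv]⟩
  have d1 := M.kap_ne_rv c
  have d2 : rv (M.kap (rv c)) ≠ rv c := by
    intro h
    apply M.kap_ne_rv (rv c)
    rw [rv_rv, ← rv_rv (M.kap (rv c)), h, rv_rv]
  unfold e2
  by_cases h2 : M.kap (M.kap c) = c <;> by_cases h3 : M.kap (M.kap (rv c)) = rv c
  · rw [if_pos h2, if_pos h3]
    have d3 := M.kap_rev2 hm c h2 h3
    have := key {rv c, M.kap c, rv (M.kap (rv c))} (by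
      intro d hd
      simp only [mem_insert, mem_singleton] at hd
      rcases hd with rfl | rfl | rfl
      exacts [g1, g2 h2, g3 h3])
    rw [Finset.card_eq_three.2 ⟨_, _, _, d1.symm, d2.symm, d3, rfl⟩] at this
    push_cast at this; linarith
  · rw [if_pos h2, if_neg h3]
    have := key {rv c, M.kap c} (by
      intro d hd
      simp only [mem_insert, mem_singleton] at hd
      rcases hd with rfl | rfl
      exacts [g1, g2 h2])
    rw [card_pair d1.symm] at this
    push_cast at this; linarith
  · rw [if_neg h2, if_pos h3]
    have := key {rv c, rv (M.kap (rv c))} (by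
      intro d hd
      simp only [mem_insert, mem_singleton] at hd
      rcases hd with rfl | rfl
      exacts [g1, g3 h3])
    rw [card_pair d2.symm] at this
    push_cast at this; linarith
  · rw [if_neg h2, if_neg h3]
    have := key {rv c} (by
      intro d hd
      simp only [mem_singleton] at hd
      rcases hd with rfl
      exacts [g1])
    rw [card_singleton] at this
    push_cast at this; linarith
noncomputable def N3 (c : Cn Q) : ℝ :=
  ∑ d, ∑ e, if M.vert d = M.vert (rv c) ∧ M.vert e = M.vert (rv d) ∧ M.vert (rv e) = M.vert c then 1 else 0
theorem N3_ge (hm : 4 ≤ card Q) (c : Cn Q) :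
    M.e3 c + M.e3 (rv c) ≤ M.N3 c := by
  have e : M.N3 c = ((Finset.univ.filter fun p : (Cn Q) × (Cn Q) =>
      M.vert p.1 = M.vert (rv c) ∧ M.vert p.2 = M.vert (rv p.1) ∧ M.vert (rv p.2) = M.vert c).card : ℝ) := by
    unfold N3
    rw [← Finset.sum_product', Finset.univ_product_univ]
    simp
  have key : ∀ s : Finset ((Cn Q) × (Cn Q)), (∀ p ∈ s, M.vert p.1 = M.vert (rv c) ∧ M.vert p.2 = M.vert (rv p.1) ∧ M.vert (rv p.2) = M.vert c) →
      (s.card : ℝ) ≤ M.N3 c := by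
    intro s hs
    rw [e]
    exact_mod_cast card_le_card (fun d hd => by
      simp only [mem_filter, mem_univ, true_and]; exact hs d hd)
  have g1 : M.kap (M.kap (M.kap c)) = c → M.vert (M.kap c) = M.vert (rv c) ∧
      M.vert (M.kap (M.kap c)) = M.vert (rv (M.kap c)) ∧ M.vert (rv (M.kap (M.kap c))) = M.vert c := by
    intro h; exact ⟨M.vert_kap c, M.vert_kap _, by rw [← M.vert_kap, h]⟩
  have g2 : M.kap (M.kap (M.kap (rv c))) = rv c → M.vert (rv (M.kap (M.kap (rv c)))) = M.vert (rv c) ∧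
      M.vert (rv (M.kap (rv c))) = M.vert (rv (rv (M.kap (M.kap (rv c))))) ∧
      M.vert (rv (rv (M.kap (rv c)))) = M.vert c := by
    intro h; exact ⟨by rw [← M.vert_kap, h], by rw [rv_rv, M.vert_kap (M.kap (rv c))], by rw [rv_rv, M.vert_kap, rv_rv]⟩
  unfold e3
  by_cases h2 : M.kap (M.kap (M.kap c)) = c <;> by_cases h3 : M.kap (M.kap (M.kap (rv c))) = rv c
  · rw [if_pos h2, if_pos h3]
    have d3 : ((M.kap c, M.kap (M.kap c)) : (Cn Q) × (Cn Q)) ≠ (rv (M.kap (M.kap (rv c))), rv (M.kap (rv c))) := by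
      intro h
      exact M.kap_rev3 hm c h2 h3 (congrArg Prod.fst h) (congrArg Prod.snd h)
    have := key {(M.kap c, M.kap (M.kap c)), (rv (M.kap (M.kap (rv c))), rv (M.kap (rv c)))} (by
      intro d hd
      simp only [mem_insert, mem_singleton] at hd
      rcases hd with rfl | rfl
      exacts [g1 h2, g2 h3])
    rw [card_pair d3] at this
    push_cast at this; linarith
  · rw [if_pos h2, if_neg h3]
    have := key {(M.kap c, M.kap (M.kap c))} (by
      intro d hd
      simp only [mem_singleton] at hd
      rcases hd with rfl
      exacts [g1 h2])
    rw [card_singleton] at this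
    push_cast at this; linarith
  · rw [if_neg h2, if_pos h3]
    have := key {(rv (M.kap (M.kap (rv c))), rv (M.kap (rv c)))} (by
      intro d hd
      simp only [mem_singleton] at hd
      rcases hd with rfl
      exacts [g2 h3])
    rw [card_singleton] at this
    push_cast at this; linarith
  · rw [if_neg h2, if_neg h3]
    have := key ∅ (by simp)
    simpa using this
end Fin
end SqMap
namespace SqMap
open Matrix
variable {n : ℕ} {Q : Type} (M : SqMap n Q)
section Fin
open Classical
variable [Fintype Q]
noncomputable def AR : Matrix M.HV M.HV ℝ := Matrix.of fun u v => (M.A u.1 v.1 : ℝ)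
noncomputable def dg (u : M.HV) : ℝ := (M.sz u.1 : ℝ)
theorem L_eq : M.L ℝ = diagonal M.dg - M.AR := by
  ext u v
  simp only [L, AR, dg, Matrix.sub_apply, Matrix.of_apply, diagonal_apply]
theorem AR_self (u : M.HV) : M.AR u u = 0 := by
  simp only [AR, Matrix.of_apply, M.A_self u]; simp
theorem AA_apply (u : M.HV) : (M.AR * M.AR) u u
    = ∑ c, if M.vert c = u.1 then (M.A (M.vert (rv c)) (M.vert c) : ℝ) else 0 := by
  rw [Matrix.mul_apply]
  have := M.sum_A (R := ℝ) u (fun v => (M.A v u.1 : ℝ))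
  refine Eq.trans ?_ (this.trans ?_)
  · rfl
  · refine sum_congr rfl fun c _ => ?_
    split_ifs with h
    · rw [h]
    · rfl
theorem AAA_apply (u : M.HV) : (M.AR * M.AR * M.AR) u u
    = ∑ c, if M.vert c = u.1 then M.N3 c else 0 := by
  rw [Matrix.mul_assoc, Matrix.mul_apply]
  have h1 : ∀ v : M.HV, (M.AR * M.AR) v u = ∑ d, if M.vert d = v.1 then (M.A (M.vert (rv d)) u.1 : ℝ) else 0 := by
    intro v
    rw [Matrix.mul_apply]
    exact M.sum_A (R := ℝ) v (fun v => (M.A v u.1 : ℝ))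
  simp only [h1]
  have := M.sum_A (R := ℝ) u (fun w => ∑ d, if M.vert d = w then (M.A (M.vert (rv d)) u.1 : ℝ) else 0)
  refine Eq.trans ?_ (this.trans ?_)
  · rfl
  · refine sum_congr rfl fun c _ => ?_
    split_ifs with h
    · unfold N3
      refine sum_congr rfl fun d _ => ?_
      rw [M.A_cast]
      split_ifs with h2
      · refine sum_congr rfl fun e _ => ?_
        rw [h]
        exact if_congr (by simp [h2]) rfl rfl
      · symm
        refine sum_eq_zero fun e _ => ?_
        rw [if_neg]; tauto
    · rfl
theorem trL : (M.L ℝ).trace = ∑ u, M.dg u := by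
  rw [M.L_eq]
  simp [trace, M.AR_self]
theorem trDA (f : M.HV → ℝ) : (diagonal f * M.AR).trace = 0 := by
  simp [trace, Matrix.diagonal_mul, M.AR_self]
theorem trLL : (M.L ℝ * M.L ℝ).trace = ∑ u, M.dg u ^ 2 + ∑ u, (M.AR * M.AR) u u := by
  rw [M.L_eq, sub_mul, mul_sub, mul_sub]
  simp only [trace_sub]
  rw [trace_mul_comm M.AR, M.trDA, diagonal_mul_diagonal, trace_diagonal]
  simp only [trace, diag_apply, ← pow_two]; ring
theorem trLLL : (M.L ℝ * M.L ℝ * M.L ℝ).trace = ∑ u, M.dg u ^ 3 + 3 * ∑ u, M.dg u * (M.AR * M.AR) u u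
     - ∑ u, (M.AR * M.AR * M.AR) u u := by
  rw [M.L_eq]
  set D := diagonal M.dg with hD
  set B := M.AR with hB
  have e : (D - B) * (D - B) * (D - B) = D * D * D - D * D * B - D * B * D - B * D * D
     + D * B * B + B * D * B + B * B * D - B * B * B := by noncomm_ring
  rw [e]
  simp only [trace_sub, trace_add]
  have z1 : (D * D * B).trace = 0 := by rw [hD, diagonal_mul_diagonal]; exact M.trDA _
  have z2 : (D * B * D).trace = 0 := by rw [trace_mul_comm, ← Matrix.mul_assoc]; exact z1
  have z3 : (B * D * D).trace = 0 := by rw [Matrix.mul_assoc, trace_mul_comm]; exact z1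
  have t1 : (B * D * B).trace = (D * B * B).trace := by rw [trace_mul_comm, Matrix.mul_assoc D, ← trace_mul_comm (B * B), ← Matrix.mul_assoc]
  have t2 : (B * B * D).trace = (D * B * B).trace := by rw [trace_mul_comm, Matrix.mul_assoc D]
  have t3 : (D * B * B).trace = ∑ u, M.dg u * (B * B) u u := by
    rw [Matrix.mul_assoc, hD]; simp [trace, Matrix.diagonal_mul]
  have t4 : (D * D * D).trace = ∑ u, M.dg u ^ 3 := by
    rw [hD, diagonal_mul_diagonal, diagonal_mul_diagonal, trace_diagonal]
    refine sum_congr rfl fun u _ => ?_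
    ring
  rw [z1, z2, z3, t1, t2, t3, t4]
  simp only [trace, diag_apply]; ring
noncomputable def z2 : ℝ := ∑ c, if isE c then M.e2 c else 0
noncomputable def z3 : ℝ := ∑ c, if isE c then M.e3 c else 0
theorem sum_rv (f : Cn Q → ℝ) : ∑ c, (if isE c then f (rv c) else 0) = ∑ c, if isE c then f c else 0 := by
  rw [← Equiv.sum_comp (Function.Involutive.toPerm (rv : Cn Q → Cn Q) rv_rv) (fun c => if isE c then f c else 0)]
  refine sum_congr rfl fun c _ => ?_
  exact if_congr (isE_rv c).symm rfl rfl
theorem e2_nonneg (c : Cn Q) : 0 ≤ M.e2 c := by unfold e2; split_ifs <;> norm_num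
theorem bound2 (hm : 4 ≤ card Q) (W : M.HV → ℝ) (ω : ℝ) (hω : 0 ≤ ω) (hW : ∀ u, W u ≤ - ω) :
    ∑ u, W u * (M.AR * M.AR) u u ≤ ∑ u, W u * M.dg u - 2 * ω * M.z2 := by
  have h1 : ∀ u, W u * (M.AR * M.AR) u u ≤ W u * M.dg u
      - ω * ∑ c, if M.vert c = u.1 then (M.e2 c + M.e2 (rv c)) else 0 := by
    intro u
    have h2 : M.dg u + ∑ c, (if M.vert c = u.1 then (M.e2 c + M.e2 (rv c)) else 0) ≤ (M.AR * M.AR) u u := by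
      rw [M.AA_apply, dg, M.sz_cast, ← sum_add_distrib]
      refine sum_le_sum fun c _ => ?_
      have := M.A_ge hm c
      split_ifs <;> linarith
    have h3 : 0 ≤ ∑ c, (if M.vert c = u.1 then (M.e2 c + M.e2 (rv c)) else 0) := by
      refine Finset.sum_nonneg fun c _ => ?_
      have := M.e2_nonneg c; have := M.e2_nonneg (rv c)
      split_ifs <;> linarith
    set X := ∑ c, (if M.vert c = u.1 then (M.e2 c + M.e2 (rv c)) else 0)
    have := hW u
    nlinarith
  refine (sum_le_sum fun u _ => h1 u).trans ?_
  rw [sum_sub_distrib, ← mul_sum]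
  have h4 := M.sum_HV (fun _ c => M.e2 c + M.e2 (rv c))
  have h5 : ∑ c, (if isE c then M.e2 c + M.e2 (rv c) else 0) = 2 * M.z2 := by
    have : ∀ c, (if isE c then M.e2 c + M.e2 (rv c) else 0) = (if isE c then M.e2 c else 0) + (if isE c then M.e2 (rv c) else 0) := by
      intro c; split_ifs <;> ring
    simp only [this]
    rw [sum_add_distrib, sum_rv, z2]; ring
  rw [h4, h5]; linarith
theorem bound3 (hm : 4 ≤ card Q) : 2 * M.z3 ≤ ∑ u, (M.AR * M.AR * M.AR) u u := by
  simp only [M.AAA_apply]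
  rw [M.sum_HV (fun _ c => M.N3 c)]
  have h5 : ∑ c, (if isE c then M.e3 c + M.e3 (rv c) else 0) = 2 * M.z3 := by
    have : ∀ c, (if isE c then M.e3 c + M.e3 (rv c) else 0) = (if isE c then M.e3 c else 0) + (if isE c then M.e3 (rv c) else 0) := by
      intro c; split_ifs <;> ring
    simp only [this]
    rw [sum_add_distrib, sum_rv, z3]; ring
  rw [← h5]
  refine sum_le_sum fun c _ => ?_
  have := M.N3_ge hm c
  split_ifs <;> linarith
theorem sum_sz : ∑ u, M.dg u = 2 * card Q := by
  have h1 : ∑ u, M.dg u = ∑ c : Cn Q, if isE c then 1 else 0 := by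
    rw [← M.sum_HV (fun _ _ => (1 : ℝ))]
    refine sum_congr rfl fun u _ => ?_
    rw [dg, M.sz_cast]
  rw [h1, sum_prod_type]
  have : ∀ q : Q, ∑ i : Fin 4, (if isE (q, i) then (1 : ℝ) else 0) = 2 := by
    intro q
    rw [Fin.sum_univ_four]
    simp only [isE]
    norm_num [Fin.ext_iff]
  simp only [this]
  simp [mul_comm]
theorem spec_bound (hm : 4 ≤ card Q) (q0 q1 q2 q3 a D ω : ℝ) (ha : 0 < a)
    (hq : ∀ x : ℝ, 0 < x → log x ≤ q0 + q1 * x + q2 * x ^ 2 + q3 * x ^ 3)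
    (hD : ∀ u, M.dg u ≤ D) (hω : 0 ≤ ω) (hω2 : q2 + 3 * q3 * D ≤ - ω) (hq3 : 0 ≤ q3) :
    log (card M.HV) + log M.tau + log a
      ≤ (q0 + q1 * a + q2 * a ^ 2 + q3 * a ^ 3) + q0 * (card M.HV - 1) + q1 * (2 * card Q)
        + ∑ u, (q2 * (M.dg u ^ 2 + M.dg u) + q3 * (M.dg u ^ 3 + 3 * M.dg u ^ 2))
        - 2 * ω * M.z2 - 2 * q3 * M.z3 := by
  have hV : (0 : ℝ) < card M.HV := by exact_mod_cast M.card_pos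
  have ht : (0 : ℝ) < M.tau := by exact_mod_cast M.tau_pos
  set V : ℝ := ((card M.HV : ℕ) : ℝ) with hVdef
  set c : ℝ := a / V with hcdef
  have hc : 0 < c := div_pos ha hV
  have hcV : c * V = a := by rw [hcdef]; field_simp
  have h1 := sp_logdet _ (M.posdef_add c hc) q0 q1 q2 q3 hq
  rw [M.det_add, ← hVdef] at h1
  have e1 : c * V ^ 2 * (M.tau : ℝ) = V * M.tau * a := by rw [← hcV]; ring
  rw [e1, log_mul (by positivity) ha.ne', log_mul hV.ne' ht.ne'] at h1
  set J : Matrix M.HV M.HV ℝ := Matrix.of fun _ _ => c with hJ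
  set L := M.L ℝ with hL
  have LJ : L * J = 0 := by
    ext u v
    rw [Matrix.mul_apply]
    simp only [hJ, Matrix.of_apply, ← sum_mul, hL, M.L_row, zero_mul, Matrix.zero_apply]
  have JL : J * L = 0 := by
    ext u v
    rw [Matrix.mul_apply]
    simp only [hJ, Matrix.of_apply, ← mul_sum, hL, M.L_col, mul_zero, Matrix.zero_apply]
  have JJ : J * J = a • J := by
    ext u v
    rw [Matrix.mul_apply]
    simp only [hJ, Matrix.of_apply, Matrix.smul_apply, smul_eq_mul, sum_const, card_univ, nsmul_eq_mul]
    rw [← hVdef, ← hcV]; ring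
  have tJ : J.trace = a := by
    simp only [trace, diag_apply, hJ, Matrix.of_apply, sum_const, card_univ, nsmul_eq_mul]
    rw [← hVdef, ← hcV]; ring
  have t2 : ((L + J) * (L + J)) = L * L + a • J := by
    rw [add_mul, mul_add, mul_add, LJ, JL, JJ]; simp
  have t3 : ((L + J) * (L + J) * (L + J)) = L * L * L + (a * a) • J := by
    rw [t2, add_mul, mul_add, mul_add, Matrix.mul_assoc L L J, LJ, Matrix.smul_mul, Matrix.smul_mul, JL, JJ, smul_smul]; simp
  rw [t3, t2, trace_add, trace_add, trace_add, trace_smul, trace_smul, tJ, hL, M.trL, M.trLL, M.trLLL, M.sum_sz] at h1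
  simp only [smul_eq_mul] at h1
  have b2 := M.bound2 hm (fun u => q2 + 3 * q3 * M.dg u) ω hω (fun u => by
    have := hD u
    nlinarith)
  have b3 := M.bound3 hm
  have s1 : ∑ u, (q2 + 3 * q3 * M.dg u) * (M.AR * M.AR) u u
      = q2 * ∑ u, (M.AR * M.AR) u u + 3 * q3 * ∑ u, M.dg u * (M.AR * M.AR) u u := by
    rw [mul_sum, mul_sum, ← sum_add_distrib]
    refine sum_congr rfl fun u _ => ?_
    ring
  have s2 : ∑ u, (q2 * (M.dg u ^ 2 + M.dg u) + q3 * (M.dg u ^ 3 + 3 * M.dg u ^ 2))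
     = q2 * ∑ u, M.dg u ^ 2 + q3 * ∑ u, M.dg u ^ 3 + ∑ u, (q2 + 3 * q3 * M.dg u) * M.dg u := by
    rw [mul_sum, mul_sum, ← sum_add_distrib, ← sum_add_distrib]
    refine sum_congr rfl fun u _ => ?_
    ring
  rw [s2]
  rw [s1] at b2
  have b4 := mul_le_mul_of_nonneg_left b3 hq3
  nlinarith [h1, b2, b4]
end Fin
end SqMap
theorem cubic_bound (a r b q0 q1 q2 q3 : ℝ) (ha : 0 < a) (har : a < r) (hrb : r < b)
    (e1 : q1 * (a * b * r) = a * b + a * r + b * r) (e2 : 2 * q2 * (a * b * r) = - (a + b + r))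
    (e3 : 3 * q3 * (a * b * r) = 1)
    (h1 : log a ≤ q0 + q1 * a + q2 * a ^ 2 + q3 * a ^ 3)
    (h2 : log b ≤ q0 + q1 * b + q2 * b ^ 2 + q3 * b ^ 3) (x : ℝ) (hx : 0 < x) :
    log x ≤ q0 + q1 * x + q2 * x ^ 2 + q3 * x ^ 3 := by
  set g : ℝ → ℝ := fun x => q0 + q1 * x + q2 * x ^ 2 + q3 * x ^ 3 - log x with hg
  have hr : 0 < r := ha.trans har
  have hb : 0 < b := hr.trans hrb
  have hd : ∀ x : ℝ, 0 < x → HasDerivAt g ((x - a) * (x - b) * (x - r) / (a * b * r * x)) x := by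
    intro x hx
    have d1 : HasDerivAt g (0 + q1 * 1 + q2 * (2 * x ^ 1 * 1) + q3 * (3 * x ^ 2 * 1) - x⁻¹) x := by
      have i := hasDerivAt_id' x
      exact ((((hasDerivAt_const x q0).add (i.const_mul q1)).add ((i.pow 2).const_mul q2)).add
        ((i.pow 3).const_mul q3)).sub (Real.hasDerivAt_log hx.ne')
    convert d1 using 1
    have p : a * b * r ≠ 0 := by positivity
    rw [div_eq_iff (by positivity)]
    have : (0 + q1 * 1 + q2 * (2 * x ^ 1 * 1) + q3 * (3 * x ^ 2 * 1) - x⁻¹) * (a * b * r * x)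
      = (q1 * (a * b * r)) * x + (2 * q2 * (a * b * r)) * x ^ 2 + (3 * q3 * (a * b * r)) * x ^ 3 - a * b * r := by
      field_simp
      ring
    rw [this, e1, e2, e3]; ring
  have hc : ∀ s : Set ℝ, (∀ x ∈ s, 0 < x) → ContinuousOn g s := fun s hs x hx =>
    (hd x (hs x hx)).continuousAt.continuousWithinAt
  have hdf : ∀ s : Set ℝ, (∀ x ∈ s, 0 < x) → DifferentiableOn ℝ g s := fun s hs x hx =>
    (hd x (hs x hx)).differentiableAt.differentiableWithinAt
  have mono : ∀ u v : ℝ, 0 < u → u ≤ v → (∀ x, u < x → x < v → 0 ≤ (x - a) * (x - b) * (x - r)) → g u ≤ g v := by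
    intro u v hu huv hs
    refine monotoneOn_of_deriv_nonneg (convex_Icc u v) (hc _ fun x hx => hu.trans_le hx.1) (hdf _ fun x hx => by
      rw [interior_Icc] at hx; exact hu.trans hx.1) ?_ (Set.left_mem_Icc.2 huv) (Set.right_mem_Icc.2 huv) huv
    intro x hx
    rw [interior_Icc] at hx
    have hx0 := hu.trans hx.1
    rw [(hd x hx0).deriv]
    exact div_nonneg (hs x hx.1 hx.2) (by positivity)
  have anti : ∀ u v : ℝ, 0 < u → u ≤ v → (∀ x, u < x → x < v → (x - a) * (x - b) * (x - r) ≤ 0) → g v ≤ g u := by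
    intro u v hu huv hs
    refine antitoneOn_of_deriv_nonpos (convex_Icc u v) (hc _ fun x hx => hu.trans_le hx.1) (hdf _ fun x hx => by
      rw [interior_Icc] at hx; exact hu.trans hx.1) ?_ (Set.left_mem_Icc.2 huv) (Set.right_mem_Icc.2 huv) huv
    intro x hx
    rw [interior_Icc] at hx
    have hx0 := hu.trans hx.1
    rw [(hd x hx0).deriv]
    exact div_nonpos_of_nonpos_of_nonneg (hs x hx.1 hx.2) (by positivity)
  have ga : 0 ≤ g a := by simp only [hg]; linarith
  have gb : 0 ≤ g b := by simp only [hg]; linarith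
  suffices 0 ≤ g x by simp only [hg] at this; linarith
  rcases le_total x a with h | h
  · refine ga.trans (anti x a hx h fun y h3 h4 => ?_)
    have t1 : 0 ≤ a - y := by linarith
    have t2 : 0 ≤ b - y := by linarith
    have t3 : 0 ≤ r - y := by linarith
    nlinarith [mul_nonneg (mul_nonneg t1 t2) t3]
  · rcases le_total x r with h' | h'
    · refine ga.trans (mono a x ha h fun y h3 h4 => ?_)
      have t1 : 0 ≤ y - a := by linarith
      have t2 : 0 ≤ b - y := by linarith
      have t3 : 0 ≤ r - y := by linarith
      nlinarith [mul_nonneg (mul_nonneg t1 t2) t3]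
    · rcases le_total x b with h'' | h''
      · refine gb.trans (anti x b hx h'' fun y h3 h4 => ?_)
        have t1 : 0 ≤ y - a := by linarith
        have t2 : 0 ≤ b - y := by linarith
        have t3 : 0 ≤ y - r := by linarith
        nlinarith [mul_nonneg (mul_nonneg t1 t2) t3]
      · refine gb.trans (mono b x hb h'' fun y h3 h4 => ?_)
        have t1 : 0 ≤ y - a := by linarith
        have t2 : 0 ≤ y - b := by linarith
        have t3 : 0 ≤ y - r := by linarith
        nlinarith [mul_nonneg (mul_nonneg t1 t2) t3]
theorem log_one_add_le (x y : ℝ) (hy : 0 < y) (hxy : y < x) : log x ≤ log y + (x - y) / y := by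
  have hx : 0 < x := hy.trans hxy
  have h := log_le_sub_one_of_pos (show 0 < x / y by positivity)
  rw [log_div (by positivity) (by positivity)] at h
  have : x / y - 1 = (x - y) / y := by field_simp
  linarith
theorem log_one_add_ge (x y : ℝ) (hy : 0 < y) (hxy : y < x) : log y + (x - y) / x ≤ log x := by
  have hx : 0 < x := hy.trans hxy
  have h := log_le_sub_one_of_pos (show 0 < y / x by positivity)
  rw [log_div (by positivity) (by positivity)] at h
  have : y / x - 1 = - ((x - y) / x) := by field_simp; ring
  linarith
theorem log7 : (1.9459100 : ℝ) < log 7 ∧ log 7 < 1.9459102 := by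
  have e : log (7 ^ 4 : ℝ) = 4 * log 7 := by rw [log_pow]; norm_num
  have e2 : log (2 ^ 5 * 3 * 5 ^ 2 : ℝ) = 5 * log 2 + log 3 + 2 * log 5 := by
    rw [log_mul (by norm_num) (by norm_num), log_mul (by norm_num) (by norm_num), log_pow, log_pow]; norm_num
  have h1 := log_one_add_le (7 ^ 4) (2 ^ 5 * 3 * 5 ^ 2) (by norm_num) (by norm_num)
  have h2 := log_one_add_ge (7 ^ 4) (2 ^ 5 * 3 * 5 ^ 2) (by norm_num) (by norm_num)
  rw [e, e2] at h1 h2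
  have := log_two_gt_d9; have := log_two_lt_d9
  have := log_three_gt_d9; have := log_three_lt_d9
  have := Real.log_five_gt_d9; have := Real.log_five_lt_d9
  norm_num at *
  constructor <;> linarith
theorem log17 : log 17 < 2.833220 := by
  have e : log (17 ^ 2 : ℝ) = 2 * log 17 := by rw [log_pow]; norm_num
  have e2 : log (2 ^ 5 * 3 ^ 2 : ℝ) = 5 * log 2 + 2 * log 3 := by
    rw [log_mul (by norm_num) (by norm_num), log_pow, log_pow]; norm_num
  have h1 := log_one_add_le (17 ^ 2) (2 ^ 5 * 3 ^ 2) (by norm_num) (by norm_num)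
  rw [e, e2] at h1
  have := log_two_gt_d9; have := log_two_lt_d9
  have := log_three_gt_d9; have := log_three_lt_d9
  norm_num at *
  linarith
theorem log43 : 3.761195 < log 43 := by
  have e : log (2 ^ 3 * 43 : ℝ) = 3 * log 2 + log 43 := by
    rw [log_mul (by norm_num) (by norm_num), log_pow]; norm_num
  have e2 : log (7 ^ 3 : ℝ) = 3 * log 7 := by
    rw [log_pow]; norm_num
  have h1 := log_one_add_ge (2 ^ 3 * 43) (7 ^ 3) (by norm_num) (by norm_num)
  rw [e, e2] at h1
  have := log_two_lt_d9
  have := log7.1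
  norm_num at *
  linarith
theorem logs : (log 2.4 < 0.8754690 ∧ 0.8754683 < log 2.4) ∧ log 5.6 < 1.7227670 ∧
    (log 2.8 < 1.0296197 ∧ 1.0296190 < log 2.8) ∧ log 6.8 < 1.9169300 ∧
    (log 3.2 < 1.1631512 ∧ 1.1631505 < log 3.2) ∧ log 9 < 2.1972250 ∧ 2.1972245 < log 9
    ∧ 8.168485 < log 3528 ∧ 8.215537 < log 3698 ∧ (log 8 < 2.0794417 ∧ 2.0794413 < log 8) := by
  have := log_two_gt_d9; have := log_two_lt_d9
  have := log_three_gt_d9; have := log_three_lt_d9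
  have := Real.log_five_gt_d9; have := Real.log_five_lt_d9
  obtain ⟨_, _⟩ := log7
  have := log17
  have := log43
  have e1 : log 2.4 = 2 * log 2 + log 3 - log 5 := by
    rw [show (2.4 : ℝ) = 2 ^ 2 * 3 / 5 by norm_num, log_div (by norm_num) (by norm_num),
      log_mul (by norm_num) (by norm_num), log_pow]; norm_num
  have e2 : log 5.6 = 2 * log 2 + log 7 - log 5 := by
    rw [show (5.6 : ℝ) = 2 ^ 2 * 7 / 5 by norm_num, log_div (by norm_num) (by norm_num),
      log_mul (by norm_num) (by norm_num), log_pow]; norm_num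
  have e3 : log 2.8 = log 2 + log 7 - log 5 := by
    rw [show (2.8 : ℝ) = 2 * 7 / 5 by norm_num, log_div (by norm_num) (by norm_num),
      log_mul (by norm_num) (by norm_num)]
  have e4 : log 6.8 = log 2 + log 17 - log 5 := by
    rw [show (6.8 : ℝ) = 2 * 17 / 5 by norm_num, log_div (by norm_num) (by norm_num),
      log_mul (by norm_num) (by norm_num)]
  have e5 : log 3.2 = 4 * log 2 - log 5 := by
    rw [show (3.2 : ℝ) = 2 ^ 4 / 5 by norm_num, log_div (by norm_num) (by norm_num), log_pow]; norm_num
  have e6 : log 9 = 2 * log 3 := by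
    rw [show (9 : ℝ) = 3 ^ 2 by norm_num, log_pow]; norm_num
  have e7 : log 3528 = 3 * log 2 + 2 * log 3 + 2 * log 7 := by
    rw [show (3528 : ℝ) = 2 ^ 3 * 3 ^ 2 * 7 ^ 2 by norm_num, 
      log_mul (by norm_num) (by norm_num), log_mul (by norm_num) (by norm_num), log_pow, log_pow, log_pow]; norm_num
  have e8 : log 3698 = log 2 + 2 * log 43 := by
    rw [show (3698 : ℝ) = 2 * 43 ^ 2 by norm_num, 
      log_mul (by norm_num) (by norm_num), log_pow]; norm_num
  have e9 : log 8 = 3 * log 2 := by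
    rw [show (8 : ℝ) = 2 ^ 3 by norm_num, log_pow]; norm_num
  rw [e1, e2, e3, e4, e5, e6, e7, e8, e9]
  norm_num at *
  refine ⟨⟨?_, ?_⟩, ?_, ⟨?_, ?_⟩, ?_, ⟨?_, ?_⟩, ?_, ?_, ?_, ?_, ?_, ?_⟩ <;> linarith
namespace SqMap
open Matrix
variable {n : ℕ} {Q : Type} (M : SqMap n Q)
section Fin
open Classical
variable [Fintype Q]
theorem vert_pow (c : Cn Q) (k : ℕ) : M.vert ((M.rho ^ k) c) = M.vert c := by
  induction k with
  | zero => simp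
  | succ k ih => rw [pow_succ', Equiv.Perm.mul_apply, vert_rho, ih]
theorem exists_pow {c d : Cn Q} (h : M.vert c = M.vert d) : ∃ i : ℕ, (M.rho ^ i) c = d := by
  rw [vert_eq] at h
  obtain ⟨i, _, hi⟩ := h.exists_pow_eq'
  exact ⟨i, hi⟩
theorem exists_period (c : Cn Q) : ∃ k, 0 < k ∧ (M.rho ^ k) c = c := by
  refine ⟨orderOf M.rho, orderOf_pos _, ?_⟩
  rw [pow_orderOf_eq_one]; rfl
theorem sz_of (c : Cn Q) (k : ℕ) (hk : 0 < k) (h1 : (M.rho ^ k) c = c)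
    (h2 : ∀ j, 0 < j → j < k → (M.rho ^ j) c ≠ c) : M.sz (M.vert c) = k := by
  have hmul : ∀ j, (M.rho ^ (k * j)) c = c := by
    intro j
    induction j with
    | zero => simp
    | succ j ih => rw [Nat.mul_succ, pow_add, Equiv.Perm.mul_apply, h1, ih]
  have : (Finset.univ.filter fun d => M.vert d = M.vert c) = (Finset.range k).image (fun i => (M.rho ^ i) c) := by
    ext d
    simp only [mem_filter, mem_univ, true_and, Finset.mem_image, Finset.mem_range]
    constructor
    · intro h
      obtain ⟨i, hi⟩ := M.exists_pow h.symm
      refine ⟨i % k, mod_lt _ hk, ?_⟩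
      rw [← hi]
      conv_rhs => rw [← mod_add_div i k, pow_add, Equiv.Perm.mul_apply, hmul]
    · rintro ⟨i, _, rfl⟩; exact M.vert_pow c i
  unfold sz
  rw [this, Finset.card_image_of_injOn, Finset.card_range]
  have key : ∀ i j, i < j → j < k → (M.rho ^ i) c ≠ (M.rho ^ j) c := by
    intro i j hij hj h
    apply h2 (j - i) (by omega) (by omega)
    apply (M.rho ^ i).injective
    rw [← Equiv.Perm.mul_apply, ← pow_add, h]
    congr 2; omega
  intro i hi j hj h
  simp only [Finset.coe_range, Set.mem_Iio] at hi hj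
  by_contra hne
  rcases lt_or_gt_of_ne hne with h' | h'
  · exact key i j h' hj h
  · exact key j i h' hi h.symm
theorem sz_spec (c : Cn Q) : 0 < M.sz (M.vert c) ∧ (M.rho ^ (M.sz (M.vert c))) c = c ∧
    ∀ j, 0 < j → j < M.sz (M.vert c) → (M.rho ^ j) c ≠ c := by
  have hex := M.exists_period c
  have hs := Nat.find_spec hex
  have hm : ∀ j, 0 < j → j < Nat.find hex → (M.rho ^ j) c ≠ c :=
    fun j h0 hj h => Nat.find_min hex hj ⟨h0, h⟩
  rw [M.sz_of c _ hs.1 hs.2 hm]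
  exact ⟨hs.1, hs.2, hm⟩
theorem two_le_sz (c : Cn Q) : 2 ≤ M.sz (M.vert c) := by
  have h := M.sz_spec c
  by_contra hlt
  have h1 : M.sz (M.vert c) = 1 := by omega
  rw [h1] at h
  exact M.rho_ne c (by simpa using h.2.1)
theorem two_le_sz' (w : M.W) : 2 ≤ M.sz w := by
  induction w using Quotient.inductionOn with
  | h c => exact M.two_le_sz c
def wE (w : M.W) : Prop := ∃ c, M.vert c = w ∧ isE c
theorem wE_vert (c : Cn Q) : M.wE (M.vert c) ↔ isE c :=
  ⟨fun ⟨d, h, e⟩ => (M.isE_of_vert h).1 e, fun h => ⟨c, rfl, h⟩⟩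
noncomputable def nh (k : ℕ) : ℕ := (Finset.univ.filter fun w : M.W => M.wE w ∧ M.sz w = k).card
noncomputable def nv (k : ℕ) : ℕ := (Finset.univ.filter fun w : M.W => ¬ M.wE w ∧ M.sz w = k).card
noncomputable def cV : ℕ := (Finset.univ.filter fun w : M.W => ¬ M.wE w).card
theorem card_HV : card M.HV = (Finset.univ.filter fun w : M.W => M.wE w).card :=
  by
  rw [← Fintype.card_subtype]
  exact Fintype.card_congr (Equiv.refl _)
theorem card_W : card M.W = card M.HV + M.cV := by
  rw [card_HV, cV, card_filter_add_card_filter_not, card_univ]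
theorem sum_vert {R : Type*} [AddCommMonoid R] (g : M.W → R) :
    ∑ c, g (M.vert c) = ∑ w, M.sz w • g w := by
  rw [← Finset.sum_fiberwise (s := Finset.univ) (g := M.vert)]
  refine sum_congr rfl fun w _ => ?_
  rw [sum_congr rfl (g := fun _ => g w) (fun c hc => by
    rw [(Finset.mem_filter.1 hc).2]), sum_const, sz]
theorem sum_HV' {R : Type*} [AddCommMonoid R] (g : M.W → R) :
    ∑ u : M.HV, g u.1 = ∑ w, if M.wE w then g w else 0 := by
  rw [← Finset.sum_filter]
  exact (sum_subtype _ (p := fun w => ∃ c, M.vert c = w ∧ isE c) (by intro x; simp [wE]) g).symm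
theorem sum_odd_sz : ∑ w, (if M.wE w then 0 else M.sz w) = 2 * card Q := by
  have h1 : ∑ w, M.sz w = 4 * card Q := by
    have := M.sum_vert (fun _ => (1 : ℕ))
    simp only [sum_const, card_univ, smul_eq_mul, mul_one, Fintype.card_prod, Fintype.card_fin] at this
    omega
  have h2 : ∑ w, (if M.wE w then M.sz w else 0) = 2 * card Q := by
    have := M.sum_sz
    have h3 := M.sum_HV' (fun w => M.sz w)
    rw [← h3]
    have : ((∑ u : M.HV, M.sz u.1 : ℕ) : ℝ) = ((2 * card Q : ℕ) : ℝ) := by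
      push_cast; exact this
    exact_mod_cast this
  have h3 : ∑ w, M.sz w = ∑ w, (if M.wE w then M.sz w else 0) + ∑ w, (if M.wE w then 0 else M.sz w) := by
    rw [← sum_add_distrib]
    refine sum_congr rfl fun w _ => ?_
    split_ifs <;> simp
  omega
theorem nv_sum (k : ℕ) : M.nv k = ∑ w, (if M.wE w then 0 else if M.sz w = k then 1 else 0) := by
  unfold nv
  rw [card_filter]
  refine sum_congr rfl fun w _ => ?_
  split_ifs <;> simp_all
theorem nh_sum (k : ℕ) : M.nh k = ∑ u : M.HV, (if M.sz u.1 = k then 1 else 0) := by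
  rw [M.sum_HV' (fun w => if M.sz w = k then 1 else 0)]
  unfold nh
  rw [card_filter]
  refine sum_congr rfl fun w _ => ?_
  split_ifs <;> simp_all
theorem cV_sum : M.cV = ∑ w, (if M.wE w then 0 else 1) := by
  unfold cV
  rw [card_filter]
  refine sum_congr rfl fun w _ => ?_
  split_ifs <;> simp_all
theorem nv_ge : 4 * M.cV ≤ 2 * M.nv 2 + M.nv 3 + 2 * card Q := by
  rw [← M.sum_odd_sz, nv_sum, nv_sum, cV_sum, mul_sum, mul_sum, ← sum_add_distrib,
    ← sum_add_distrib]
  refine sum_le_sum fun w _ => ?_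
  have := M.two_le_sz' w
  split_ifs <;> omega
theorem sum_odd_nx (f : Cn Q → ℝ) :
    ∑ c, (if isE c then f (nx c) else 0) = ∑ c, if isE c then 0 else f c := by
  let e : (Cn Q) ≃ (Cn Q) := ⟨nx, pv, pv_nx, nx_pv⟩
  rw [← Equiv.sum_comp e (fun c => if isE c then 0 else f c)]
  refine sum_congr rfl fun c _ => ?_
  have := isE_nx c
  change _ = if isE (nx c) then 0 else f (nx c)
  split_ifs <;> simp_all
theorem z2_eq : (2 : ℝ) * M.nv 2 ≤ M.z2 := by
  have h : M.z2 = ∑ c, if isE c then (fun c => if M.rho (M.rho c) = c then (1 : ℝ) else 0) (nx c) else 0 := by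
    unfold z2
    refine sum_congr rfl fun c _ => ?_
    simp only [e2, ← nx_kap]
    congr 2
    exact propext ⟨fun h => by rw [h], fun h => nx_inj h⟩
  rw [h, sum_odd_nx (f := fun c => if M.rho (M.rho c) = c then (1 : ℝ) else 0), nv_sum]
  have h2 := M.sum_vert (fun w => if M.wE w then (0 : ℝ) else if M.sz w = 2 then 1 else 0)
  have h3 : (2 : ℝ) * ((∑ w, (if M.wE w then 0 else if M.sz w = 2 then 1 else 0) : ℕ) : ℝ)
    = ∑ c, (if M.wE (M.vert c) then (0 : ℝ) else if M.sz (M.vert c) = 2 then 1 else 0) := by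
    rw [h2]
    push_cast
    rw [mul_sum]
    refine sum_congr rfl fun w _ => ?_
    split_ifs with h1 h2 <;> simp [h2]
  rw [h3]
  refine sum_le_sum fun c _ => ?_
  rw [wE_vert]
  split_ifs with h1 h2 h3 <;> norm_num
  apply h3
  have := (M.sz_spec c).2.1
  rw [h2] at this
  simpa [pow_succ] using this
theorem z3_eq : (3 : ℝ) * M.nv 3 ≤ M.z3 := by
  have h : M.z3 = ∑ c, if isE c then (fun c => if M.rho (M.rho (M.rho c)) = c then (1 : ℝ) else 0) (nx c) else 0 := by
    unfold z3
    refine sum_congr rfl fun c _ => ?_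
    simp only [e3, ← nx_kap]
    congr 2
    exact propext ⟨fun h => by rw [h], fun h => nx_inj h⟩
  rw [h, sum_odd_nx (f := fun c => if M.rho (M.rho (M.rho c)) = c then (1 : ℝ) else 0), nv_sum]
  have h2 := M.sum_vert (fun w => if M.wE w then (0 : ℝ) else if M.sz w = 3 then 1 else 0)
  have h3 : (3 : ℝ) * ((∑ w, (if M.wE w then 0 else if M.sz w = 3 then 1 else 0) : ℕ) : ℝ)
    = ∑ c, (if M.wE (M.vert c) then (0 : ℝ) else if M.sz (M.vert c) = 3 then 1 else 0) := by
    rw [h2]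
    push_cast
    rw [mul_sum]
    refine sum_congr rfl fun w _ => ?_
    split_ifs with h1 h2 <;> simp [h2]
  rw [h3]
  refine sum_le_sum fun c _ => ?_
  rw [wE_vert]
  split_ifs with h1 h2 h3 <;> norm_num
  apply h3
  have := (M.sz_spec c).2.1
  rw [h2] at this
  simpa [pow_succ] using this
theorem amgm (t : ℝ) (ht : 0 < t) :
    log (card M.HV) + log M.tau
      ≤ (log t - 1) * (card M.HV - 1) + 2 * card Q / t := by
  have hV : (0 : ℝ) < card M.HV := by exact_mod_cast M.card_pos
  have htau : (0 : ℝ) < M.tau := by exact_mod_cast M.tau_pos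
  set V : ℝ := ((card M.HV : ℕ) : ℝ) with hVdef
  have hc : 0 < t / V := div_pos ht hV
  have hq : ∀ x : ℝ, 0 < x → log x ≤ (log t - 1) + (1 / t) * x + 0 * x ^ 2 + 0 * x ^ 3 := by
    intro x hx
    have := log_le_sub_one_of_pos (div_pos hx ht)
    rw [log_div hx.ne' ht.ne'] at this
    have e : 1 / t * x = x / t := by ring
    rw [e]; linarith
  have h1 := sp_logdet _ (M.posdef_add (t / V) hc) _ _ _ _ hq
  rw [M.det_add, ← hVdef] at h1
  have e1 : t / V * V ^ 2 * (M.tau : ℝ) = V * M.tau * t := by field_simp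
  rw [e1, log_mul (by positivity) ht.ne', log_mul hV.ne' htau.ne', trace_add, M.trL, M.sum_sz] at h1
  have tJ : (Matrix.of fun _ _ => t / V : Matrix M.HV M.HV ℝ).trace = t := by
    simp only [trace, diag_apply, Matrix.of_apply, sum_const, card_univ, nsmul_eq_mul]
    rw [← hVdef]; field_simp
  rw [tJ] at h1
  have e2 : 1 / t * (2 * (card Q : ℝ) + t) = 2 * card Q / t + 1 := by
    field_simp
  rw [e2] at h1
  linarith
theorem amgm_red (t : ℝ) (ht : 0 < t) (r : M.HV) :
    log M.tau
      ≤ (log t - 1) * (card M.HV - 1) + (2 * card Q - M.sz r.1) / t := by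
  have hq : ∀ x : ℝ, 0 < x → log x ≤ (log t - 1) + (1 / t) * x + 0 * x ^ 2 + 0 * x ^ 3 := by
    intro x hx
    have := log_le_sub_one_of_pos (div_pos hx ht)
    rw [log_div hx.ne' ht.ne'] at this
    have e : 1 / t * x = x / t := by ring
    rw [e]; linarith
  have h1 := sp_logdet _ (M.posdef_red r) _ _ _ _ hq
  rw [M.det_red r, M.trace_red r, M.trL, M.sum_sz] at h1
  have e1 : M.L ℝ r r = M.sz r.1 := by simp [L, M.A_self]
  have e2 : (card {v : M.HV // v ≠ r} : ℝ) = card M.HV - 1 := by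
    rw [Fintype.card_subtype_compl, Fintype.card_subtype_eq, Nat.cast_sub M.card_pos]; simp
  rw [e1, e2] at h1
  have e3 : 1 / t * (2 * (card Q : ℝ) - M.sz r.1) = (2 * card Q - M.sz r.1) / t := by ring
  rw [e3] at h1
  linarith
theorem two_le_HV : 2 ≤ card M.HV := by
  have : 1 < card M.HV := Fintype.one_lt_card_iff.2 ⟨_, _, M.t0_ne⟩
  exact this
theorem log_tau (hn : 41 < n) : log 3528 ≤ log M.tau := by
  apply Real.log_le_log (by norm_num)
  have h := M.tau_ge
  have : (3528 : ℤ) ≤ M.tau := by nlinarith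
  exact_mod_cast this
theorem log_tau' (hn : 42 < n) : log 3698 ≤ log M.tau := by
  apply Real.log_le_log (by norm_num)
  have h := M.tau_ge
  have : (3698 : ℤ) ≤ M.tau := by nlinarith
  exact_mod_cast this
theorem amgm_kill (k s : ℕ) (hn : 41 < n) (hV : card M.HV = k + 1) (hk : 0 < k) (hs : 2 * card Q ≤ s)
    (hs0 : 0 < s) (hnum : (s : ℝ) ^ k < (k + 1) * 3528 * (k : ℝ) ^ k) : False := by
  have hk' : (0 : ℝ) < k := by exact_mod_cast hk
  have hs' : (0 : ℝ) < s := by exact_mod_cast hs0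
  have h := M.amgm (s / k) (by positivity)
  rw [hV] at h
  have h2 := M.log_tau hn
  have hs1 : (2 * (card Q : ℝ)) ≤ s := by exact_mod_cast hs
  have h3 : 2 * (card Q : ℝ) / (s / k) ≤ k := by
    rw [div_le_iff₀ (by positivity)]
    have : (k : ℝ) * (s / k) = s := by field_simp
    rw [this]; exact hs1
  have h4 : log ((k + 1) * 3528) ≤ log ((s / k : ℝ) ^ k) := by
    rw [log_mul (by positivity) (by norm_num), log_pow]
    push_cast at h
    ring_nf at h h3 ⊢
    linarith
  rw [Real.log_le_log_iff (by positivity) (by positivity), div_pow, le_div_iff₀ (by positivity)] at h4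
  linarith
theorem amgm_red_kill (k s : ℕ) (hn : 41 < n) (hV : card M.HV = k + 1) (hk : 0 < k) (r : M.HV)
    (hs : 2 * card Q ≤ s + M.sz r.1)
    (hs0 : 0 < s) (hnum : (s : ℝ) ^ k < 3528 * (k : ℝ) ^ k) : False := by
  have hk' : (0 : ℝ) < k := by exact_mod_cast hk
  have hs' : (0 : ℝ) < s := by exact_mod_cast hs0
  have h := M.amgm_red (s / k) (by positivity) r
  rw [hV] at h
  have h2 := M.log_tau hn
  have hs1 : (2 * (card Q : ℝ)) ≤ s + M.sz r.1 := by exact_mod_cast hs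
  have h3 : (2 * (card Q : ℝ) - M.sz r.1) / (s / k) ≤ k := by
    rw [div_le_iff₀ (by positivity)]
    have : (k : ℝ) * (s / k) = s := by field_simp
    rw [this]; linarith
  have h4 : log (3528) ≤ log ((s / k : ℝ) ^ k) := by
    rw [log_pow]
    push_cast at h
    ring_nf at h h3 h2 ⊢
    linarith
  rw [Real.log_le_log_iff (by positivity) (by positivity), div_pow, le_div_iff₀ (by positivity)] at h4
  linarith
theorem reduce1 (hn : 41 < n) (hQ : card Q ≤ 16) (hE : card M.W = card Q + 2)
    (hle : card M.HV ≤ M.cV) : card Q = 16 ∧ (card M.HV = 8 ∨ card M.HV = 9)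
    ∧ ∀ u : M.HV, M.sz u.1 ≤ 9 := by
  have h2 := M.two_le_HV
  have hW := M.card_W
  have hV9 : card M.HV ≤ 9 := by omega
  have A : card Q = 16 := by
    by_contra hne
    have hV8 : card M.HV ≤ 8 := by omega
    obtain ⟨k, hk⟩ : ∃ k, card M.HV = k + 1 := ⟨card M.HV - 1, by omega⟩
    refine M.amgm_kill k 30 hn hk (by omega) (by omega) (by norm_num) ?_
    have h7 : k ≤ 7 := by omega
    have h1 : 1 ≤ k := by omega
    interval_cases k <;> norm_num
  have B : 8 ≤ card M.HV := by
    by_contra hlt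
    obtain ⟨k, hk⟩ : ∃ k, card M.HV = k + 1 := ⟨card M.HV - 1, by omega⟩
    refine M.amgm_kill k 32 hn hk (by omega) (by omega) (by norm_num) ?_
    have h7 : k ≤ 6 := by omega
    have h1 : 1 ≤ k := by omega
    interval_cases k <;> norm_num
  refine ⟨A, by omega, fun u => ?_⟩
  by_contra hlt
  have : card M.HV = 7 + 1 ∨ card M.HV = 8 + 1 := by omega
  rcases this with h | h
  · exact M.amgm_red_kill 7 22 hn h (by norm_num) u (by omega) (by norm_num) (by norm_num)
  · exact M.amgm_red_kill 8 22 hn h (by norm_num) u (by omega) (by norm_num) (by norm_num)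
theorem num (hQ : card Q = 16) (q0 q1 q2 q3 a : ℝ) (D : ℕ) (ω α β p1 p2 : ℝ) (k1 k2 : ℕ) (ha : 0 < a)
    (hq : ∀ x : ℝ, 0 < x → log x ≤ q0 + q1 * x + q2 * x ^ 2 + q3 * x ^ 3)
    (hD : ∀ u : M.HV, M.sz u.1 ≤ D) (hω : 0 ≤ ω) (hω2 : q2 + 3 * q3 * D ≤ - ω) (hq3 : 0 ≤ q3)
    (hf : ∀ d : ℕ, 2 ≤ d → d ≤ D → q2 * ((d : ℝ) ^ 2 + d) + q3 * ((d : ℝ) ^ 3 + 3 * (d : ℝ) ^ 2)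
       ≤ α + β * d - p1 * (if d = k1 then 1 else 0) - p2 * (if d = k2 then 1 else 0)) :
    log (card M.HV) + log M.tau + log a
      ≤ (q0 + q1 * a + q2 * a ^ 2 + q3 * a ^ 3) + q0 * (card M.HV - 1) + 32 * q1
        + α * card M.HV + 32 * β - p1 * M.nh k1 - p2 * M.nh k2 - 4 * ω * M.nv 2 - 6 * q3 * M.nv 3 := by
  have h := M.spec_bound (by omega) q0 q1 q2 q3 a D ω ha hq (fun u => by unfold dg; exact_mod_cast hD u) hω hω2 hq3
  have hs : ∑ u, (q2 * (M.dg u ^ 2 + M.dg u) + q3 * (M.dg u ^ 3 + 3 * M.dg u ^ 2))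
      ≤ α * card M.HV + 32 * β - p1 * M.nh k1 - p2 * M.nh k2 := by
    calc _ ≤ ∑ u : M.HV, (α + β * M.dg u - p1 * (if M.sz u.1 = k1 then 1 else 0) - p2 * (if M.sz u.1 = k2 then 1 else 0)) :=
          sum_le_sum fun u _ => hf (M.sz u.1) (M.two_le_sz' _) (hD u)
      _ = _ := by
        rw [sum_sub_distrib, sum_sub_distrib, sum_add_distrib, ← mul_sum, ← mul_sum,
          ← mul_sum, M.sum_sz, hQ, nh_sum, nh_sum]
        push_cast
        simp only [sum_const, card_univ, nsmul_eq_mul]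
        ring
  have z2 := mul_le_mul_of_nonneg_left M.z2_eq hω
  have z3 := mul_le_mul_of_nonneg_left M.z3_eq hq3
  rw [hQ] at h
  push_cast at h
  linarith
theorem hq1 (x : ℝ) (hx : 0 < x) :
    log x ≤ (-378/625) + (46225/54138) * x + (-296675/2598624) * x ^ 2 + (3125/487242) * x ^ 3 := by
  obtain ⟨⟨_, _⟩, _, ⟨_, _⟩, _, ⟨_, _⟩, _, _⟩ := logs
  refine cubic_bound 2.4 3.867 5.6 _ _ _ _ (by norm_num) (by norm_num) (by norm_num) (by norm_num) (by norm_num) (by norm_num) ?_ ?_ x hx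
  · norm_num at *; linarith
  · norm_num at *; linarith
theorem hq2 (x : ℝ) (hx : 0 < x) :
    log x ≤ (-21867/50000) + (198280/275247) * x + (-59275/733992) * x ^ 2 + (3125/825741) * x ^ 3 := by
  obtain ⟨⟨_, _⟩, _, ⟨_, _⟩, _, ⟨_, _⟩, _, _⟩ := logs
  refine cubic_bound 2.8 4.626 6.8 _ _ _ _ (by norm_num) (by norm_num) (by norm_num) (by norm_num) (by norm_num) (by norm_num) ?_ ?_ x hx
  · norm_num at *; linarith
  · norm_num at *; linarith
theorem hq3 (x : ℝ) (hx : 0 < x) :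
    log x ≤ (-1609/6250) + (10381/17424) * x + (-11255/209088) * x ^ 2 + (625/313632) * x ^ 3 := by
  obtain ⟨⟨_, _⟩, _, ⟨_, _⟩, _, ⟨_, _⟩, _, _⟩ := logs
  refine cubic_bound 3.2 5.808 9 _ _ _ _ (by norm_num) (by norm_num) (by norm_num) (by norm_num) (by norm_num) (by norm_num) ?_ ?_ x hx
  · norm_num at *; linarith
  · norm_num at *; linarith
theorem num_A7 (hQ : card Q = 16) (hD : ∀ u : M.HV, M.sz u.1 ≤ 7) :
    log (card M.HV) + log M.tau + log 3.2 ≤ (5202091/500000) + (746873/5000000) * (card M.HV : ℝ)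
      - (11971/50000) * (M.nh 7 : ℝ) - (0) * (M.nh 7 : ℝ) - (0) * (M.nv 2 : ℝ) - (0) * (M.nv 3 : ℝ) := by
  have h := M.num hQ (-1609/6250) (10381/17424) (-11255/209088) (625/313632) 3.2 7 (0) (2034073/5000000) (-787627/2500000) (11971/50000) (0) 7 7
    (by norm_num) hq3 hD (by norm_num) (by norm_num) (by norm_num)
    (by intro d h1 h2; interval_cases d <;> norm_num)
  have := (cast_nonneg (M.nv 3) : (0 : ℝ) ≤ _)
  have := (cast_nonneg (card M.HV) : (0 : ℝ) ≤ _)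
  norm_num at h ⊢
  linarith
theorem num_A8 (hQ : card Q = 16) (hD : ∀ u : M.HV, M.sz u.1 ≤ 8) :
    log (card M.HV) + log M.tau + log 3.2 ≤ (5202091/500000) + (746873/5000000) * (card M.HV : ℝ)
      - (179589/500000) * (M.nh 8 : ℝ) - (0) * (M.nh 8 : ℝ) - (0) * (M.nv 2 : ℝ) - (0) * (M.nv 3 : ℝ) := by
  have h := M.num hQ (-1609/6250) (10381/17424) (-11255/209088) (625/313632) 3.2 8 (0) (2034073/5000000) (-787627/2500000) (179589/500000) (0) 8 8
    (by norm_num) hq3 hD (by norm_num) (by norm_num) (by norm_num)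
    (by intro d h1 h2; interval_cases d <;> norm_num)
  have := (cast_nonneg (M.nv 3) : (0 : ℝ) ≤ _)
  have := (cast_nonneg (card M.HV) : (0 : ℝ) ≤ _)
  norm_num at h ⊢
  linarith
theorem num_A9 (hQ : card Q = 16) (hD : ∀ u : M.HV, M.sz u.1 ≤ 9) :
    log (card M.HV) + log M.tau + log 3.2 ≤ (5202091/500000) + (746873/5000000) * (card M.HV : ℝ)
      - (59873/125000) * (M.nh 9 : ℝ) - (0) * (M.nh 9 : ℝ) - (0) * (M.nv 2 : ℝ) - (0) * (M.nv 3 : ℝ) := by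
  have h := M.num hQ (-1609/6250) (10381/17424) (-11255/209088) (625/313632) 3.2 9 (0) (2034073/5000000) (-787627/2500000) (59873/125000) (0) 9 9
    (by norm_num) hq3 hD (by norm_num) (by norm_num) (by norm_num)
    (by intro d h1 h2; interval_cases d <;> norm_num)
  have := (cast_nonneg (M.nv 3) : (0 : ℝ) ≤ _)
  have := (cast_nonneg (card M.HV) : (0 : ℝ) ≤ _)
  norm_num at h ⊢
  linarith
theorem num_B6 (hQ : card Q = 16) (hD : ∀ u : M.HV, M.sz u.1 ≤ 6) :
    log (card M.HV) + log M.tau + log 2.8 ≤ (108690567/10000000) + (776067/10000000) * (card M.HV : ℝ)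
      - (121231/1000000) * (M.nh 6 : ℝ) - (0) * (M.nh 6 : ℝ) - (3159/62500) * (M.nv 2 : ℝ) - (11353/500000) * (M.nv 3 : ℝ) := by
  have h := M.num hQ (-21867/50000) (198280/275247) (-59275/733992) (3125/825741) 2.8 6 (3159/250000) (5149467/10000000) (-4265563/10000000) (121231/1000000) (0) 6 6
    (by norm_num) hq2 hD (by norm_num) (by norm_num) (by norm_num)
    (by intro d h1 h2; interval_cases d <;> norm_num)
  have := (cast_nonneg (M.nv 3) : (0 : ℝ) ≤ _)
  have := (cast_nonneg (card M.HV) : (0 : ℝ) ≤ _)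
  norm_num at h ⊢
  linarith
theorem num_B5 (hQ : card Q = 16) (hD : ∀ u : M.HV, M.sz u.1 ≤ 5) :
    log (card M.HV) + log M.tau + log 2.8 ≤ (108690567/10000000) + (776067/10000000) * (card M.HV : ℝ)
      - (47979/1000000) * (M.nh 5 : ℝ) - (0) * (M.nh 5 : ℝ) - (23989/250000) * (M.nv 2 : ℝ) - (11353/500000) * (M.nv 3 : ℝ) := by
  have h := M.num hQ (-21867/50000) (198280/275247) (-59275/733992) (3125/825741) 2.8 5 (23989/1000000) (5149467/10000000) (-4265563/10000000) (47979/1000000) (0) 5 5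
    (by norm_num) hq2 hD (by norm_num) (by norm_num) (by norm_num)
    (by intro d h1 h2; interval_cases d <;> norm_num)
  have := (cast_nonneg (M.nv 3) : (0 : ℝ) ≤ _)
  have := (cast_nonneg (card M.HV) : (0 : ℝ) ≤ _)
  norm_num at h ⊢
  linarith
theorem num_B4 (hQ : card Q = 16) (hD : ∀ u : M.HV, M.sz u.1 ≤ 4) :
    log (card M.HV) + log M.tau + log 2.8 ≤ (108690567/10000000) + (776067/10000000) * (card M.HV : ℝ)
      - (0) * (M.nh 3 : ℝ) - (0) * (M.nh 3 : ℝ) - (35343/250000) * (M.nv 2 : ℝ) - (11353/500000) * (M.nv 3 : ℝ) := by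
  have h := M.num hQ (-21867/50000) (198280/275247) (-59275/733992) (3125/825741) 2.8 4 (35343/1000000) (5149467/10000000) (-4265563/10000000) (0) (0) 3 3
    (by norm_num) hq2 hD (by norm_num) (by norm_num) (by norm_num)
    (by intro d h1 h2; interval_cases d <;> norm_num)
  have := (cast_nonneg (M.nv 3) : (0 : ℝ) ≤ _)
  have := (cast_nonneg (card M.HV) : (0 : ℝ) ≤ _)
  norm_num at h ⊢
  linarith
theorem num_C9 (hQ : card Q = 16) (hD : ∀ u : M.HV, M.sz u.1 ≤ 5) :
    log (card M.HV) + log M.tau + log 2.4 ≤ (28700577/2500000) + (-44437/10000000) * (card M.HV : ℝ)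
      - (18601/250000) * (M.nh 2 : ℝ) - (17961/500000) * (M.nh 5 : ℝ) - (17961/250000) * (M.nv 2 : ℝ) - (38481/1000000) * (M.nv 3 : ℝ) := by
  have h := M.num hQ (-378/625) (46225/54138) (-296675/2598624) (3125/487242) 2.4 5 (17961/1000000) (6003563/10000000) (-2706689/5000000) (18601/250000) (17961/500000) 2 5
    (by norm_num) hq1 hD (by norm_num) (by norm_num) (by norm_num)
    (by intro d h1 h2; interval_cases d <;> norm_num)
  have := (cast_nonneg (M.nv 3) : (0 : ℝ) ≤ _)
  have := (cast_nonneg (card M.HV) : (0 : ℝ) ≤ _)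
  norm_num at h ⊢
  linarith
theorem num_C8 (hQ : card Q = 16) (hD : ∀ u : M.HV, M.sz u.1 ≤ 4) :
    log (card M.HV) + log M.tau + log 2.4 ≤ (5452733/500000) + (674019/10000000) * (card M.HV : ℝ)
      - (17961/1000000) * (M.nh 3 : ℝ) - (0) * (M.nh 3 : ℝ) - (18601/125000) * (M.nv 2 : ℝ) - (38481/1000000) * (M.nv 3 : ℝ) := by
  have h := M.num hQ (-378/625) (46225/54138) (-296675/2598624) (3125/487242) 2.4 4 (18601/500000) (6722019/10000000) (-174781/312500) (17961/1000000) (0) 3 3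
    (by norm_num) hq1 hD (by norm_num) (by norm_num) (by norm_num)
    (by intro d h1 h2; interval_cases d <;> norm_num)
  have := (cast_nonneg (M.nv 3) : (0 : ℝ) ≤ _)
  have := (cast_nonneg (card M.HV) : (0 : ℝ) ≤ _)
  norm_num at h ⊢
  linarith
def cls (a3 a4 a5 b3 b4 b5 : ℕ) : Prop :=
  (∀ w, 3 ≤ M.sz w ∧ M.sz w ≤ 5) ∧ M.nh 3 = a3 ∧ M.nh 4 = a4 ∧ M.nh 5 = a5 ∧ M.nv 3 = b3 ∧ M.nv 4 = b4 ∧ M.nv 5 = b5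
theorem nh_pos (u : M.HV) : 1 ≤ M.nh (M.sz u.1) := by
  unfold nh
  rw [Nat.one_le_iff_ne_zero, ← Nat.pos_iff_ne_zero, Finset.card_pos]
  exact ⟨u.1, Finset.mem_filter.2 ⟨mem_univ _, u.2, rfl⟩⟩
theorem nh_zero {k : ℕ} (h : M.nh k = 0) (u : M.HV) : M.sz u.1 ≠ k := by
  intro hk
  have := M.nh_pos u
  rw [hk] at this; omega
theorem nv_zero {k : ℕ} (h : M.nv k = 0) (w : M.W) (hw : ¬ M.wE w) : M.sz w ≠ k := by
  intro hk
  unfold nv at h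
  rw [card_eq_zero, Finset.filter_eq_empty_iff] at h
  exact h (mem_univ w) ⟨hw, hk⟩
theorem kill7 (hn : 41 < n) (hQ : card Q = 16) (hV : card M.HV = 8 ∨ card M.HV = 9)
    (h9 : ∀ u : M.HV, M.sz u.1 ≤ 9) : ∀ u : M.HV, M.sz u.1 ≤ 6 := by
  have ht := M.log_tau hn
  obtain ⟨⟨_, _⟩, _, ⟨_, _⟩, _, ⟨_, _⟩, l9, l9', l1, l2, l8, l8'⟩ := logs
  have step : ∀ D, (D = 7 ∨ D = 8 ∨ D = 9) → (∀ u : M.HV, M.sz u.1 ≤ D) → ∀ u : M.HV, M.sz u.1 ≠ D := by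
    intro D hD hle u hu
    have h1 := M.nh_pos u
    rw [hu] at h1
    have h1' : (1 : ℝ) ≤ M.nh D := by exact_mod_cast h1
    have hh : log (card M.HV) + log M.tau + log 3.2 ≤ 10.404182 + 0.1493746 * (card M.HV : ℝ)
      - 0.23942 := by
      rcases hD with rfl | rfl | rfl
      · have := M.num_A7 hQ hle
        norm_num at this ⊢; linarith
      · have := M.num_A8 hQ hle
        norm_num at this ⊢; linarith
      · have := M.num_A9 hQ hle
        norm_num at this ⊢; linarith
    rcases hV with hV | hV <;> rw [hV] at hh <;> norm_num at * <;> linarith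
  intro u
  have s9 := step 9 (by norm_num) h9
  have s8 := step 8 (by norm_num) (fun u => by have := h9 u; have := s9 u; omega)
  have s7 := step 7 (by norm_num) (fun u => by have := h9 u; have := s9 u; have := s8 u; omega)
  have := h9 u; have := s9 u; have := s8 u; have := s7 u; omega
theorem odd_sum : 4 * M.cV + ∑ w, (if M.wE w then 0 else M.sz w - 4) = 2 * card Q + 2 * M.nv 2 + M.nv 3 := by
  rw [← M.sum_odd_sz, nv_sum, nv_sum, cV_sum, mul_sum, mul_sum, ← sum_add_distrib,
    ← sum_add_distrib, ← sum_add_distrib]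
  refine sum_congr rfl fun w _ => ?_
  have := M.two_le_sz' w
  split_ifs <;> omega
theorem odd_cls (h2 : M.nv 2 = 0) (h : ∑ w, (if M.wE w then 0 else M.sz w - 4) ≤ 1) :
    (∀ w, ¬ M.wE w → 3 ≤ M.sz w ∧ M.sz w ≤ 5) ∧ M.nv 5 = ∑ w, (if M.wE w then 0 else M.sz w - 4)
      ∧ M.cV = M.nv 3 + M.nv 4 + M.nv 5 := by
  have A : ∀ w, ¬ M.wE w → 3 ≤ M.sz w ∧ M.sz w ≤ 5 := by
    intro w hw
    have h3 := M.nv_zero h2 w hw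
    have h4 := M.two_le_sz' w
    have h5 : (if M.wE w then 0 else M.sz w - 4) ≤ ∑ w, (if M.wE w then 0 else M.sz w - 4) :=
      Finset.single_le_sum (f := fun w => if M.wE w then 0 else M.sz w - 4) (fun _ _ => Nat.zero_le _) (mem_univ w)
    rw [if_neg hw] at h5
    omega
  refine ⟨A, ?_, ?_⟩
  · rw [nv_sum]
    refine sum_congr rfl fun w _ => ?_
    by_cases hw : M.wE w
    · simp [hw]
    · have := A w hw
      simp only [hw, if_false]
      split_ifs <;> omega
  · rw [nv_sum, nv_sum, nv_sum, cV_sum, ← sum_add_distrib, ← sum_add_distrib]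
    refine sum_congr rfl fun w _ => ?_
    by_cases hw : M.wE w
    · simp [hw]
    · have := A w hw
      simp only [hw, if_false]
      split_ifs <;> omega
theorem even_cls (hQ : card Q = 16) (h2 : M.nh 2 = 0) (h : ∀ u : M.HV, M.sz u.1 ≤ 5) :
    (∀ w, M.wE w → 3 ≤ M.sz w ∧ M.sz w ≤ 5) ∧ 32 = 3 * M.nh 3 + 4 * M.nh 4 + 5 * M.nh 5
      ∧ card M.HV = M.nh 3 + M.nh 4 + M.nh 5 := by
  have A : ∀ u : M.HV, 3 ≤ M.sz u.1 ∧ M.sz u.1 ≤ 5 := by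
    intro u
    have h3 := M.nh_zero h2 u
    have h4 := M.two_le_sz' u.1
    have := h u
    omega
  refine ⟨fun w hw => A ⟨w, hw⟩, ?_, ?_⟩
  · have hs : (∑ u : M.HV, M.sz u.1 : ℕ) = 32 := by
      have h1 := M.sum_sz
      rw [hQ] at h1
      have : ((∑ u : M.HV, M.sz u.1 : ℕ) : ℝ) = 32 := by
        push_cast; simp only [dg] at h1; rw [h1]; norm_num
      exact_mod_cast this
    rw [← hs, nh_sum, nh_sum, nh_sum, mul_sum, mul_sum, mul_sum, ← sum_add_distrib, ← sum_add_distrib]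
    refine sum_congr rfl fun u _ => ?_
    have := A u
    split_ifs <;> omega
  · rw [nh_sum, nh_sum, nh_sum, ← sum_add_distrib, ← sum_add_distrib, ← card_univ, Finset.card_eq_sum_ones]
    refine sum_congr rfl fun u _ => ?_
    have := A u
    split_ifs <;> omega
theorem class9 (hn : 41 < n) (hQ : card Q = 16) (hE : card M.W = card Q + 2)
    (hV : card M.HV = 9) (h6 : ∀ u : M.HV, M.sz u.1 ≤ 6) :
    n = 42 ∧ (M.cls 5 3 1 4 5 0 ∨ M.cls 4 5 0 4 5 0 ∨ M.cls 4 5 0 5 3 1) := by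
  have ht := M.log_tau hn
  have LL := logs
  norm_num at LL
  obtain ⟨⟨_, _⟩, _, ⟨_, _⟩, _, ⟨_, _⟩, l9, l9', l1, l2, l8, l8'⟩ := LL
  have hW := M.card_W
  have hos := M.odd_sum
  have hge := M.nv_ge
  have hge' : 4 ≤ 2 * M.nv 2 + M.nv 3 := by omega
  have hgeR : (4 : ℝ) ≤ 2 * M.nv 2 + M.nv 3 := by exact_mod_cast hge'
  have hnn := (cast_nonneg (M.nv 3) : (0 : ℝ) ≤ _)
  have hnn2 := (cast_nonneg (M.nv 2) : (0 : ℝ) ≤ _)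
  have h5 : ∀ u : M.HV, M.sz u.1 ≤ 5 := by
    intro u
    by_contra hlt
    have hu : M.sz u.1 = 6 := by have := h6 u; omega
    have h1 := M.nh_pos u
    rw [hu] at h1
    have h1' : (1 : ℝ) ≤ M.nh 6 := by exact_mod_cast h1
    have hB := M.num_B6 hQ h6
    rw [hV] at hB
    norm_num at hB; linarith
  have hnv2 : M.nv 2 = 0 := by
    by_contra hne
    have h2 : (1 : ℝ) ≤ M.nv 2 := by exact_mod_cast Nat.one_le_iff_ne_zero.2 hne
    have h4 : ∀ u : M.HV, M.sz u.1 ≤ 4 := by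
      intro u
      by_contra hlt
      have hu : M.sz u.1 = 5 := by have := h5 u; omega
      have h1 := M.nh_pos u
      rw [hu] at h1
      have h1' : (1 : ℝ) ≤ M.nh 5 := by exact_mod_cast h1
      have hB := M.num_B5 hQ h5
      rw [hV] at hB
      norm_num at hB; linarith
    have hB := M.num_B4 hQ h4
    rw [hV] at hB
    norm_num at hB; linarith
  have hC := M.num_C9 hQ h5
  rw [hV] at hC
  norm_num at hC
  have p2 := (cast_nonneg (M.nh 2) : (0 : ℝ) ≤ _)
  have p5 := (cast_nonneg (M.nh 5) : (0 : ℝ) ≤ _)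
  have g4 : 4 ≤ M.nv 3 := by omega
  have g4R : (4 : ℝ) ≤ M.nv 3 := by exact_mod_cast g4
  rw [hnv2] at hC
  norm_num at hC
  have hn42 : n = 42 := by
    by_contra hne
    have := M.log_tau' (by omega)
    linarith
  have hnh2 : M.nh 2 = 0 := by
    by_contra hne
    have h2 : (1 : ℝ) ≤ M.nh 2 := by exact_mod_cast Nat.one_le_iff_ne_zero.2 hne
    linarith
  have hs : M.nh 5 + M.nv 3 ≤ 5 := by
    by_contra hlt
    have : (6 : ℝ) ≤ M.nh 5 + M.nv 3 := by exact_mod_cast (by omega : 6 ≤ M.nh 5 + M.nv 3)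
    linarith
  obtain ⟨o1, o2, o3⟩ := M.odd_cls hnv2 (by omega)
  obtain ⟨e1, e2, e3⟩ := M.even_cls hQ hnh2 h5
  refine ⟨hn42, ?_⟩
  have hall : ∀ w, 3 ≤ M.sz w ∧ M.sz w ≤ 5 := fun w => by
    by_cases hw : M.wE w
    · exact e1 w hw
    · exact o1 w hw
  have hcase : M.nh 5 = 1 ∧ M.nv 3 = 4 ∨ M.nh 5 = 0 ∧ M.nv 3 = 4 ∨ M.nh 5 = 0 ∧ M.nv 3 = 5 := by omega
  rcases hcase with h | h | h
  · left; exact ⟨hall, by omega, by omega, by omega, by omega, by omega, by omega⟩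
  · right; left; exact ⟨hall, by omega, by omega, by omega, by omega, by omega, by omega⟩
  · right; right; exact ⟨hall, by omega, by omega, by omega, by omega, by omega, by omega⟩
theorem class8 (hn : 41 < n) (hQ : card Q = 16) (hE : card M.W = card Q + 2)
    (hV : card M.HV = 8) (h6 : ∀ u : M.HV, M.sz u.1 ≤ 6) :
    n = 42 ∧ M.cls 0 8 0 8 2 0 := by
  have ht := M.log_tau hn
  have LL := logs
  norm_num at LL
  obtain ⟨⟨_, _⟩, _, ⟨_, _⟩, _, ⟨_, _⟩, l9, l9', l1, l2, l8, l8'⟩ := LL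
  have hW := M.card_W
  have hos := M.odd_sum
  have hge := M.nv_ge
  have hge' : 8 ≤ 2 * M.nv 2 + M.nv 3 := by omega
  have hgeR : (8 : ℝ) ≤ 2 * M.nv 2 + M.nv 3 := by exact_mod_cast hge'
  have hnn := (cast_nonneg (M.nv 3) : (0 : ℝ) ≤ _)
  have hnn2 := (cast_nonneg (M.nv 2) : (0 : ℝ) ≤ _)
  have h5 : ∀ u : M.HV, M.sz u.1 ≤ 5 := by
    intro u
    by_contra hlt
    have hu : M.sz u.1 = 6 := by have := h6 u; omega
    have h1 := M.nh_pos u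
    rw [hu] at h1
    have h1' : (1 : ℝ) ≤ M.nh 6 := by exact_mod_cast h1
    have hB := M.num_B6 hQ h6
    rw [hV] at hB
    norm_num at hB; linarith
  have h4 : ∀ u : M.HV, M.sz u.1 ≤ 4 := by
    intro u
    by_contra hlt
    have hu : M.sz u.1 = 5 := by have := h5 u; omega
    have h1 := M.nh_pos u
    rw [hu] at h1
    have h1' : (1 : ℝ) ≤ M.nh 5 := by exact_mod_cast h1
    have hB := M.num_B5 hQ h5
    rw [hV] at hB
    norm_num at hB; linarith
  have hC := M.num_C8 hQ h4
  rw [hV] at hC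
  norm_num at hC
  have p2 := (cast_nonneg (M.nh 3) : (0 : ℝ) ≤ _)
  have hnv2 : M.nv 2 = 0 := by
    by_contra hne
    have h2 : (1 : ℝ) ≤ M.nv 2 := by exact_mod_cast Nat.one_le_iff_ne_zero.2 hne
    linarith
  have g4 : 8 ≤ M.nv 3 := by omega
  have g4R : (8 : ℝ) ≤ M.nv 3 := by exact_mod_cast g4
  rw [hnv2] at hC
  norm_num at hC
  have hn42 : n = 42 := by
    by_contra hne
    have := M.log_tau' (by omega)
    linarith
  have hs : M.nv 3 ≤ 8 := by
    by_contra hlt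
    have : (9 : ℝ) ≤ M.nv 3 := by exact_mod_cast (by omega : 9 ≤ M.nv 3)
    linarith
  have h44 : ∀ u : M.HV, M.sz u.1 = 4 := by
    have hs : (∑ u : M.HV, M.sz u.1 : ℕ) = ∑ u : M.HV, 4 := by
      have h1 := M.sum_sz
      rw [hQ] at h1
      have : ((∑ u : M.HV, M.sz u.1 : ℕ) : ℝ) = 32 := by
        push_cast; simp only [dg] at h1; rw [h1]; norm_num
      simp only [sum_const, card_univ, hV]
      exact_mod_cast this
    intro u
    exact (Finset.sum_eq_sum_iff_of_le (fun u _ => h4 u)).1 hs u (mem_univ u)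
  have z : ∀ k, k ≠ 4 → M.nh k = 0 := by
    intro k hk
    rw [nh_sum]
    refine sum_eq_zero fun u _ => ?_
    rw [h44 u, if_neg (Ne.symm hk)]
  obtain ⟨o1, o2, o3⟩ := M.odd_cls hnv2 (by omega)
  obtain ⟨e1, e2, e3⟩ := M.even_cls hQ (z 2 (by norm_num)) h5
  have hall : ∀ w, 3 ≤ M.sz w ∧ M.sz w ≤ 5 := fun w => by
    by_cases hw : M.wE w
    · exact e1 w hw
    · exact o1 w hw
  have := z 3 (by norm_num)
  have := z 5 (by norm_num)
  exact ⟨hn42, hall, by omega, by omega, by omega, by omega, by omega, by omega⟩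
noncomputable def sg (c : Cn Q) : Cn Q := if c.1 = M.b then pv c else nx c
noncomputable def sg' (c : Cn Q) : Cn Q := if c.1 = M.b then nx c else pv c
theorem sg_fst (c : Cn Q) : (M.sg c).1 = c.1 := by unfold sg; split_ifs <;> rfl
theorem sg'_fst (c : Cn Q) : (M.sg' c).1 = c.1 := by unfold sg'; split_ifs <;> rfl
theorem sg_sg' (c : Cn Q) : M.sg (M.sg' c) = c := by
  unfold sg; rw [sg'_fst]; unfold sg'
  split_ifs <;> simp [pv_nx, nx_pv]
theorem sg'_sg (c : Cn Q) : M.sg' (M.sg c) = c := by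
  unfold sg'; rw [sg_fst]; unfold sg
  split_ifs <;> simp [pv_nx, nx_pv]
theorem isE_sg (c : Cn Q) : isE (M.sg c) ↔ ¬ isE c := by
  unfold sg; split_ifs <;> simp [isE_nx, isE_pv]
theorem isE_sg' (c : Cn Q) : isE (M.sg' c) ↔ ¬ isE c := by
  unfold sg'; split_ifs <;> simp [isE_nx, isE_pv]
theorem nx_sg (c : Cn Q) : nx (M.sg c) = M.sg (nx c) := by
  unfold sg; rw [show (nx c).1 = c.1 from rfl]; split_ifs <;> simp [pv_nx, nx_pv]
noncomputable def rX (q : Q) : ℤ := if q = M.b then - M.y q else - M.y q - M.h q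
noncomputable def rW (q : Q) : ℤ := if q = M.b then - M.h q else M.h q
noncomputable def rY (q : Q) : ℤ := if q = M.b then M.x q + M.w q else M.x q
noncomputable def rH (q : Q) : ℤ := if q = M.b then - M.w q else M.w q
theorem rot_X (c : Cn Q) : crX M.rX M.rW c = - M.cY (M.sg' c) := by
  obtain ⟨q, i⟩ := c
  unfold sg' crX rX rW cY crY pv nx
  by_cases hq : q = M.b
  · fin_cases i <;> simp [hq] <;> ring
  · fin_cases i <;> simp [hq] <;> ring
theorem rot_Y (c : Cn Q) : crY M.rY M.rH c = M.cX (M.sg' c) := by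
  obtain ⟨q, i⟩ := c
  unfold sg' crY rY rH cX crX pv nx
  by_cases hq : q = M.b
  · fin_cases i <;> simp [hq] 
  · fin_cases i <;> simp [hq]
noncomputable def rot : SqMap n Q where
  b := M.b
  io c := M.sg (M.io (M.sg' c))
  inv c := by rw [sg'_sg, M.inv, sg_sg']
  par c := by rw [isE_sg, M.par, isE_sg', not_not]
  x := M.rX
  y := M.rY
  w := M.rW
  h := M.rH
  ptX c := by rw [rot_X, rot_X, sg'_sg]; unfold cY; rw [M.ptY]
  ptY c := by rw [rot_Y, rot_Y, sg'_sg]; unfold cX; rw [M.ptX]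
  hbw := by simp [rW, M.hbh]
  hbh := by simp [rH, M.hbw]
  hpos q := by
    unfold rH; split_ifs with h
    · rw [h, M.hbw]
      have h1 := M.hpos M.b
      rw [M.hbh] at h1; omega
    · rw [M.hwh q h]; exact M.hpos q
  hwh q hq := by simp [rW, rH, hq, M.hwh q hq]
  hgcd d hd := by
    apply M.hgcd
    intro q
    have h := hd q
    unfold rH at h
    split_ifs at h with hq
    · rw [hq, M.hbw, neg_neg] at h; rw [hq, M.hbh]; exact h
    · rw [← M.hwh q hq]; exact h
  conn S hS hc := by
    apply M.conn S hS
    intro c h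
    have := hc (M.sg c) (by rw [sg_fst]; exact h)
    rwa [sg_fst, sg'_sg] at this
theorem rot_rho (c : Cn Q) : M.rot.rho (M.sg c) = M.sg (M.rho c) := by
  rw [rho_apply, rho_apply, ← nx_sg]
  change nx (M.sg (M.io (M.sg' (M.sg c)))) = _
  rw [sg'_sg]
theorem rot_pow (k : ℕ) (c : Cn Q) : (M.rot.rho ^ k) (M.sg c) = M.sg ((M.rho ^ k) c) := by
  induction k with
  | zero => simp
  | succ k ih => rw [pow_succ', pow_succ', Equiv.Perm.mul_apply, Equiv.Perm.mul_apply, ih, rot_rho]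
theorem sg_inj {c d : Cn Q} (h : M.sg c = M.sg d) : c = d := by
  rw [← M.sg'_sg c, h, sg'_sg]
theorem rot_vert (c d : Cn Q) : M.rot.vert (M.sg c) = M.rot.vert (M.sg d) ↔ M.vert c = M.vert d := by
  constructor
  · intro h
    obtain ⟨i, hi⟩ := M.rot.exists_pow h
    rw [rot_pow] at hi
    rw [← M.sg_inj hi, vert_pow]
  · intro h
    obtain ⟨i, hi⟩ := M.exists_pow h
    rw [← hi, ← rot_pow, vert_pow]
noncomputable def rotW : M.W ≃ M.rot.W where
  toFun := Quotient.lift (fun c => M.rot.vert (M.sg c)) (fun c d h => (M.rot_vert c d).2 (M.vert_eq.2 h))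
  invFun := Quotient.lift (fun c => M.vert (M.sg' c)) (fun c d h => by
    rw [← M.rot_vert, sg_sg', sg_sg']; exact M.rot.vert_eq.2 h)
  left_inv w := by
    induction w using Quotient.inductionOn with
    | h c => change M.vert (M.sg' (M.sg c)) = M.vert c; rw [sg'_sg]
  right_inv w := by
    induction w using Quotient.inductionOn with
    | h c => change M.rot.vert (M.sg (M.sg' c)) = M.rot.vert c; rw [sg_sg']
theorem rotW_vert (c : Cn Q) : M.rotW (M.vert c) = M.rot.vert (M.sg c) := rfl
theorem rotW_sz (w : M.W) : M.rot.sz (M.rotW w) = M.sz w := by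
  induction w using Quotient.inductionOn with
  | h c =>
    change M.rot.sz (M.rotW (M.vert c)) = M.sz (M.vert c)
    have h := M.sz_spec c
    rw [rotW_vert]
    refine M.rot.sz_of _ _ h.1 ?_ ?_
    · rw [rot_pow, h.2.1]
    · intro j h0 hj hh
      rw [rot_pow] at hh
      exact h.2.2 j h0 hj (M.sg_inj hh)
theorem rotW_wE (w : M.W) : M.rot.wE (M.rotW w) ↔ ¬ M.wE w := by
  induction w using Quotient.inductionOn with
  | h c =>
    change M.rot.wE (M.rotW (M.vert c)) ↔ ¬ M.wE (M.vert c)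
    rw [rotW_vert, wE_vert, wE_vert, isE_sg]
theorem rot_nh (k : ℕ) : M.rot.nh k = M.nv k := by
  unfold nh nv
  symm
  apply card_bij (fun w _ => M.rotW w)
  · intro w hw; simpa [rotW_wE, rotW_sz] using hw
  · intro w _ v _ h; exact M.rotW.injective h
  · intro v hv
    refine ⟨M.rotW.symm v, ?_, by simp⟩
    have h1 := M.rotW_wE (M.rotW.symm v)
    have h2 := M.rotW_sz (M.rotW.symm v)
    rw [Equiv.apply_symm_apply] at h1 h2
    simp only [mem_filter, mem_univ, true_and] at hv ⊢
    rw [← h2]; exact ⟨h1.1 hv.1, hv.2⟩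
theorem rot_nv (k : ℕ) : M.rot.nv k = M.nh k := by
  unfold nh nv
  symm
  apply card_bij (fun w _ => M.rotW w)
  · intro w hw; simpa [rotW_wE, rotW_sz] using hw
  · intro w _ v _ h; exact M.rotW.injective h
  · intro v hv
    refine ⟨M.rotW.symm v, ?_, by simp⟩
    have h1 := M.rotW_wE (M.rotW.symm v)
    have h2 := M.rotW_sz (M.rotW.symm v)
    rw [Equiv.apply_symm_apply] at h1 h2
    simp only [mem_filter, mem_univ, true_and] at hv ⊢
    rw [← h2]; exact ⟨by tauto, hv.2⟩
theorem rot_cV : M.rot.cV = card M.HV := by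
  rw [card_HV]
  unfold cV
  symm
  apply card_bij (fun w _ => M.rotW w)
  · intro w hw; simpa [rotW_wE, rotW_sz] using hw
  · intro w _ v _ h; exact M.rotW.injective h
  · intro v hv
    refine ⟨M.rotW.symm v, ?_, by simp⟩
    have h1 := M.rotW_wE (M.rotW.symm v)
    rw [Equiv.apply_symm_apply] at h1
    simp only [mem_filter, mem_univ, true_and] at hv ⊢
    tauto
theorem rot_cW : card M.rot.W = card M.W := (Fintype.card_congr M.rotW).symm
theorem rot_cls {a3 a4 a5 b3 b4 b5 : ℕ} (h : M.cls a3 a4 a5 b3 b4 b5) : M.rot.cls b3 b4 b5 a3 a4 a5 := by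
  obtain ⟨h0, h1, h2, h3, h4, h5, h6⟩ := h
  unfold cls
  simp only [rot_nh, rot_nv]
  refine ⟨fun w => ?_, h4, h5, h6, h1, h2, h3⟩
  have := M.rotW_sz (M.rotW.symm w)
  rw [Equiv.apply_symm_apply] at this
  rw [this]; exact h0 _
theorem classes (hn : 41 < n) (hQ : card Q ≤ 16) (hE : card M.W = card Q + 2) :
    n = 42 ∧ card Q = 16 ∧ ∃ N : SqMap n Q, N.cls 5 3 1 4 5 0 ∨ N.cls 4 5 0 4 5 0 ∨ N.cls 0 8 0 8 2 0 := by
  have main : ∀ M : SqMap n Q, card M.W = card Q + 2 → card M.HV ≤ M.cV →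
    n = 42 ∧ card Q = 16 ∧ ∃ N : SqMap n Q, N.cls 5 3 1 4 5 0 ∨ N.cls 4 5 0 4 5 0 ∨ N.cls 0 8 0 8 2 0 := by
    intro M hE hle
    obtain ⟨h16, hV, h9⟩ := M.reduce1 hn hQ hE hle
    have h6 := M.kill7 hn h16 hV h9
    rcases hV with hV | hV
    · obtain ⟨a, b⟩ := M.class8 hn h16 hE hV h6
      exact ⟨a, h16, M, Or.inr (Or.inr b)⟩
    · obtain ⟨a, b | b | b⟩ := M.class9 hn h16 hE hV h6
      · exact ⟨a, h16, M, Or.inl b⟩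
      · exact ⟨a, h16, M, Or.inr (Or.inl b)⟩
      · exact ⟨a, h16, M.rot, Or.inl (M.rot_cls b)⟩
  by_cases hle : card M.HV ≤ M.cV
  · exact main M hE hle
  · refine main M.rot (by rw [rot_cW, hE]) ?_
    rw [rot_cV]
    have h1 := M.rot.card_W
    have h2 := M.card_W
    rw [rot_cV, rot_cW] at h1
    omega
end Fin
end SqMap
namespace Srch
def mem (x : Nat) : List Nat → Bool
  | [] => false
  | y :: t => cond (Nat.beq x y) true (mem x t)
def labs : List (Nat × Nat) → List Nat
  | [] => []
  | q :: t => match labs t with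
    | L => match (cond (mem q.1 L) L (q.1 :: L)) with
      | L' => cond (mem q.2 L') L' (q.2 :: L')
def comb (p a b : Nat) : List Nat → List Nat → List Nat
  | x :: s, y :: r => ((a * x + (p - 1) * b * y) % p) :: comb p a b s r
  | _, _ => []
def piv (p : Nat) : List (List Nat) → List (List Nat) → Option (Nat × List Nat × List (List Nat))
  | _, [] => none
  | acc, [] :: t => piv p acc t
  | acc, (a :: r) :: t => cond (Nat.beq (a % p) 0) (piv p ((a :: r) :: acc) t) (some (a, r, acc ++ t))
def elimRows (p a : Nat) (r : List Nat) : List (List Nat) → List (List Nat)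
  | [] => []
  | [] :: t => elimRows p a r t
  | (b :: s) :: t => cond (Nat.beq b 0) s (comb p a b s r) :: elimRows p a r t
def fN (n : Nat) (k : Nat → Bool) : Bool := Nat.rec (k 0) (fun m _ => k (Nat.succ m)) n
def fQ : List (Nat × Nat) → (List (Nat × Nat) → Bool) → Bool
  | [], k => k []
  | q :: t, k => fN q.1 fun a => fN q.2 fun b => fQ t fun r => k ((a, b) :: r)
def fL : List Nat → (List Nat → Bool) → Bool
  | [], k => k []
  | q :: t, k => fN q fun a => fL t fun r => k (a :: r)
def fR : List (List Nat) → (List (List Nat) → Bool) → Bool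
  | [], k => k []
  | q :: t, k => fL q fun a => fR t fun r => k (a :: r)
def elim (p : Nat) : Nat → List (List Nat) → Bool
  | 0, _ => true
  | k + 1, rows => fR rows fun rows => match piv p [] rows with
    | none => false
    | some (a, r, rest) => elim p k (elimRows p a r rest)
def nb (r : Nat) : List (Nat × Nat) → List Nat
  | [] => []
  | q :: t => cond (Nat.beq q.1 r) (q.2 :: nb r t) (cond (Nat.beq q.2 r) (q.1 :: nb r t) (nb r t))
def cnt (c : Nat) : List Nat → Nat
  | [] => 0
  | x :: t => cond (Nat.beq x c) (cnt c t + 1) (cnt c t)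
def row (p r : Nat) (N : List Nat) : List Nat → List Nat
  | [] => []
  | c :: t => (cond (Nat.beq c r) (N.length % p) (((p - 1) * cnt c N) % p)) :: row p r N t
def chkp (p : Nat) (qs : List (Nat × Nat)) : Bool :=
  fL (labs qs) fun L => match L with
  | [] => false
  | _ :: L => elim p L.length (L.map fun r => row p r (nb r qs) L)
def allQ (f : Nat × Nat → Bool) : List (Nat × Nat) → Bool
  | [] => true
  | q :: t => and (f q) (allQ f t)
def leafOK (qs : List (Nat × Nat)) : Bool := fQ qs fun qs =>
  or (chkp 7 qs) (or (chkp 2 qs) (or (chkp 3 qs) (allQ (fun q => chkp 5 (q :: q :: q :: qs)) qs)))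
theorem beq_iff (a b : ℕ) : Nat.beq a b = true ↔ a = b := Nat.beq_eq ▸ Iff.rfl
theorem cond_beq {α : Type*} (a b : ℕ) (x y : α) : cond (Nat.beq a b) x y = if a = b then x else y := by
  by_cases h : a = b
  · rw [(beq_iff a b).2 h, if_pos h]; rfl
  · have : Nat.beq a b = false := by
      rw [← Bool.not_eq_true, beq_iff]; exact h
    rw [this, if_neg h]; rfl
theorem fN_eq (n : ℕ) (k : ℕ → Bool) : fN n k = k n := by cases n <;> rfl
theorem fQ_eq (l : List (ℕ × ℕ)) : ∀ k, fQ l k = k l := by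
  induction l with
  | nil => intro k; rfl
  | cons q t ih => intro k; simp [fQ, fN_eq, ih]
theorem fL_eq (l : List ℕ) : ∀ k, fL l k = k l := by
  induction l with
  | nil => intro k; rfl
  | cons q t ih => intro k; simp [fL, fN_eq, ih]
theorem fR_eq (l : List (List ℕ)) : ∀ k, fR l k = k l := by
  induction l with
  | nil => intro k; rfl
  | cons q t ih => intro k; simp [fR, fL_eq, ih]
theorem mem_iff (x : ℕ) (l : List ℕ) : mem x l = true ↔ x ∈ l := by
  induction l with
  | nil => simp [mem]
  | cons y t ih =>
    rw [mem, cond_beq]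
    by_cases h : x = y <;> simp [h, ih]
def ins (a : ℕ) (L : List ℕ) : List ℕ := cond (mem a L) L (a :: L)
theorem ins_mem (a : ℕ) (L : List ℕ) (x : ℕ) : x ∈ ins a L ↔ x = a ∨ x ∈ L := by
  unfold ins
  cases h : mem a L
  · simp
  · have := (mem_iff a L).1 h
    simp; intro h; subst h; exact this
theorem ins_nodup (a : ℕ) (L : List ℕ) (h : L.Nodup) : (ins a L).Nodup := by
  unfold ins
  cases h' : mem a L
  · have : a ∉ L := by rw [← mem_iff, h']; simp
    simp [this, h]
  · simpa
theorem labs_cons (q : ℕ × ℕ) (t) : labs (q :: t) = ins q.2 (ins q.1 (labs t)) := rfl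
theorem labs_nodup (qs) : (labs qs).Nodup := by
  induction qs with
  | nil => simp [labs]
  | cons q t ih => rw [labs_cons]; exact ins_nodup _ _ (ins_nodup _ _ ih)
theorem labs_mem (qs : List (ℕ × ℕ)) (x : ℕ) : x ∈ labs qs ↔ ∃ q ∈ qs, x = q.1 ∨ x = q.2 := by
  induction qs with
  | nil => simp [labs]
  | cons q t ih => rw [labs_cons, ins_mem, ins_mem, ih]; simp only [exists_mem_cons_iff]; rw [or_left_comm, or_assoc]
section Z
variable {p : ℕ} [Fact p.Prime]
def dot (p : ℕ) : List ℕ → List (ZMod p) → ZMod p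
  | a :: s, y :: t => (a : ZMod p) * y + dot p s t
  | _, _ => 0
theorem p1 : ((p - 1 : ℕ) : ZMod p) = -1 := by
  have := (Fact.out : p.Prime).one_lt
  rw [Nat.cast_sub this.le]; simp
theorem comb_len (a b : ℕ) : ∀ (s r : List ℕ), s.length = r.length → (comb p a b s r).length = r.length := by
  intro s
  induction s with
  | nil => intro r h; cases r <;> simp_all [comb]
  | cons x s ih => intro r h; cases r with
    | nil => simp at h
    | cons y r => simp [comb]; exact ih r (by simpa using h)
theorem comb_dot (a b : ℕ) : ∀ (s r : List ℕ) (ys : List (ZMod p)), s.length = r.length →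
    dot p (comb p a b s r) ys = a * dot p s ys - b * dot p r ys := by
  intro s
  induction s with
  | nil => intro r ys h; cases r <;> simp_all [comb, dot]
  | cons x s ih => intro r ys h; cases r with
    | nil => simp at h
    | cons y r =>
      cases ys with
      | nil => simp [comb, dot]
      | cons z ys =>
        simp only [comb, dot]
        rw [ih r ys (by simpa using h), ZMod.natCast_mod]
        push_cast
        rw [p1]; ring
theorem piv_spec : ∀ (rows acc : List (List ℕ)) (a r rest), piv p acc rows = some (a, r, rest) →
    (a : ZMod p) ≠ 0 ∧ (a :: r) ∈ rows ∧ ∀ s ∈ rest, s ∈ acc ∨ s ∈ rows := by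
  intro rows
  induction rows with
  | nil => intro acc a r rest h; simp [piv] at h
  | cons x t ih =>
    intro acc a r rest h
    cases x with
    | nil =>
      rw [piv] at h
      obtain ⟨h1, h2, h3⟩ := ih _ _ _ _ h
      exact ⟨h1, by simp [h2], fun s hs => by rcases h3 s hs with h | h <;> simp [h]⟩
    | cons b x =>
      rw [piv, cond_beq] at h
      split_ifs at h with hb
      · obtain ⟨h1, h2, h3⟩ := ih _ _ _ _ h
        refine ⟨h1, by simp [h2], fun s hs => ?_⟩
        rcases h3 s hs with h | h
        · simp at h; rcases h with h | h <;> simp [h]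
        · simp [h]
      · simp only [Option.some.injEq, Prod.mk.injEq] at h
        obtain ⟨rfl, rfl, rfl⟩ := h
        refine ⟨?_, by simp, fun s hs => ?_⟩
        · rw [Ne, ZMod.natCast_eq_zero_iff]; intro h; exact hb (Nat.mod_eq_zero_of_dvd h)
        · simp at hs; rcases hs with h | h <;> simp [h]
theorem elimRows_spec (a : ℕ) (r : List ℕ) (rest : List (List ℕ)) (s : List ℕ)
    (hs : s ∈ elimRows p a r rest) : ∃ b s', (b :: s') ∈ rest ∧ ((b = 0 ∧ s = s') ∨ s = comb p a b s' r) := by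
  induction rest with
  | nil => simp [elimRows] at hs
  | cons x t ih =>
    cases x with
    | nil => rw [elimRows] at hs; obtain ⟨b, s', h1, h2⟩ := ih hs; exact ⟨b, s', by simp [h1], h2⟩
    | cons b x =>
      rw [elimRows, cond_beq, mem_cons] at hs
      rcases hs with hs | hs
      · refine ⟨b, x, by simp, ?_⟩
        split_ifs at hs with h
        · exact Or.inl ⟨h, hs⟩
        · exact Or.inr hs
      · obtain ⟨b, s', h1, h2⟩ := ih hs; exact ⟨b, s', by simp [h1], h2⟩
theorem elim_spec : ∀ (k : ℕ) (rows : List (List ℕ)) (ys : List (ZMod p)), elim p k rows = true →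
    ys.length = k → (∀ s ∈ rows, s.length = k ∧ dot p s ys = 0) → ∀ y ∈ ys, y = 0 := by
  intro k
  induction k with
  | zero => intro rows ys _ h _ y hy; simp at h; simp [h] at hy
  | succ k ih =>
    intro rows ys h hl hr
    rw [elim, fR_eq] at h
    cases hp : piv p [] rows with
    | none => rw [hp] at h; simp at h
    | some v =>
      obtain ⟨a, r, rest⟩ := v
      rw [hp] at h
      obtain ⟨h1, h2, h3⟩ := piv_spec _ _ _ _ _ hp
      cases ys with
      | nil => simp at hl
      | cons z ys =>
        have ha := hr _ h2
        simp only [length_cons, Nat.add_right_cancel_iff, dot] at ha hl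
        have key : ∀ y ∈ ys, y = 0 := by
          refine ih _ ys h hl ?_
          intro s hs
          obtain ⟨b, s', hb, hh⟩ := elimRows_spec _ _ _ _ hs
          have hb' := hr _ (by rcases h3 _ hb with h | h; · simp at h
                               · exact h)
          simp only [length_cons, Nat.add_right_cancel_iff, dot] at hb'
          rcases hh with ⟨rfl, rfl⟩ | rfl
          · refine ⟨hb'.1, ?_⟩; simpa using hb'.2
          · have hl' : s'.length = r.length := hb'.1.trans ha.1.symm
            rw [comb_len _ _ _ _ hl', comb_dot _ _ _ _ _ hl']
            refine ⟨ha.1, ?_⟩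
            linear_combination (a : ZMod p) * hb'.2 - (b : ZMod p) * ha.2
        have hd : ∀ (r : List ℕ) (ys : List (ZMod p)), (∀ y ∈ ys, y = 0) → dot p r ys = 0 := by
          intro r
          induction r with
          | nil => intro ys _; simp [dot]
          | cons x r ih => intro ys hy; cases ys with
            | nil => simp [dot]
            | cons y ys =>
              simp only [dot]; rw [ih ys (fun y hy' => hy y (by simp [hy'])), hy y (by simp)]; simp
        have hz : z = 0 := by
          have := ha.2
          rw [hd _ _ key, add_zero] at this
          exact (mul_eq_zero.1 this).resolve_left h1
        intro y hy
        rcases List.mem_cons.1 hy with rfl | hy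
        · exact hz
        · exact key y hy
def lp (g : ℕ → ZMod p) (r : ℕ) (q : ℕ × ℕ) : ZMod p :=
  if q.1 = r then g q.1 - g q.2 else if q.2 = r then g q.2 - g q.1 else 0
theorem nb_sum (g : ℕ → ZMod p) (r : ℕ) (qs : List (ℕ × ℕ)) :
    (qs.map (lp g r)).sum = (nb r qs).length * g r - ((nb r qs).map g).sum := by
  induction qs with
  | nil => simp [nb]
  | cons q t ih =>
    rw [map_cons, sum_cons, ih, nb, cond_beq, cond_beq, lp]
    split_ifs with h1 h2
    · simp [h1]; ring
    · simp [h2]; ring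
    · simp
theorem nb_mem (r : ℕ) (qs : List (ℕ × ℕ)) (hl : ∀ q ∈ qs, q.1 ≠ q.2) (x : ℕ) (hx : x ∈ nb r qs) :
    x ≠ r ∧ ∃ q ∈ qs, x = q.1 ∨ x = q.2 := by
  induction qs with
  | nil => simp [nb] at hx
  | cons q t ih =>
    have ih := ih (fun q hq => hl q (by simp [hq]))
    have h0 := hl q (by simp)
    rw [nb, cond_beq, cond_beq] at hx
    have ih' : x ∈ nb r t → x ≠ r ∧ ∃ q' ∈ q :: t, x = q'.1 ∨ x = q'.2 := fun h =>
      ⟨(ih h).1, by obtain ⟨q, h1, h2⟩ := (ih h).2; exact ⟨q, by simp [h1], h2⟩⟩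
    split_ifs at hx with h1 h2
    · rcases List.mem_cons.1 hx with rfl | hx
      · exact ⟨fun h => h0 (h1.trans h.symm), q, by simp, Or.inr rfl⟩
      · exact ih' hx
    · rcases List.mem_cons.1 hx with rfl | hx
      · exact ⟨h1, q, by simp, Or.inl rfl⟩
      · exact ih' hx
    · exact ih' hx
theorem cnt_eq (c : ℕ) (l : List ℕ) : cnt c l = l.count c := by
  induction l with
  | nil => simp [cnt]
  | cons x t ih => rw [cnt, cond_beq, count_cons, ih]; by_cases h : x = c <;> simp [h]
theorem row_len (r : ℕ) (N : List ℕ) (L : List ℕ) : (row p r N L).length = L.length := by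
  induction L with
  | nil => rfl
  | cons c t ih => simp [row, ih]
theorem row_dot (r : ℕ) (N : List ℕ) (hN : r ∉ N) (g : ℕ → ZMod p) (L : List ℕ) :
    dot p (row p r N L) (L.map g) = L.count r * (N.length * g r) - (L.map fun c => (N.count c : ZMod p) * g c).sum := by
  induction L with
  | nil => simp [row, dot]
  | cons c t ih =>
    simp only [row, map_cons, dot]
    rw [ih, cond_beq, count_cons, sum_cons, cnt_eq]
    by_cases h : c = r
    · subst h
      simp [List.count_eq_zero_of_not_mem hN]; ring
    · simp [h]
      rw [p1]; ring
theorem count_sum (g : ℕ → ZMod p) (L : List ℕ) (hL : L.Nodup) (N : List ℕ) (h : ∀ x ∈ N, x ∈ L ∨ g x = 0) :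
    (L.map fun c => (N.count c : ZMod p) * g c).sum = (N.map g).sum := by
  induction N with
  | nil => simp
  | cons x N ih =>
    have ih := ih (fun y hy => h y (by simp [hy]))
    rw [map_cons, sum_cons, ← ih]
    have h1 : ∀ c, (((x :: N).count c : ℕ) : ZMod p) * g c = (N.count c : ZMod p) * g c + (if x = c then g c else 0) := by
      intro c
      rw [count_cons]
      by_cases h : x = c
      · simp [h]; ring
      · simp [h]
    simp only [h1]
    rw [List.sum_map_add]
    have h2 : ∀ L : List ℕ, L.Nodup → (L.map fun c => if x = c then g c else 0).sum = if x ∈ L then g x else 0 := by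
      intro L
      induction L with
      | nil => simp
      | cons y t iht =>
        intro hn
        rw [nodup_cons] at hn
        rw [map_cons, sum_cons, iht hn.2]
        by_cases hxy : x = y
        · subst hxy; simp [hn.1]
        · simp [hxy]
    rw [h2 L hL]
    rcases h x (by simp) with h | h
    · simp [h]; ring
    · simp [h]
theorem chkp_spec (qs : List (ℕ × ℕ)) (hc : chkp p qs = true) (hl : ∀ q ∈ qs, q.1 ≠ q.2)
    (g : ℕ → ZMod p) (hg : ∀ r, (∃ q ∈ qs, r = q.1 ∨ r = q.2) → (qs.map (lp g r)).sum = 0) :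
    ∃ z, ∀ q ∈ qs, g q.1 = z ∧ g q.2 = z := by
  rw [chkp, fL_eq] at hc
  have hn := labs_nodup qs
  have hm := labs_mem qs
  cases hL : labs qs with
  | nil => rw [hL] at hc; simp at hc
  | cons l0 L =>
    rw [hL] at hc hn hm
    simp only at hc
    rw [nodup_cons] at hn
    have key := elim_spec (p := p) L.length _ (L.map fun c => g c - g l0) hc (by simp) (by
      intro s hs
      rw [mem_map] at hs
      obtain ⟨r, hr, rfl⟩ := hs
      refine ⟨row_len _ _ _, ?_⟩
      have hN := nb_mem r qs hl
      rw [row_dot r _ (fun h => (hN r h).1 rfl), List.count_eq_one_of_mem hn.2 hr, count_sum _ L hn.2]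
      · have h1 := hg r ((hm r).1 (by simp [hr]))
        have h2 := nb_sum (fun c => g c - g l0) r qs
        have h3 : (lp (fun c => g c - g l0) r) = lp g r := by
          funext q; simp [lp]
        rw [h3, h1] at h2
        rw [Nat.cast_one, one_mul, ← h2]
      · intro x hx
        have := (hm x).2 (hN x hx).2
        rcases List.mem_cons.1 this with rfl | h
        · right; ring
        · exact Or.inl h)
    have k2 : ∀ x ∈ l0 :: L, g x = g l0 := by
      intro x hx
      rcases List.mem_cons.1 hx with rfl | h
      · rfl
      · exact sub_eq_zero.1 (key _ (List.mem_map.2 ⟨x, h, rfl⟩))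
    exact ⟨g l0, fun q hq => ⟨k2 _ ((hm _).2 ⟨q, hq, Or.inl rfl⟩), k2 _ ((hm _).2 ⟨q, hq, Or.inr rfl⟩)⟩⟩
end Z
theorem allQ_spec (f) (l : List (ℕ × ℕ)) (h : allQ f l = true) : ∀ q ∈ l, f q = true := by
  induction l with
  | nil => simp
  | cons q t ih =>
    rw [allQ] at h
    simp only [and_eq_true] at h
    intro q' hq'
    rcases List.mem_cons.1 hq' with rfl | hq'
    · exact h.1
    · exact ih h.2 _ hq'
theorem leafOK_spec (qs) (h : leafOK qs = true) : chkp 7 qs = true ∨ chkp 2 qs = true ∨ chkp 3 qs = true ∨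
    ∀ q ∈ qs, chkp 5 (q :: q :: q :: qs) = true := by
  rw [leafOK, fQ_eq] at h
  simp only [Bool.or_eq_true] at h
  rcases h with h | h | h | h
  · exact Or.inl h
  · exact Or.inr (Or.inl h)
  · exact Or.inr (Or.inr (Or.inl h))
  · exact Or.inr (Or.inr (Or.inr (allQ_spec _ _ h)))
end Srch
namespace SqMap
variable {n : ℕ} {Q : Type} (M : SqMap n Q)
section Fin
open Classical
variable [Fintype Q]
theorem sum_R {A : Type*} [AddCommMonoid A] (F : Cn Q → A) (hF : ∀ c, ¬ isE c → F c = 0) (R : List (Cn Q))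
    (hRe : ∀ c ∈ R, isE c) (hRn : (R.map Prod.fst).Nodup) (hRall : ∀ q, q ∈ R.map Prod.fst) :
    ∑ c, F c = (R.map fun c => F c + F (rv c)).sum := by
  rw [sum_prod_type]
  have h1 : ∀ q, ∑ i, F (q, i) = F (q, 0) + F (q, 2) := by
    intro q
    rw [Fin.sum_univ_four, hF (q, 1) (by simp [isE]), hF (q, 3) (by simp [isE])]
    simp
  simp only [h1]
  have h2 : (R.map fun c => F c + F (rv c)) = (R.map Prod.fst).map (fun q => F (q, 0) + F (q, 2)) := by
    rw [map_map]
    apply map_congr_left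
    intro c hc
    obtain ⟨q, i⟩ := c
    rcases hRe _ hc with h | h <;> simp at h <;> subst h <;> simp [rv]
    exact add_comm _ _
  rw [h2, ← List.sum_toFinset _ hRn]
  apply sum_congr _ (fun _ _ => rfl)
  ext q; simpa using hRall q
section leaf
variable (R : List (Cn Q)) (hRe : ∀ c ∈ R, isE c) (hRn : (R.map Prod.fst).Nodup)
  (hRall : ∀ q, q ∈ R.map Prod.fst) (sl : Cn Q → ℕ)
  (hsl : ∀ c d, isE c → isE d → (M.vert c = M.vert d ↔ sl c = sl d))
theorem isE_in (R : List (Cn Q)) (hRe : ∀ c ∈ R, isE c)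
  (hRall : ∀ q, q ∈ R.map Prod.fst) (c : Cn Q) (hc : isE c) : c ∈ R ∨ rv c ∈ R := by
  obtain ⟨d, hd, h⟩ := List.mem_map.1 (hRall c.1)
  obtain ⟨q, i⟩ := c
  obtain ⟨q', j⟩ := d
  simp at h; subst h
  rcases hc with h | h <;> rcases hRe _ hd with h' | h' <;> simp at h h' <;> subst h <;> subst h' <;> simp [rv, hd]
theorem leaf_core (p : ℕ) [Fact p.Prime] (wt : Q → ZMod p) (f : M.W → ZMod p)
    (hf : ∀ u : M.HV, ∑ c, (if M.vert c = u.1 then wt c.1 * (f (M.vert c) - f (M.vert (rv c))) else 0) = 0)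
    (hne : ∃ c d, isE c ∧ isE d ∧ f (M.vert c) ≠ f (M.vert d))
    (R : List (Cn Q)) (hRe : ∀ c ∈ R, isE c) (hRn : (R.map Prod.fst).Nodup)
    (hRall : ∀ q, q ∈ R.map Prod.fst) (sl : Cn Q → ℕ)
    (hsl : ∀ c d, isE c → isE d → (M.vert c = M.vert d ↔ sl c = sl d))
    (qs : List (ℕ × ℕ)) (hqs : ∀ q, q ∈ qs ↔ q ∈ R.map (fun c => (sl c, sl (rv c))))
    (hsum : ∀ G : ℕ × ℕ → ZMod p, (qs.map G).sum = (R.map fun c => wt c.1 * G (sl c, sl (rv c))).sum) :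
    Srch.chkp p qs ≠ true := by
  intro hc
  let g : ℕ → ZMod p := fun l => if h : ∃ c, isE c ∧ sl c = l then f (M.vert h.choose) else 0
  have hg : ∀ c, isE c → g (sl c) = f (M.vert c) := by
    intro c hc
    have h : ∃ d, isE d ∧ sl d = sl c := ⟨c, hc, rfl⟩
    simp only [g]
    rw [dif_pos h, (hsl _ _ h.choose_spec.1 hc).2 h.choose_spec.2]
  have hloop : ∀ c, isE c → sl c ≠ sl (rv c) := fun c hc h =>
    M.vert_ne_rv hc ((hsl _ _ hc ((isE_rv c).2 hc)).2 h)
  have hq : ∀ q ∈ qs, ∃ c ∈ R, isE c ∧ q = (sl c, sl (rv c)) := by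
    intro q h
    obtain ⟨c, h1, h2⟩ := List.mem_map.1 ((hqs q).1 h)
    exact ⟨c, h1, hRe c h1, h2.symm⟩
  obtain ⟨z, hz⟩ := Srch.chkp_spec qs hc (by
    intro q h
    obtain ⟨c, _, h2, rfl⟩ := hq q h
    exact hloop c h2) g (by
    intro r hr
    obtain ⟨c0, hc0, rfl⟩ : ∃ c0, isE c0 ∧ sl c0 = r := by
      obtain ⟨q, h, hr⟩ := hr
      obtain ⟨c, _, h2, rfl⟩ := hq q h
      rcases hr with h | h
      · exact ⟨c, h2, h.symm⟩
      · exact ⟨rv c, (isE_rv c).2 h2, h.symm⟩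
    rw [hsum, ← hf (M.mkH c0 hc0), sum_R _ _ R hRe hRn hRall]
    · congr 1
      apply map_congr_left
      intro c hc
      have hE := hRe c hc
      have hE' := (isE_rv c).2 hE
      simp only [mkH, Srch.lp, hsl c c0 hE hc0, hsl _ c0 hE' hc0, hg c hE, hg _ hE', rv_rv]
      have := hloop c hE
      by_cases h1 : sl c = sl c0
      · have h2 : sl (rv c) ≠ sl c0 := fun h => this (h1.trans h.symm)
        simp [h1, h2]
      · by_cases h2 : sl (rv c) = sl c0
        · have hw : (rv c).1 = c.1 := rfl
          simp [h1, h2, hw]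
        · simp [h1, h2]
    · intro c hc
      rw [if_neg]
      intro h
      exact hc ((M.isE_of_vert h).2 hc0))
  have hall : ∀ c, isE c → f (M.vert c) = z := by
    intro c hc
    rcases isE_in R hRe hRall c hc with h | h
    · rw [← hg c hc]; exact (hz _ ((hqs _).2 (List.mem_map.2 ⟨c, h, rfl⟩))).1
    · have := (hz _ ((hqs _).2 (List.mem_map.2 ⟨rv c, h, rfl⟩))).2
      simp only [rv_rv] at this
      rw [← hg c hc]; exact this
  obtain ⟨c, d, h1, h2, h3⟩ := hne
  exact h3 ((hall c h1).trans (hall d h2).symm)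
theorem leaf_contra (hn : n = 42)
    (R : List (Cn Q)) (hRe : ∀ c ∈ R, isE c) (hRn : (R.map Prod.fst).Nodup)
    (hRall : ∀ q, q ∈ R.map Prod.fst) (sl : Cn Q → ℕ)
    (hsl : ∀ c d, isE c → isE d → (M.vert c = M.vert d ↔ sl c = sl d)) :
    Srch.leafOK (R.map (fun c => (sl c, sl (rv c)))) ≠ true := by
  intro h
  have hd := M.tau_dvd
  have main : ∀ p : ℕ, ∀ [Fact p.Prime], (p : ℤ) ∣ 2 * (n : ℤ) ^ 2 →
      Srch.chkp p (R.map (fun c => (sl c, sl (rv c)))) ≠ true := by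
    intro p _ hp
    obtain ⟨f, h1, h2⟩ := M.exists_ker p (hp.trans hd)
    exact M.leaf_core p (fun _ => 1) f (by simpa using h1) h2 R hRe hRn hRall sl hsl _ (fun q => Iff.rfl)
      (by intro G; simp [map_map, Function.comp_def])
  have : Fact (Nat.Prime 7) := ⟨by norm_num⟩
  have : Fact (Nat.Prime 5) := ⟨by norm_num⟩
  rcases Srch.leafOK_spec _ h with h | h | h | h
  · exact main 7 (by rw [hn]; decide) h
  · exact main 2 (by rw [hn]; decide) h
  · exact main 3 (by rw [hn]; decide) h
  · obtain ⟨c0, hc0, hb⟩ := List.mem_map.1 (hRall M.b)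
    obtain ⟨f, h1, h2⟩ := M.exists_ker' 5
    refine M.leaf_core 5 (fun q => if q = M.b then -1 else 1) f h1 h2 R hRe hRn hRall sl hsl _ ?_ ?_
      (h _ (List.mem_map.2 ⟨c0, hc0, rfl⟩))
    · intro q
      simp only [mem_cons]
      constructor
      · rintro (h | h | h | h)
        · rw [h]; exact List.mem_map.2 ⟨c0, hc0, rfl⟩
        · rw [h]; exact List.mem_map.2 ⟨c0, hc0, rfl⟩
        · rw [h]; exact List.mem_map.2 ⟨c0, hc0, rfl⟩
        · exact h
      · intro h; exact Or.inr (Or.inr (Or.inr h))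
    · intro G
      simp only [map_cons, sum_cons, map_map, Function.comp_def]
      generalize hH : (fun c => G (sl c, sl (rv c))) = H
      have e1 : G (sl c0, sl (rv c0)) = H c0 := by rw [← hH]
      have e2 : ∀ c, G (sl c, sl (rv c)) = H c := by intro c; rw [← hH]
      simp only [e2]
      have key : ∀ R : List (Cn Q), (R.map Prod.fst).Nodup →
          (R.map fun c => (if c.1 = M.b then (-1 : ZMod 5) else 1) * H c).sum =
          (R.map H).sum + (if c0 ∈ R then 3 * H c0 else 0) ∨ ∃ c ∈ R, c.1 = M.b ∧ c ≠ c0 := by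
        intro R
        induction R with
        | nil => intro _; left; simp
        | cons c R ih =>
          intro hn
          rw [map_cons, nodup_cons] at hn
          rcases ih hn.2 with h | ⟨d, h, h'⟩
          · by_cases hcc : c = c0
            · subst hcc
              left
              have : c ∉ R := fun h => hn.1 (List.mem_map.2 ⟨c, h, rfl⟩)
              simp only [map_cons, sum_cons, h, hb, if_true, if_neg this, mem_cons, true_or]
              have : (5 : ZMod 5) = 0 := by exact_mod_cast ZMod.natCast_self 5
              linear_combination (-H c) * this
            · by_cases hcb : c.1 = M.b
              · right; exact ⟨c, by simp, hcb, hcc⟩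
              · left
                have hcc' : c0 ≠ c := fun h => hcc h.symm
                simp only [map_cons, sum_cons, h, hcb, if_false, mem_cons, hcc', false_or]
                ring
          · right; exact ⟨d, by simp [h], h'⟩
      rcases key R hRn with h | ⟨c, h1, h2, h3⟩
      · rw [h, if_pos hc0]; ring
      · exact absurd (List.inj_on_of_nodup_map hRn h1 hc0 (h2.trans hb.symm)) h3
end leaf
end Fin
end SqMap
namespace SqMap
variable {n : ℕ} {Q : Type} (M : SqMap n Q)
def Ch (G : Set (Cn Q)) (a b : Cn Q) (k : ℕ) : Prop :=
  ∃ j, k = j + 1 ∧ (M.rho ^ j) (nx a) = b ∧ ∀ t < j, (M.rho ^ t) (nx a) ∈ G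
theorem Ch.mono {G G' : Set (Cn Q)} (hG : G ⊆ G') {a b : Cn Q} {k : ℕ} (h : M.Ch G a b k) : M.Ch G' a b k := by
  obtain ⟨j, h1, h2, h3⟩ := h
  exact ⟨j, h1, h2, fun t ht => hG (h3 t ht)⟩
theorem Ch.cat {G G' : Set (Cn Q)} (hG : G ⊆ G') {a b a' b' : Cn Q} {k k' : ℕ} (h : M.Ch G a b k)
    (h' : M.Ch G a' b' k') (hb : M.rho b = nx a') (hbG : b ∈ G') : M.Ch G' a b' (k + k') := by
  obtain ⟨j, h1, h2, h3⟩ := h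
  obtain ⟨j', h1', h2', h3'⟩ := h'
  have key : ∀ t, (M.rho ^ (j + 1 + t)) (nx a) = (M.rho ^ t) (nx a') := by
    intro t
    rw [add_comm, pow_add, Equiv.Perm.mul_apply, pow_succ', Equiv.Perm.mul_apply, h2, hb]
  refine ⟨j + 1 + j', by omega, by rw [key, h2'], fun t ht => ?_⟩
  rcases lt_trichotomy t j with h | h | h
  · exact hG (h3 t h)
  · rw [h, h2]; exact hbG
  · obtain ⟨i, rfl⟩ := Nat.exists_eq_add_of_lt h
    have : j + i + 1 = j + 1 + i := by ring
    rw [this, key]; exact hG (h3' _ (by omega))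
theorem Ch.inj_b {G : Set (Cn Q)} {a b b' : Cn Q} {k : ℕ} (h : M.Ch G a b k) (h' : M.Ch G a b' k) : b = b' := by
  obtain ⟨j, h1, h2, h3⟩ := h
  obtain ⟨j', h1', h2', h3'⟩ := h'
  obtain rfl : j = j' := by omega
  rw [← h2, ← h2']
theorem Ch.inj_a {G : Set (Cn Q)} {a a' b : Cn Q} {k : ℕ} (h : M.Ch G a b k) (h' : M.Ch G a' b k) : a = a' := by
  obtain ⟨j, h1, h2, h3⟩ := h
  obtain ⟨j', h1', h2', h3'⟩ := h'
  obtain rfl : j = j' := by omega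
  have := (M.rho ^ j).injective (h2.trans h2'.symm)
  rw [← pv_nx a, this, pv_nx]
structure Pair (G : Set (Cn Q)) (S T : Set (ℕ × ℕ × (Cn Q))) : Prop where
  st : ∀ s ∈ S, ∃ t ∈ T, t.1 = s.1
  ts : ∀ t ∈ T, ∃ s ∈ S, s.1 = t.1
  ch : ∀ s ∈ S, ∀ t ∈ T, s.1 = t.1 → s.2.1 = t.2.1 ∧ M.Ch G s.2.2 t.2.2 s.2.1
  us : ∀ s ∈ S, ∀ s' ∈ S, s.2.2 = s'.2.2 → s = s'
  ut : ∀ s ∈ T, ∀ s' ∈ T, s.2.2 = s'.2.2 → s = s'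
variable {M}
theorem Pair.sinj {G S T} (P : M.Pair G S T) {s s'} (hs : s ∈ S) (hs' : s' ∈ S) (h : s.1 = s'.1) : s = s' := by
  obtain ⟨t, ht, hh⟩ := P.st s hs
  have h1 := P.ch s hs t ht hh.symm
  have h2 := P.ch s' hs' t ht (h.symm.trans hh.symm)
  rw [h1.1] at h1
  rw [h2.1] at h2
  exact P.us _ hs _ hs' (Ch.inj_a M h1.2 h2.2)
theorem Pair.tinj {G S T} (P : M.Pair G S T) {t t'} (ht : t ∈ T) (ht' : t' ∈ T) (h : t.1 = t'.1) : t = t' := by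
  obtain ⟨s, hs, hh⟩ := P.ts t ht
  have h1 := P.ch s hs t ht hh
  have h2 := P.ch s hs t' ht' (hh.trans h)
  exact P.ut _ ht _ ht' (Ch.inj_b M h1.2 h2.2)
def up (a m K : ℕ) (y : ℕ × ℕ × (Cn Q)) : ℕ × ℕ × (Cn Q) := if y.1 = a then (m, K, y.2.2) else y
theorem up_c (a m K : ℕ) (y : ℕ × ℕ × (Cn Q)) : (up a m K y).2.2 = y.2.2 := by unfold up; split_ifs <;> rfl
theorem up_pos {a m K : ℕ} {y : ℕ × ℕ × (Cn Q)} (h : y.1 = a) : up a m K y = (m, K, y.2.2) := if_pos h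
theorem up_neg {a m K : ℕ} {y : ℕ × ℕ × (Cn Q)} (h : y.1 ≠ a) : up a m K y = y := if_neg h
theorem Pair.glue {G G' S T S' T'} (P : M.Pair G S T) (hG : G ⊆ G') {s0 t0} (hs0 : s0 ∈ S) (ht0 : t0 ∈ T)
    (hr : M.rho t0.2.2 = nx s0.2.2) (ht0G : t0.2.2 ∈ G') (m : ℕ) (hm : m = t0.1 ∨ m = s0.1)
    (K : ℕ) (hK : K = t0.2.1 + s0.2.1)
    (hS : ∀ y, y ∈ S' ↔ ∃ z, (z ∈ S ∧ z.2.2 ≠ s0.2.2) ∧ y = up t0.1 m K z)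
    (hT : ∀ y, y ∈ T' ↔ ∃ z, (z ∈ T ∧ z.2.2 ≠ t0.2.2) ∧ y = up s0.1 m K z) : M.Pair G' S' T' := by
  have us' : ∀ s ∈ S', ∀ s' ∈ S', s.2.2 = s'.2.2 → s = s' := by
    intro s hs s' hs' h
    obtain ⟨z, hz, rfl⟩ := (hS _).1 hs
    obtain ⟨z', hz', rfl⟩ := (hS _).1 hs'
    rw [up_c, up_c] at h
    rw [P.us _ hz.1 _ hz'.1 h]
  have ut' : ∀ s ∈ T', ∀ s' ∈ T', s.2.2 = s'.2.2 → s = s' := by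
    intro s hs s' hs' h
    obtain ⟨z, hz, rfl⟩ := (hT _).1 hs
    obtain ⟨z', hz', rfl⟩ := (hT _).1 hs'
    rw [up_c, up_c] at h
    rw [P.ut _ hz.1 _ hz'.1 h]
  have ns : ∀ z ∈ S, z.2.2 ≠ s0.2.2 → z.1 ≠ s0.1 := fun z hz h h' => h (by rw [P.sinj hz hs0 h'])
  have nt : ∀ z ∈ T, z.2.2 ≠ t0.2.2 → z.1 ≠ t0.1 := fun z hz h h' => h (by rw [P.tinj hz ht0 h'])
  by_cases hst : s0.1 = t0.1
  · have hS2 : ∀ y, y ∈ S' ↔ (y ∈ S ∧ y.2.2 ≠ s0.2.2) := by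
      intro y
      rw [hS]
      constructor
      · rintro ⟨z, hz, rfl⟩
        rw [up_neg (hst ▸ ns z hz.1 hz.2)]; exact hz
      · intro hz; exact ⟨y, hz, by rw [up_neg (hst ▸ ns y hz.1 hz.2)]⟩
    have hT2 : ∀ y, y ∈ T' ↔ (y ∈ T ∧ y.2.2 ≠ t0.2.2) := by
      intro y
      rw [hT]
      constructor
      · rintro ⟨z, hz, rfl⟩
        rw [up_neg (hst ▸ nt z hz.1 hz.2)]; exact hz
      · intro hz; exact ⟨y, hz, by rw [up_neg (hst ▸ nt y hz.1 hz.2)]⟩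
    refine ⟨?_, ?_, ?_, us', ut'⟩
    · intro s hs
      obtain ⟨h1, h2⟩ := (hS2 s).1 hs
      obtain ⟨t, ht, hts⟩ := P.st s h1
      refine ⟨t, (hT2 t).2 ⟨ht, fun h => ?_⟩, hts⟩
      exact ns s h1 h2 (by rw [← hts, P.ut t ht t0 ht0 h, hst])
    · intro t ht
      obtain ⟨h1, h2⟩ := (hT2 t).1 ht
      obtain ⟨s, hs, hts⟩ := P.ts t h1
      refine ⟨s, (hS2 s).2 ⟨hs, fun h => ?_⟩, hts⟩
      exact nt t h1 h2 (by rw [← hts, P.us s hs s0 hs0 h, hst])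
    · intro s hs t ht h
      obtain ⟨h1, h2⟩ := P.ch s ((hS2 s).1 hs).1 t ((hT2 t).1 ht).1 h
      exact ⟨h1, Ch.mono M hG h2⟩
  · obtain ⟨s1, hs1, hs1t⟩ := P.ts t0 ht0
    obtain ⟨t1, ht1, ht1s⟩ := P.st s0 hs0
    have n1 : s1.2.2 ≠ s0.2.2 := fun h => hst (by rw [← hs1t, P.us _ hs1 _ hs0 h])
    have n2 : t1.2.2 ≠ t0.2.2 := fun h => hst (by rw [← ht1s, P.ut _ ht1 _ ht0 h])
    have c1 := P.ch s1 hs1 t0 ht0 hs1t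
    have c0 := P.ch s0 hs0 t1 ht1 ht1s.symm
    have hch : M.Ch G' s1.2.2 t1.2.2 K := by
      have := Ch.cat M hG c1.2 c0.2 hr ht0G
      rw [hK, ← c1.1]; exact this
    have m1 : (m, K, s1.2.2) ∈ S' := (hS _).2 ⟨s1, ⟨hs1, n1⟩, by rw [up_pos hs1t]⟩
    have m2 : (m, K, t1.2.2) ∈ T' := (hT _).2 ⟨t1, ⟨ht1, n2⟩, by rw [up_pos ht1s]⟩
    have cS : ∀ y ∈ S', y = (m, K, s1.2.2) ∨ (y ∈ S ∧ y.2.2 ≠ s0.2.2 ∧ y.1 ≠ s0.1 ∧ y.1 ≠ t0.1) := by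
      intro y hy
      obtain ⟨z, hz, rfl⟩ := (hS y).1 hy
      by_cases h : z.1 = t0.1
      · left; rw [up_pos h, P.sinj hz.1 hs1 (h.trans hs1t.symm)]
      · right; rw [up_neg h]; exact ⟨hz.1, hz.2, ns z hz.1 hz.2, h⟩
    have cT : ∀ y ∈ T', y = (m, K, t1.2.2) ∨ (y ∈ T ∧ y.2.2 ≠ t0.2.2 ∧ y.1 ≠ s0.1 ∧ y.1 ≠ t0.1) := by
      intro y hy
      obtain ⟨z, hz, rfl⟩ := (hT y).1 hy
      by_cases h : z.1 = s0.1
      · left; rw [up_pos h, P.tinj hz.1 ht1 (h.trans ht1s.symm)]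
      · right; rw [up_neg h]; exact ⟨hz.1, hz.2, h, nt z hz.1 hz.2⟩
    refine ⟨?_, ?_, ?_, us', ut'⟩
    · intro s hs
      rcases cS s hs with rfl | ⟨h1, h2, h3, h4⟩
      · exact ⟨_, m2, rfl⟩
      · obtain ⟨t, ht, hts⟩ := P.st s h1
        refine ⟨t, (hT t).2 ⟨t, ⟨ht, fun h => ?_⟩, ?_⟩, hts⟩
        · exact h4 (by rw [← hts, P.ut t ht t0 ht0 h])
        · rw [up_neg]; rw [hts]; exact h3
    · intro t ht
      rcases cT t ht with rfl | ⟨h1, h2, h3, h4⟩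
      · exact ⟨_, m1, rfl⟩
      · obtain ⟨s, hs, hts⟩ := P.ts t h1
        refine ⟨s, (hS s).2 ⟨s, ⟨hs, fun h => ?_⟩, ?_⟩, hts⟩
        · exact h3 (by rw [← hts, P.us s hs s0 hs0 h])
        · rw [up_neg]; rw [hts]; exact h4
    · intro s hs t ht h
      rcases cS s hs with rfl | ⟨h1, h2, h3, h4⟩
      · rcases cT t ht with rfl | ⟨h1', h2', h3', h4'⟩
        · exact ⟨rfl, hch⟩
        · exfalso
          simp only at h
          rcases hm with hm | hm
          · exact h4' (h.symm.trans hm)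
          · exact h3' (h.symm.trans hm)
      · rcases cT t ht with rfl | ⟨h1', h2', h3', h4'⟩
        · exfalso
          simp only at h
          rcases hm with hm | hm
          · exact h4 (h.trans hm)
          · exact h3 (h.trans hm)
        · obtain ⟨h1, h2⟩ := P.ch s h1 t h1' h
          exact ⟨h1, Ch.mono M hG h2⟩
theorem Pair.add {G S T S' T'} (P : M.Pair G S T) (l : ℕ) (s t : Cn Q) (hst : nx s = t)
    (hl : ∀ y ∈ S, y.1 ≠ l) (hs : ∀ y ∈ S, y.2.2 ≠ s) (ht : ∀ y ∈ T, y.2.2 ≠ t)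
    (hS : ∀ y, y ∈ S' ↔ y = (l, 1, s) ∨ y ∈ S) (hT : ∀ y, y ∈ T' ↔ y = (l, 1, t) ∨ y ∈ T) : M.Pair G S' T' := by
  have hl' : ∀ y ∈ T, y.1 ≠ l := by
    intro y hy h
    obtain ⟨s, hs, h'⟩ := P.ts y hy
    exact hl s hs (h'.trans h)
  refine ⟨?_, ?_, ?_, ?_, ?_⟩
  · intro y hy
    rcases (hS y).1 hy with rfl | hy
    · exact ⟨(l, 1, t), (hT _).2 (Or.inl rfl), rfl⟩
    · obtain ⟨t, h1, h2⟩ := P.st y hy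
      exact ⟨t, (hT _).2 (Or.inr h1), h2⟩
  · intro y hy
    rcases (hT y).1 hy with rfl | hy
    · exact ⟨(l, 1, s), (hS _).2 (Or.inl rfl), rfl⟩
    · obtain ⟨t, h1, h2⟩ := P.ts y hy
      exact ⟨t, (hS _).2 (Or.inr h1), h2⟩
  · intro y hy z hz h
    rcases (hS y).1 hy with rfl | hy
    · rcases (hT z).1 hz with rfl | hz
      · exact ⟨rfl, 0, rfl, by simpa using hst, by simp⟩
      · exact absurd h.symm (hl' z hz)
    · rcases (hT z).1 hz with rfl | hz
      · exact absurd h (hl y hy)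
      · exact P.ch y hy z hz h
  · intro y hy z hz h
    rcases (hS y).1 hy with rfl | hy
    · rcases (hS z).1 hz with rfl | hz
      · rfl
      · exact absurd h.symm (hs z hz)
    · rcases (hS z).1 hz with rfl | hz
      · exact absurd h (hs y hy)
      · exact P.us y hy z hz h
  · intro y hy z hz h
    rcases (hT y).1 hy with rfl | hy
    · rcases (hT z).1 hz with rfl | hz
      · rfl
      · exact absurd h.symm (ht z hz)
    · rcases (hT z).1 hz with rfl | hz
      · exact absurd h (ht y hy)
      · exact P.ut y hy z hz h
section Fin
open Classical
variable [Fintype Q]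
theorem Pair.len_same {G S T} (P : M.Pair G S T) {s0 t0} (hs0 : s0 ∈ S) (ht0 : t0 ∈ T)
    (hr : M.rho t0.2.2 = nx s0.2.2) (hG : t0.2.2 ∉ G) (h : s0.1 = t0.1) :
    M.sz (M.vert t0.2.2) = t0.2.1 ∧ ∀ c, M.vert c = M.vert t0.2.2 → c = t0.2.2 ∨ c ∈ G := by
  obtain ⟨h1, j, h2, h3, h4⟩ := P.ch s0 hs0 t0 ht0 h
  have hv : M.vert t0.2.2 = M.vert (nx s0.2.2) := by rw [← hr, M.vert_rho]
  have hp : (M.rho ^ (j + 1)) (nx s0.2.2) = nx s0.2.2 := by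
    rw [pow_succ', Equiv.Perm.mul_apply, h3, hr]
  have hsz : M.sz (M.vert t0.2.2) = j + 1 := by
    rw [hv]
    refine M.sz_of _ (j + 1) (by omega) hp ?_
    intro t ht htj hh
    obtain ⟨i, rfl⟩ := Nat.exists_eq_succ_of_ne_zero (by omega : t ≠ 0)
    rw [pow_succ', Equiv.Perm.mul_apply] at hh
    have := M.rho.injective (hh.trans hr.symm)
    exact hG (this ▸ h4 i (by omega))
  refine ⟨by omega, ?_⟩
  intro c hc
  obtain ⟨i, hi⟩ := M.exists_pow (hv.symm.trans hc.symm)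
  have hmod : (M.rho ^ (i % (j + 1))) (nx s0.2.2) = c := by
    have e : ∀ q : ℕ, (M.rho ^ ((j + 1) * q)) (nx s0.2.2) = nx s0.2.2 := by
      intro q
      induction q with
      | zero => simp
      | succ q ih => rw [Nat.mul_succ, pow_add, Equiv.Perm.mul_apply, hp, ih]
    have : i = i % (j + 1) + (j + 1) * (i / (j + 1)) := (mod_add_div _ _).symm
    rw [this, pow_add, Equiv.Perm.mul_apply, e] at hi
    exact hi
  have hlt : i % (j + 1) < j + 1 := mod_lt i (Nat.succ_pos j)
  rcases Nat.lt_or_ge (i % (j + 1)) j with h | h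
  · right; rw [← hmod]; exact h4 _ h
  · left
    have : i % (j + 1) = j := by omega
    rw [← hmod, this, h3]
theorem Pair.len_diff {G S T} (P : M.Pair G S T) {s0 t0} (hs0 : s0 ∈ S) (ht0 : t0 ∈ T)
    (hr : M.rho t0.2.2 = nx s0.2.2) (hG : ∀ t ∈ T, t.2.2 ∉ G) (hst : s0.1 ≠ t0.1) :
    t0.2.1 + s0.2.1 ≤ M.sz (M.vert t0.2.2) := by
  obtain ⟨s1, hs1, hs1t⟩ := P.ts t0 ht0
  obtain ⟨t1, ht1, ht1s⟩ := P.st s0 hs0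
  have n2 : t1.2.2 ≠ t0.2.2 := fun h => hst (by rw [← ht1s, P.ut _ ht1 _ ht0 h])
  obtain ⟨h1, j, h2, h3, h4⟩ := P.ch s1 hs1 t0 ht0 hs1t
  obtain ⟨h1', j', h2', h3', h4'⟩ := P.ch s0 hs0 t1 ht1 ht1s.symm
  have hv : M.vert t0.2.2 = M.vert (nx s1.2.2) := by rw [← h3, M.vert_pow]
  by_contra hlt
  rw [hv] at hlt
  obtain ⟨p0, p1, -⟩ := M.sz_spec (nx s1.2.2)
  set p := M.sz (M.vert (nx s1.2.2)) with hp
  have key : ∀ t, (M.rho ^ (j + 1 + t)) (nx s1.2.2) = (M.rho ^ t) (nx s0.2.2) := by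
    intro t
    rw [add_comm, pow_add, Equiv.Perm.mul_apply, pow_succ', Equiv.Perm.mul_apply, h3, hr]
  have ht : (M.rho ^ (j + 1 + j')) (nx s1.2.2) = t1.2.2 := by rw [key, h3']
  obtain ⟨i, hi⟩ : ∃ i, j + 1 + j' = i + p := ⟨j + 1 + j' - p, by omega⟩
  rw [hi, pow_add, Equiv.Perm.mul_apply, p1] at ht
  rcases lt_trichotomy i j with h | h | h
  · exact hG t1 ht1 (ht ▸ h4 i h)
  · rw [h, h3] at ht; exact n2 ht.symm
  · obtain ⟨r, rfl⟩ := Nat.exists_eq_add_of_lt h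
    have e : j + r + 1 = j + 1 + r := by ring
    rw [e, key] at ht
    exact hG t1 ht1 (ht ▸ h4' r (by omega))
end Fin
end SqMap
namespace Srch
structure En where
  h : Nat
  k : Nat
  v : Nat
  l : Nat
structure Bd where
  h3 : Nat
  h4 : Nat
  v3 : Nat
  v4 : Nat
inductive Ev where
  | new (a h : Nat)
  | mrg (a b : Nat)
def score (e : En) : Nat := e.k + e.l
def best : En → List En → En × List En
  | e, [] => (e, [])
  | e, x :: t => cond (Nat.ble (score e + 1) (score x))
      (match best x t with | (y, r) => (y, e :: r)) (match best e t with | (y, r) => (y, x :: r))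
def updO (h k v l h' v' : Nat) : List En → List En
  | [] => []
  | x :: t => ⟨cond (Nat.beq x.h h) h' x.h, cond (Nat.beq x.h h) k x.k,
       cond (Nat.beq x.v v) v' x.v, cond (Nat.beq x.v v) l x.l⟩ :: updO h k v l h' v' t
def lenOK (b3 b4 : Nat) (h k h' k' : Nat) : Bool :=
  cond (Nat.beq h h')
    (cond (Nat.beq k 3) (Nat.ble 1 b3) (cond (Nat.beq k 4) (Nat.ble 1 b4) false))
    (Nat.ble (k + k') 4)
def dec (b : Bd) (e f : En) : Bd :=
  ⟨cond (Nat.beq e.h f.h) (cond (Nat.beq e.k 3) (b.h3 - 1) b.h3) b.h3,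
   cond (Nat.beq e.h f.h) (cond (Nat.beq e.k 4) (b.h4 - 1) b.h4) b.h4,
   cond (Nat.beq e.v f.v) (cond (Nat.beq e.l 3) (b.v3 - 1) b.v3) b.v3,
   cond (Nat.beq e.v f.v) (cond (Nat.beq e.l 4) (b.v4 - 1) b.v4) b.v4⟩
def tries (rec : List En → List En → Bd → List Ev → Bool) (b : Bd) (lg : List Ev) (e : En) (E : List En) :
    List En → List En → Bool
  | _, [] => true
  | pre, f :: post =>
    and (cond (and (lenOK b.h3 b.h4 e.h e.k f.h f.k) (lenOK b.v3 b.v4 e.v e.l f.v f.l))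
      (rec (updO f.h (e.k + f.k) f.v (e.l + f.l) f.h f.v E)
        (updO e.h (e.k + f.k) e.v (e.l + f.l) f.h f.v (pre ++ post)) (dec b e f) (Ev.mrg e.h f.h :: lg)) true)
      (tries rec b lg e E (f :: pre) post)
def go (chk : List Ev → Bool) (M : Nat) : Nat → Nat → List En → List En → Bd → List Ev → Bool
  | 0, _, _, _, _, _ => false
  | n + 1, u, E, O, b, lg =>
    match E with
    | [] => cond (Nat.beq u M) (chk lg) true
    | x :: t =>
      match best x t with
      | (e, E) =>
        and (cond (and (Nat.ble (u + 1) M) (and (Nat.ble e.k 3) (Nat.ble e.l 3)))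
          (go chk M n (u+1) (⟨e.h, e.k + 1, u + 1, 1⟩ :: ⟨u + 1, 1, e.v, e.l + 1⟩ :: E)
            (⟨u + 1, 1, u + 1, 1⟩ :: updO e.h (e.k + 1) e.v (e.l + 1) e.h e.v O) b (Ev.new (u+1) e.h :: lg)) true)
          (tries (go chk M n u) b lg e E [] O)
def initE (d : Nat) : Nat → List En
  | 0 => []
  | k + 1 => ⟨k + 1, 1, (k + d - 1) % d, 2⟩ :: initE d k
def initO : Nat → List En
  | 0 => []
  | k + 1 => ⟨k + 1, 1, k, 2⟩ :: initO k
def cur (st : List (Nat × Nat)) : List Ev → List (Nat × Nat)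
  | [] => st
  | Ev.new a h :: t => (a, h) :: cur st t
  | Ev.mrg a b :: t => (cur st t).map (fun q => (cond (Nat.beq q.1 a) b q.1, cond (Nat.beq q.2 a) b q.2))
def initQ : Nat → List (Nat × Nat)
  | 0 => []
  | k + 1 => (0, k + 1) :: initQ k
def run (d : Nat) (b : Bd) : Bool :=
  go (fun lg => leafOK (cur (initQ d) lg)) 16 33 d (initE d d) (initO d) b []
def up1 (h k v l h' v' : Nat) (x : En) : En :=
  ⟨if x.h = h then h' else x.h, if x.h = h then k else x.k, if x.v = v then v' else x.v, if x.v = v then l else x.l⟩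
theorem updO_eq (h k v l h' v' : Nat) (L : List En) : updO h k v l h' v' L = L.map (up1 h k v l h' v') := by
  induction L with
  | nil => rfl
  | cons x t ih => simp only [updO, cond_beq, ih, map_cons, up1]
theorem best_perm (e : En) (L : List En) : ((best e L).1 :: (best e L).2).Perm (e :: L) := by
  induction L generalizing e with
  | nil => simp [best]
  | cons x t ih =>
    rw [best]
    cases Nat.ble (score e + 1) (score x)
    · simp only [cond_false]
      have := ih e
      exact (List.Perm.swap _ _ _).trans ((List.Perm.cons _ this).trans (List.Perm.swap _ _ _))
    · simp only [cond_true]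
      exact (List.Perm.swap _ _ _).trans (List.Perm.cons _ (ih x))
theorem perm_lift {α β : Type*} (f : α → β) {l l' : List β} (h : l.Perm l') :
    ∀ g : List α, g.map f = l → ∃ g' : List α, g'.Perm g ∧ g'.map f = l' := by
  induction h with
  | nil => intro g hg; exact ⟨g, List.Perm.refl _, hg⟩
  | cons x _ ih =>
    intro g hg
    cases g with
    | nil => simp at hg
    | cons a g =>
      simp only [map_cons, List.cons.injEq] at hg
      obtain ⟨g', h1, h2⟩ := ih g hg.2
      exact ⟨a :: g', List.Perm.cons _ h1, by simp [h2, hg.1]⟩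
  | swap x y l =>
    intro g hg
    cases g with
    | nil => simp at hg
    | cons a g =>
      cases g with
      | nil => simp at hg
      | cons b g =>
        simp only [map_cons, List.cons.injEq] at hg
        exact ⟨b :: a :: g, List.Perm.swap _ _ _, by simp [hg.1, hg.2.1, hg.2.2]⟩
  | trans _ _ ih1 ih2 =>
    intro g hg
    obtain ⟨g1, h1, h2⟩ := ih1 g hg
    obtain ⟨g2, h3, h4⟩ := ih2 g1 h2
    exact ⟨g2, h3.trans h1, h4⟩
theorem tries_spec (rec b lg e E) : ∀ (O pre : List En), tries rec b lg e E pre O = true → ∀ O1 f O2, O = O1 ++ f :: O2 →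
    lenOK b.h3 b.h4 e.h e.k f.h f.k = true → lenOK b.v3 b.v4 e.v e.l f.v f.l = true →
    rec (updO f.h (e.k + f.k) f.v (e.l + f.l) f.h f.v E)
        (updO e.h (e.k + f.k) e.v (e.l + f.l) f.h f.v (O1.reverse ++ pre ++ O2)) (dec b e f) (Ev.mrg e.h f.h :: lg) = true := by
  intro O
  induction O with
  | nil => intro pre _ O1 f O2 h; simp at h
  | cons x O ih =>
    intro pre h O1 f O2 hO h1 h2
    rw [tries] at h
    simp only [and_eq_true] at h
    cases O1 with
    | nil =>
      simp only [List.nil_append, List.cons.injEq] at hO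
      obtain ⟨rfl, rfl⟩ := hO
      have := h.1
      rw [h1, h2] at this
      simpa using this
    | cons y O1 =>
      simp only [List.cons_append, List.cons.injEq] at hO
      obtain ⟨rfl, rfl⟩ := hO
      have := ih _ h.2 O1 f O2 rfl h1 h2
      simpa using this
end Srch
open Srch in
def hs {Q : Type} (L : List (En × (Cn Q))) : Set (ℕ × ℕ × (Cn Q)) := {y | ∃ p ∈ L, y = (p.1.h, p.1.k, p.2)}
open Srch in
def vs {Q : Type} (L : List (En × (Cn Q))) : Set (ℕ × ℕ × (Cn Q)) := {y | ∃ p ∈ L, y = (p.1.v, p.1.l, p.2)}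
open Srch in
def updG {Q : Type} (h k v l h' v' : Nat) (L : List (En × (Cn Q))) : List (En × (Cn Q)) :=
  L.map (fun p => (up1 h k v l h' v' p.1, p.2))
namespace SqMap
open Srch
variable {n : ℕ} {Q : Type} (M : SqMap n Q)
theorem updG_fst (h k v l h' v' : Nat) (L : List (En × (Cn Q))) :
    (updG h k v l h' v' L).map Prod.fst = updO h k v l h' v' (L.map Prod.fst) := by
  rw [updO_eq, updG, map_map, map_map]; rfl
theorem updG_snd (h k v l h' v' : Nat) (L : List (En × (Cn Q))) :
    (updG h k v l h' v' L).map Prod.snd = L.map Prod.snd := by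
  rw [updG, map_map]; rfl
theorem hs_upd (h k v l h' v' : Nat) (p) (L : List (En × (Cn Q))) (hn : ((p :: L).map Prod.snd).Nodup) (y) :
    y ∈ hs (updG h k v l h' v' L) ↔ ∃ z, (z ∈ hs (p :: L) ∧ z.2.2 ≠ p.2) ∧ y = up h h' k z := by
  rw [map_cons, nodup_cons] at hn
  constructor
  · rintro ⟨q, hq, rfl⟩
    obtain ⟨r, hr, rfl⟩ := List.mem_map.1 hq
    refine ⟨(r.1.h, r.1.k, r.2), ⟨⟨r, by simp [hr], rfl⟩, ?_⟩, ?_⟩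
    · intro h; exact hn.1 (List.mem_map.2 ⟨r, hr, h⟩)
    · simp only [up, up1]; split_ifs <;> rfl
  · rintro ⟨z, ⟨⟨r, hr, rfl⟩, h2⟩, rfl⟩
    rcases List.mem_cons.1 hr with rfl | hr
    · exact absurd rfl h2
    · refine ⟨_, List.mem_map.2 ⟨r, hr, rfl⟩, ?_⟩
      simp only [up, up1]; split_ifs <;> rfl
theorem vs_upd (h k v l h' v' : Nat) (p) (L : List (En × (Cn Q))) (hn : ((p :: L).map Prod.snd).Nodup) (y) :
    y ∈ vs (updG h k v l h' v' L) ↔ ∃ z, (z ∈ vs (p :: L) ∧ z.2.2 ≠ p.2) ∧ y = up v v' l z := by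
  rw [map_cons, nodup_cons] at hn
  constructor
  · rintro ⟨q, hq, rfl⟩
    obtain ⟨r, hr, rfl⟩ := List.mem_map.1 hq
    refine ⟨(r.1.v, r.1.l, r.2), ⟨⟨r, by simp [hr], rfl⟩, ?_⟩, ?_⟩
    · intro h; exact hn.1 (List.mem_map.2 ⟨r, hr, h⟩)
    · simp only [up, up1]; split_ifs <;> rfl
  · rintro ⟨z, ⟨⟨r, hr, rfl⟩, h2⟩, rfl⟩
    rcases List.mem_cons.1 hr with rfl | hr
    · exact absurd rfl h2
    · refine ⟨_, List.mem_map.2 ⟨r, hr, rfl⟩, ?_⟩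
      simp only [up, up1]; split_ifs <;> rfl
section Fin
open Classical
variable [Fintype Q]
noncomputable def cnt (P : M.W → Prop) (G : Set (Cn Q)) (k : ℕ) : ℕ :=
  (Finset.univ.filter fun w : M.W => P w ∧ M.sz w = k ∧ ∃ c, M.vert c = w ∧ c ∉ G).card
theorem cnt_mono (P : M.W → Prop) {G G' : Set (Cn Q)} (h : G ⊆ G') (k : ℕ) : M.cnt P G' k ≤ M.cnt P G k := by
  apply card_le_card
  intro w
  simp only [mem_filter, mem_univ, true_and]
  rintro ⟨h1, h2, c, h3, h4⟩
  exact ⟨h1, h2, c, h3, fun h' => h4 (h h')⟩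
theorem cnt_close (P : M.W → Prop) {G G' : Set (Cn Q)} (h : G ⊆ G') (k : ℕ) (w : M.W) (hP : P w) (hk : M.sz w = k)
    (c) (hc : M.vert c = w) (hcG : c ∉ G) (hall : ∀ c, M.vert c = w → c ∈ G') : M.cnt P G' k + 1 ≤ M.cnt P G k := by
  apply Nat.succ_le_of_lt
  apply Finset.card_lt_card
  rw [Finset.ssubset_iff_of_subset]
  · refine ⟨w, ?_, ?_⟩
    · simp only [mem_filter, mem_univ, true_and]; exact ⟨hP, hk, c, hc, hcG⟩
    · simp only [mem_filter, mem_univ, true_and]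
      rintro ⟨_, _, c, h1, h2⟩; exact h2 (hall c h1)
  · intro w
    simp only [mem_filter, mem_univ, true_and]
    rintro ⟨h1, h2, c, h3, h4⟩
    exact ⟨h1, h2, c, h3, fun h' => h4 (h h')⟩
structure Inv (EG OG : List (En × (Cn Q))) (G : Set (Cn Q)) (R : List (Cn Q)) (sl : Cn Q → ℕ)
    (B : ℕ) (b : Bd) : Prop where
  eN : (EG.map Prod.snd).Nodup
  oN : (OG.map Prod.snd).Nodup
  eM : ∀ c, c ∈ EG.map Prod.snd ↔ isE c ∧ c.1 ∈ R.map Prod.fst ∧ c ∉ G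
  oM : ∀ c, c ∈ OG.map Prod.snd ↔ ¬ isE c ∧ c.1 ∈ R.map Prod.fst ∧ c ∉ G
  gU : ∀ c ∈ G, c.1 ∈ R.map Prod.fst
  gI : ∀ c ∈ G, M.io c ∈ G
  hp : M.Pair G (hs OG) (hs EG)
  vp : M.Pair G (vs EG) (vs OG)
  rE : ∀ c ∈ R, isE c
  rN : (R.map Prod.fst).Nodup
  eL : ∀ p ∈ EG, p.1.h = sl p.2 ∧ p.1.v ≤ B
  oL : ∀ p ∈ OG, p.1.h = sl (nx p.2) ∧ p.1.v ≤ B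
  sG : ∀ c ∈ G, isE c → sl (M.rho c) = sl c
  sU : ∀ c, isE c → c.1 ∈ R.map Prod.fst → sl c ≤ B
  sV : ∀ c c', isE c → isE c' → c.1 ∈ R.map Prod.fst → c'.1 ∈ R.map Prod.fst → sl c = sl c' → M.vert c = M.vert c'
  s34 : ∀ c, c ∉ G → M.sz (M.vert c) = 3 ∨ M.sz (M.vert c) = 4
  b1 : M.cnt M.wE G 3 ≤ b.h3
  b2 : M.cnt M.wE G 4 ≤ b.h4
  b3 : M.cnt (fun w => ¬ M.wE w) G 3 ≤ b.v3
  b4 : M.cnt (fun w => ¬ M.wE w) G 4 ≤ b.v4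
variable {M}
theorem Inv.perm {EG OG EG' OG' G R sl B b} (I : M.Inv EG OG G R sl B b) (h1 : EG'.Perm EG) (h2 : OG'.Perm OG) :
    M.Inv EG' OG' G R sl B b := by
  have e1 : hs EG' = hs EG := by ext y; simp only [hs, mem_ofPred_eq, h1.mem_iff]
  have e2 : vs EG' = vs EG := by ext y; simp only [vs, mem_ofPred_eq, h1.mem_iff]
  have e3 : hs OG' = hs OG := by ext y; simp only [hs, mem_ofPred_eq, h2.mem_iff]
  have e4 : vs OG' = vs OG := by ext y; simp only [vs, mem_ofPred_eq, h2.mem_iff]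
  refine ⟨(h1.map _).nodup_iff.2 I.eN, (h2.map _).nodup_iff.2 I.oN, fun c => (h1.map _).mem_iff.trans (I.eM c),
    fun c => (h2.map _).mem_iff.trans (I.oM c), I.gU, I.gI, e1 ▸ e3 ▸ I.hp, e2 ▸ e4 ▸ I.vp, I.rE, I.rN,
    fun p hp => I.eL p (h1.mem_iff.1 hp), fun p hp => I.oL p (h2.mem_iff.1 hp), I.sG, I.sU, I.sV, I.s34, I.b1, I.b2, I.b3, I.b4⟩
theorem lenOK_of {b3 b4 h k h' k' : ℕ} {P : M.W → Prop} {G G' : Set (Cn Q)} {w : M.W}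
    (hs : M.sz w = 3 ∨ M.sz w = 4)
    (h1 : h' = h → M.sz w = k ∧ M.cnt P G' k + 1 ≤ M.cnt P G k) (h2 : h' ≠ h → k + k' ≤ M.sz w)
    (hb3 : M.cnt P G 3 ≤ b3) (hb4 : M.cnt P G 4 ≤ b4) : lenOK b3 b4 h k h' k' = true := by
  unfold lenOK
  rw [cond_beq, cond_beq, cond_beq]
  by_cases hh : h = h'
  · rw [if_pos hh]
    obtain ⟨h3, h4⟩ := h1 hh.symm
    rcases hs with hs | hs
    · have : k = 3 := by omega
      subst this
      simp only [if_true]; rw [Nat.ble_eq]; omega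
    · have : k = 4 := by omega
      subst this
      simp; omega
  · rw [if_neg hh, Nat.ble_eq]
    have := h2 (fun h => hh h.symm)
    omega
theorem bud_of {b h k h' K : ℕ} {P : M.W → Prop} {G G' : Set (Cn Q)} (hG : G ⊆ G')
    (h1 : h' = h → M.cnt P G' k + 1 ≤ M.cnt P G k) (hb : M.cnt P G K ≤ b) :
    M.cnt P G' K ≤ cond (Nat.beq h h') (cond (Nat.beq k K) (b - 1) b) b := by
  rw [cond_beq, cond_beq]
  have := M.cnt_mono P hG K
  split_ifs with hh hk
  · subst hk; have := h1 hh.symm; omega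
  · omega
  · omega
theorem Inv.glue {e c EG f d OG G R sl B b} (I : M.Inv ((e, c) :: EG) ((f, d) :: OG) G R sl B b) (hd : M.io c = d)
    (mh mv : ℕ) (hmh : mh = e.h ∨ mh = f.h) (hmv : mv = f.v ∨ mv = e.v) :
    lenOK b.h3 b.h4 e.h e.k f.h f.k = true ∧ lenOK b.v3 b.v4 e.v e.l f.v f.l = true ∧
    (e.h ≠ f.h → e.k + f.k ≤ 4) ∧ (e.v ≠ f.v → e.l + f.l ≤ 4) ∧
    M.Inv (updG f.h (e.k + f.k) f.v (e.l + f.l) mh mv EG) (updG e.h (e.k + f.k) e.v (e.l + f.l) mh mv OG)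
      (G ∪ {c, d}) R (fun x => if sl x = e.h ∨ sl x = f.h then mh else sl x) B (dec b e f) := by
  have hc := (I.eM c).1 (by simp)
  have hdo := (I.oM d).1 (by simp)
  have r1 : M.rho c = nx d := by rw [rho_apply, hd]
  have r2 : M.rho d = nx c := by rw [rho_apply, ← hd, M.inv]
  have ms : (f.h, f.k, d) ∈ hs ((f, d) :: OG) := ⟨(f, d), by simp, rfl⟩
  have mt : (e.h, e.k, c) ∈ hs ((e, c) :: EG) := ⟨(e, c), by simp, rfl⟩
  have ms' : (e.v, e.l, c) ∈ vs ((e, c) :: EG) := ⟨(e, c), by simp, rfl⟩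
  have mt' : (f.v, f.l, d) ∈ vs ((f, d) :: OG) := ⟨(f, d), by simp, rfl⟩
  have hG : G ⊆ G ∪ {c, d} := Set.subset_union_left
  have cG : c ∈ G ∪ ({c, d} : Set (Cn Q)) := by simp
  have dG : d ∈ G ∪ ({c, d} : Set (Cn Q)) := by simp
  have oT : ∀ t ∈ hs ((e, c) :: EG), t.2.2 ∉ G := by
    rintro t ⟨p, hp, rfl⟩
    exact ((I.eM p.2).1 (List.mem_map.2 ⟨p, hp, rfl⟩)).2.2
  have oT' : ∀ t ∈ vs ((f, d) :: OG), t.2.2 ∉ G := by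
    rintro t ⟨p, hp, rfl⟩
    exact ((I.oM p.2).1 (List.mem_map.2 ⟨p, hp, rfl⟩)).2.2
  have H1 : f.h = e.h → M.sz (M.vert c) = e.k ∧ M.cnt M.wE (G ∪ {c, d}) e.k + 1 ≤ M.cnt M.wE G e.k := by
    intro h
    obtain ⟨h1, h2⟩ := I.hp.len_same ms mt r1 hc.2.2 h
    refine ⟨h1, M.cnt_close _ hG _ (M.vert c) ((M.wE_vert c).2 hc.1) h1 c rfl hc.2.2 ?_⟩
    intro x hx
    rcases h2 x hx with rfl | h
    · exact cG
    · exact hG h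
  have V1 : e.v = f.v → M.sz (M.vert d) = f.l ∧
      M.cnt (fun w => ¬ M.wE w) (G ∪ {c, d}) f.l + 1 ≤ M.cnt (fun w => ¬ M.wE w) G f.l := by
    intro h
    obtain ⟨h1, h2⟩ := I.vp.len_same ms' mt' r2 hdo.2.2 h
    refine ⟨h1, M.cnt_close _ hG _ (M.vert d) (fun h => hdo.1 ((M.wE_vert d).1 h)) h1 d rfl hdo.2.2 ?_⟩
    intro x hx
    rcases h2 x hx with rfl | h
    · exact dG
    · exact hG h
  have el : e.v = f.v → e.l = f.l := fun h => (I.vp.ch _ ms' _ mt' h).1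
  have V1' : f.v = e.v → M.sz (M.vert d) = e.l ∧
      M.cnt (fun w => ¬ M.wE w) (G ∪ {c, d}) e.l + 1 ≤ M.cnt (fun w => ¬ M.wE w) G e.l := by
    intro h; rw [el h.symm]; exact V1 h.symm
  have H2 : f.h ≠ e.h → e.k + f.k ≤ M.sz (M.vert c) := fun h => I.hp.len_diff ms mt r1 oT h
  have V2 : f.v ≠ e.v → e.l + f.l ≤ M.sz (M.vert d) := fun h => by
    have := I.vp.len_diff ms' mt' r2 oT' (Ne.symm h)
    simp only at this; omega
  have sc := I.s34 c hc.2.2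
  have sd := I.s34 d hdo.2.2
  refine ⟨lenOK_of sc H1 H2 I.b1 I.b2, lenOK_of sd V1' V2 I.b3 I.b4, fun h => by have := H2 h.symm; omega,
    fun h => by have := V2 h.symm; omega, ?_⟩
  have eN := I.eN
  have oN := I.oN
  rw [map_cons, nodup_cons] at eN oN
  have eh : e.h = sl c := (I.eL (e, c) (by simp)).1
  have fh : f.h = sl (nx d) := (I.oL (f, d) (by simp)).1
  have ndE : isE (nx d) := (isE_nx d).2 hdo.1
  have slm : ∀ x, (sl x = e.h ∨ sl x = f.h) → isE x → x.1 ∈ R.map Prod.fst → M.vert x = M.vert c := by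
    intro x hx hxE hxR
    rcases hx with hx | hx
    · exact I.sV x c hxE hc.1 hxR hc.2.1 (hx.trans eh)
    · rw [I.sV x (nx d) hxE ndE hxR hdo.2.1 (hx.trans fh), ← r1, M.vert_rho]
  have mhB : mh ≤ B := by
    rcases hmh with h | h
    · rw [h, eh]; exact I.sU c hc.1 hc.2.1
    · rw [h, fh]; exact I.sU (nx d) ndE hdo.2.1
  have mvB : mv ≤ B := by
    rcases hmv with h | h
    · rw [h]; exact (I.oL (f, d) (by simp)).2
    · rw [h]; exact (I.eL (e, c) (by simp)).2
  have nsame : ∀ p ∈ EG, p.1.h ≠ e.h := fun p hp h => by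
    have := I.hp.tinj (t := (p.1.h, p.1.k, p.2)) (t' := (e.h, e.k, c)) ⟨p, by simp [hp], rfl⟩ mt h
    simp only [Prod.mk.injEq] at this
    exact eN.1 (List.mem_map.2 ⟨p, hp, this.2.2⟩)
  have nsame' : ∀ p ∈ OG, p.1.h ≠ f.h := fun p hp h => by
    have := I.hp.sinj (s := (p.1.h, p.1.k, p.2)) (s' := (f.h, f.k, d)) ⟨p, by simp [hp], rfl⟩ ms h
    simp only [Prod.mk.injEq] at this
    exact oN.1 (List.mem_map.2 ⟨p, hp, this.2.2⟩)
  refine ⟨by rw [updG_snd]; exact eN.2, by rw [updG_snd]; exact oN.2, ?_, ?_, ?_, ?_, ?_, ?_, I.rE, I.rN, ?_, ?_, ?_, ?_, ?_, ?_,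
    ?_, ?_, ?_, ?_⟩
  · intro x
    rw [updG_snd]
    have := I.eM x
    rw [map_cons, mem_cons] at this
    simp only [Set.mem_union, Set.mem_insert_iff, Set.mem_singleton_iff]
    constructor
    · intro hx
      obtain ⟨h1, h2, h3⟩ := this.1 (Or.inr hx)
      refine ⟨h1, h2, ?_⟩
      rintro (h | h | h)
      · exact h3 h
      · exact eN.1 (h ▸ hx)
      · exact hdo.1 (h ▸ h1)
    · rintro ⟨h1, h2, h3⟩
      push Not at h3
      exact (this.2 ⟨h1, h2, h3.1⟩).resolve_left h3.2.1
  · intro x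
    rw [updG_snd]
    have := I.oM x
    rw [map_cons, mem_cons] at this
    simp only [Set.mem_union, Set.mem_insert_iff, Set.mem_singleton_iff]
    constructor
    · intro hx
      obtain ⟨h1, h2, h3⟩ := this.1 (Or.inr hx)
      refine ⟨h1, h2, ?_⟩
      rintro (h | h | h)
      · exact h3 h
      · exact h1 (h ▸ hc.1)
      · exact oN.1 (h ▸ hx)
    · rintro ⟨h1, h2, h3⟩
      push Not at h3
      exact (this.2 ⟨h1, h2, h3.1⟩).resolve_left h3.2.2
  · rintro x (h | h)
    · exact I.gU x h
    · rcases h with rfl | rfl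
      · exact hc.2.1
      · exact hdo.2.1
  · rintro x (h | h)
    · exact hG (I.gI x h)
    · rcases h with rfl | rfl
      · rw [hd]; exact dG
      · have h' : M.io x = c := by rw [← hd, M.inv]
        rw [h']; exact cG
  · exact I.hp.glue hG ms mt r1 cG mh hmh (e.k + f.k) rfl (hs_upd _ _ _ _ _ _ _ _ I.oN) (hs_upd _ _ _ _ _ _ _ _ I.eN)
  · exact I.vp.glue hG ms' mt' r2 dG mv hmv (e.l + f.l) (add_comm _ _) (vs_upd _ _ _ _ _ _ _ _ I.eN) (vs_upd _ _ _ _ _ _ _ _ I.oN)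
  · intro p hp
    obtain ⟨q, hq, rfl⟩ := List.mem_map.1 hp
    obtain ⟨h1, h2⟩ := I.eL q (by simp [hq])
    simp only [up1, ← h1]
    refine ⟨?_, by split_ifs <;> assumption⟩
    simp only [nsame q hq, false_or]
  · intro p hp
    obtain ⟨q, hq, rfl⟩ := List.mem_map.1 hp
    obtain ⟨h1, h2⟩ := I.oL q (by simp [hq])
    simp only [up1, ← h1]
    refine ⟨?_, by split_ifs <;> assumption⟩
    simp only [nsame' q hq, or_false]
  · rintro x (h | h) hx
    · simp only [I.sG x h hx]
    · rcases h with rfl | rfl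
      · simp only [r1, ← eh, ← fh]; simp
      · exact absurd hx hdo.1
  · intro x hx hxR
    split_ifs
    · exact mhB
    · exact I.sU x hx hxR
  · intro x y hx hy hxR hyR h
    have key : ∀ x, ¬ (sl x = e.h ∨ sl x = f.h) → sl x = mh → False := by
      intro x h1 h2
      rcases hmh with h | h
      · exact h1 (Or.inl (h2.trans h))
      · exact h1 (Or.inr (h2.trans h))
    split_ifs at h with h1 h2 h2
    · rw [slm x h1 hx hxR, slm y h2 hy hyR]
    · exact (key y h2 h.symm).elim
    · exact (key x h1 h).elim
    · exact I.sV x y hx hy hxR hyR h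
  · intro x hx; exact I.s34 x (fun h => hx (hG h))
  · exact bud_of hG (fun h => (H1 h).2) I.b1
  · exact bud_of hG (fun h => (H1 h).2) I.b2
  · exact bud_of hG (fun h => (V1' h).2) I.b3
  · exact bud_of hG (fun h => (V1' h).2) I.b4
end Fin
end SqMap
theorem quadE {Q : Type} {c d : Cn Q} (hd : ¬ isE d) (h : c.1 = d.1) : isE c ↔ c = nx d ∨ c = pv d := by
  obtain ⟨q, i⟩ := c
  obtain ⟨q', j⟩ := d
  simp only at h; subst h
  simp only [isE, nx, pv, Prod.mk.injEq, true_and] at *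
  revert i j; decide
theorem quadO {Q : Type} {c d : Cn Q} (hd : ¬ isE d) (h : c.1 = d.1) : ¬ isE c ↔ c = d ∨ c = rv d := by
  obtain ⟨q, i⟩ := c
  obtain ⟨q', j⟩ := d
  simp only at h; subst h
  simp only [isE, rv, Prod.mk.injEq, true_and] at *
  revert i j; decide
theorem nx_ne_pv {Q : Type} (d : Cn Q) : pv d ≠ nx d := by
  obtain ⟨q', j⟩ := d
  simp only [nx, pv, Prod.mk.injEq, true_and, Ne]
  revert j; decide
theorem rv_ne {Q : Type} (d : Cn Q) : rv d ≠ d := by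
  obtain ⟨q', j⟩ := d
  simp only [rv, Prod.mk.injEq, true_and, Ne]
  revert j; decide
theorem hs_cons {Q : Type} (p) (L : List (Srch.En × (Cn Q))) (y) : y ∈ hs (p :: L) ↔ y = (p.1.h, p.1.k, p.2) ∨ y ∈ hs L := by
  simp only [hs, mem_ofPred_eq, exists_mem_cons_iff]
theorem vs_cons {Q : Type} (p) (L : List (Srch.En × (Cn Q))) (y) : y ∈ vs (p :: L) ↔ y = (p.1.v, p.1.l, p.2) ∨ y ∈ vs L := by
  simp only [vs, mem_ofPred_eq, exists_mem_cons_iff]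
namespace SqMap
open Srch
variable {n : ℕ} {Q : Type} {M : SqMap n Q}
section Fin
open Classical
variable [Fintype Q]
theorem Inv.add {EG OG G R sl B b} (I : M.Inv EG OG G R sl B b) (d : Cn Q) (hd : ¬ isE d) (hdR : d.1 ∉ R.map Prod.fst) :
    M.Inv ((⟨B + 2, 1, B + 1, 1⟩, nx d) :: (⟨B + 1, 1, B + 2, 1⟩, pv d) :: EG)
      ((⟨B + 2, 1, B + 2, 1⟩, d) :: (⟨B + 1, 1, B + 1, 1⟩, rv d) :: OG) G (pv d :: R)
      (fun x => if x = nx d then B + 2 else if x = pv d then B + 1 else sl x) (B + 2) b := by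
  have n1 := nx_ne_pv d
  have n2 := rv_ne d
  have qe : ∀ p ∈ EG, p.2.1 ∈ R.map Prod.fst := fun p hp => ((I.eM p.2).1 (List.mem_map.2 ⟨p, hp, rfl⟩)).2.1
  have qo : ∀ p ∈ OG, p.2.1 ∈ R.map Prod.fst := fun p hp => ((I.oM p.2).1 (List.mem_map.2 ⟨p, hp, rfl⟩)).2.1
  have ne1 : ∀ x : Cn Q, x.1 ∈ R.map Prod.fst → ∀ y : Cn Q, y.1 = d.1 → x ≠ y := by
    rintro x hx y hy rfl; exact hdR (hy ▸ hx)
  have slR : ∀ x : Cn Q, x.1 ∈ R.map Prod.fst →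
      (if x = nx d then B + 2 else if x = pv d then B + 1 else sl x) = sl x := by
    intro x hx
    rw [if_neg (ne1 x hx (nx d) rfl), if_neg (ne1 x hx (pv d) rfl)]
  have lh : ∀ y ∈ hs OG, y.1 ≤ B := by
    rintro y ⟨p, hp, rfl⟩
    simp only [(I.oL p hp).1]
    exact I.sU _ ((isE_nx _).2 ((I.oM p.2).1 (List.mem_map.2 ⟨p, hp, rfl⟩)).1) (qo p hp)
  have lv : ∀ y ∈ vs EG, y.1 ≤ B := by
    rintro y ⟨p, hp, rfl⟩
    exact (I.eL p hp).2
  have ch : ∀ y ∈ hs OG, y.2.2.1 ∈ R.map Prod.fst := by rintro y ⟨p, hp, rfl⟩; exact qo p hp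
  have ch' : ∀ y ∈ hs EG, y.2.2.1 ∈ R.map Prod.fst := by rintro y ⟨p, hp, rfl⟩; exact qe p hp
  have cv : ∀ y ∈ vs OG, y.2.2.1 ∈ R.map Prod.fst := by rintro y ⟨p, hp, rfl⟩; exact qo p hp
  have cv' : ∀ y ∈ vs EG, y.2.2.1 ∈ R.map Prod.fst := by rintro y ⟨p, hp, rfl⟩; exact qe p hp
  have mem' : ∀ x : Cn Q, x.1 ∈ (pv d :: R).map Prod.fst ↔ x.1 = d.1 ∨ x.1 ∈ R.map Prod.fst := by
    intro x; rw [map_cons, mem_cons]; rfl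
  have gd : ∀ x : Cn Q, x.1 = d.1 → x ∉ G := fun x hx h => hdR (hx ▸ I.gU x h)
  refine ⟨?_, ?_, ?_, ?_, ?_, I.gI, ?_, ?_, ?_, ?_, ?_, ?_, ?_, ?_, ?_, I.s34, I.b1, I.b2, I.b3, I.b4⟩
  · simp only [map_cons, nodup_cons, mem_cons, not_or]
    refine ⟨⟨n1.symm, fun h => ?_⟩, fun h => ?_, I.eN⟩
    · exact hdR ((I.eM _).1 h).2.1
    · exact hdR ((I.eM _).1 h).2.1
  · simp only [map_cons, nodup_cons, mem_cons, not_or]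
    refine ⟨⟨n2.symm, fun h => ?_⟩, fun h => ?_, I.oN⟩
    · exact hdR ((I.oM _).1 h).2.1
    · exact hdR ((I.oM _).1 h).2.1
  · intro x
    rw [mem', map_cons, map_cons, mem_cons, mem_cons, I.eM]
    by_cases hx : x.1 = d.1
    · have := gd x hx
      rw [hx, quadE hd hx]
      simp only [hdR, false_and, and_false, or_false, true_or, this, not_false_eq_true, and_true]
    · have h1 : x ≠ nx d := fun h => hx (by rw [h]; rfl)
      have h2 : x ≠ pv d := fun h => hx (by rw [h]; rfl)
      simp only [hx, h1, h2, false_or]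
  · intro x
    rw [mem', map_cons, map_cons, mem_cons, mem_cons, I.oM]
    by_cases hx : x.1 = d.1
    · have := gd x hx
      rw [hx, quadO hd hx]
      simp only [hdR, false_and, and_false, or_false, true_or, this, not_false_eq_true, and_true]
    · have h1 : x ≠ d := fun h => hx (by rw [h])
      have h2 : x ≠ rv d := fun h => hx (by rw [h]; rfl)
      simp only [hx, h1, h2, false_or]
  · intro x hx; rw [mem']; exact Or.inr (I.gU x hx)
  · refine (I.hp.add (B + 1) (rv d) (pv d) (nx_rv_pv d) ?_ ?_ ?_ (hs_cons _ _) (hs_cons _ _)).add (B + 2) d (nx d) rfl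
      ?_ ?_ ?_ (hs_cons _ _) (hs_cons _ _)
    · intro y hy; have := lh y hy; omega
    · intro y hy; exact ne1 _ (ch y hy) _ rfl
    · intro y hy; exact ne1 _ (ch' y hy) _ rfl
    · intro y hy
      rcases (hs_cons _ _ _).1 hy with rfl | hy
      · simp
      · have := lh y hy; omega
    · intro y hy
      rcases (hs_cons _ _ _).1 hy with rfl | hy
      · exact n2
      · exact ne1 _ (ch y hy) _ rfl
    · intro y hy
      rcases (hs_cons _ _ _).1 hy with rfl | hy
      · exact n1
      · exact ne1 _ (ch' y hy) _ rfl
  · have e1 : ∀ y, y ∈ vs ((⟨B + 2, 1, B + 1, 1⟩, nx d) :: (⟨B + 1, 1, B + 2, 1⟩, pv d) :: EG) ↔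
        y = (B + 2, 1, pv d) ∨ y ∈ vs (((⟨B + 2, 1, B + 1, 1⟩, nx d) : En × (Cn Q)) :: EG) := by
      intro y; rw [vs_cons, vs_cons, vs_cons]; exact or_left_comm
    refine (I.vp.add (B + 1) (nx d) (rv d) (nx_nx d) ?_ ?_ ?_ (vs_cons _ _) (vs_cons _ _)).add (B + 2) (pv d) d (nx_pv d)
      ?_ ?_ ?_ e1 (vs_cons _ _)
    · intro y hy; have := lv y hy; omega
    · intro y hy; exact ne1 _ (cv' y hy) _ rfl
    · intro y hy; exact ne1 _ (cv y hy) _ rfl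
    · intro y hy
      rcases (vs_cons _ _ _).1 hy with rfl | hy
      · simp
      · have := lv y hy; omega
    · intro y hy
      rcases (vs_cons _ _ _).1 hy with rfl | hy
      · exact n1.symm
      · exact ne1 _ (cv' y hy) _ rfl
    · intro y hy
      rcases (vs_cons _ _ _).1 hy with rfl | hy
      · exact n2
      · exact ne1 _ (cv y hy) _ rfl
  · intro x hx
    rcases List.mem_cons.1 hx with rfl | hx
    · exact (isE_pv d).2 hd
    · exact I.rE x hx
  · rw [map_cons, nodup_cons]; exact ⟨hdR, I.rN⟩
  · intro p hp
    rcases List.mem_cons.1 hp with rfl | hp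
    · simp
    rcases List.mem_cons.1 hp with rfl | hp
    · simp [n1]
    · rw [slR _ (qe p hp)]; exact ⟨(I.eL p hp).1, by have := (I.eL p hp).2; omega⟩
  · intro p hp
    rcases List.mem_cons.1 hp with rfl | hp
    · simp
    rcases List.mem_cons.1 hp with rfl | hp
    · simp [n1, nx_rv_pv]
    · rw [slR (nx p.2) (qo p hp)]; exact ⟨(I.oL p hp).1, by have := (I.oL p hp).2; omega⟩
  · intro x hx hE
    have h1 := I.gU x hx
    have h2 := I.gU _ (I.gI x hx)
    rw [slR x h1, slR (M.rho x) h2]; exact I.sG x hx hE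
  · intro x hx hxR
    rcases (mem' x).1 hxR with h | h
    · split_ifs
      · omega
      · omega
      · rcases (quadE hd h).1 hx with h | h <;> contradiction
    · rw [slR x h]; have := I.sU x hx h; omega
  · have key : ∀ x, isE x → x.1 ∈ (pv d :: R).map Prod.fst →
      (x = nx d ∧ (if x = nx d then B + 2 else if x = pv d then B + 1 else sl x) = B + 2) ∨
      (x = pv d ∧ (if x = nx d then B + 2 else if x = pv d then B + 1 else sl x) = B + 1) ∨
      (x.1 ∈ R.map Prod.fst ∧ (if x = nx d then B + 2 else if x = pv d then B + 1 else sl x) = sl x ∧ sl x ≤ B) := by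
      intro x hx hxR
      rcases (mem' x).1 hxR with h | h
      · rcases (quadE hd h).1 hx with h | h
        · left; simp [h]
        · right; left; simp [h, n1]
      · right; right; exact ⟨h, slR x h, I.sU x hx h⟩
    intro x y hx hy hxR hyR h
    rcases key x hx hxR with ⟨h1, h2⟩ | ⟨h1, h2⟩ | ⟨h1, h2, h3⟩ <;> rcases key y hy hyR with ⟨h1', h2'⟩ | ⟨h1', h2'⟩ | ⟨h1', h2', h3'⟩ <;>
      rw [h2, h2'] at h
    · rw [h1, h1']
    · omega
    · omega
    · omega
    · rw [h1, h1']
    · omega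
    · omega
    · omega
    · exact I.sV x y hx hy h1 h1' h
theorem Inv.new {e c EG OG G R sl B b} (I : M.Inv ((e, c) :: EG) OG G R sl B b) (hdR : (M.io c).1 ∉ R.map Prod.fst) :
    e.k ≤ 3 ∧ e.l ≤ 3 ∧ ∃ sl', M.Inv
      ((⟨e.h, e.k + 1, B + 1, 1⟩, nx (M.io c)) :: (⟨B + 1, 1, e.v, e.l + 1⟩, pv (M.io c)) :: EG)
      ((⟨B + 1, 1, B + 1, 1⟩, rv (M.io c)) :: updG e.h (e.k + 1) e.v (e.l + 1) e.h e.v OG)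
      (G ∪ {c, M.io c}) (pv (M.io c) :: R) sl' (B + 1) b ∧
      sl' (pv (M.io c)) = B + 1 ∧ sl' (nx (M.io c)) = e.h ∧ ∀ x, isE x → x.1 ∈ R.map Prod.fst → sl' x = sl x := by
  have hc := (I.eM c).1 (by simp)
  have hd : ¬ isE (M.io c) := by rw [M.par]; exact not_not.2 hc.1
  have I1 := (I.add (M.io c) hd hdR).perm (EG' := (e, c) :: (⟨B + 2, 1, B + 1, 1⟩, nx (M.io c)) :: (⟨B + 1, 1, B + 2, 1⟩, pv (M.io c)) :: EG)
    (by
      refine (List.Perm.swap _ _ _).trans ?_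
      exact List.Perm.cons _ (List.Perm.swap _ _ _)) (List.Perm.refl _)
  have hel := I.eL (e, c) (by simp)
  have ehB : e.h ≤ B := by rw [hel.1]; exact I.sU c hc.1 hc.2.1
  have evB : e.v ≤ B := hel.2
  obtain ⟨-, -, g1, g2, I2⟩ := I1.glue rfl e.h e.v (Or.inl rfl) (Or.inr rfl)
  have k1 : e.k ≤ 3 := by have := g1 (by simp only; omega); simp only at this; omega
  have k2 : e.l ≤ 3 := by have := g2 (by simp only; omega); simp only at this; omega
  have hdec : Srch.dec b e ⟨B + 2, 1, B + 2, 1⟩ = b := by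
    simp only [Srch.dec, cond_beq]
    rw [if_neg (by omega), if_neg (by omega), if_neg (by omega), if_neg (by omega)]
  rw [hdec] at I2
  have qe : ∀ p ∈ EG, p.1.h ≤ B ∧ p.1.v ≤ B := by
    intro p hp
    have h1 := I.eL p (by simp [hp])
    have h2 := (I.eM p.2).1 (List.mem_map.2 ⟨p, by simp [hp], rfl⟩)
    exact ⟨by rw [h1.1]; exact I.sU _ h2.1 h2.2.1, h1.2⟩
  have eE : updG (B + 2) (e.k + 1) (B + 2) (e.l + 1) e.h e.v ((⟨B + 2, 1, B + 1, 1⟩, nx (M.io c)) :: (⟨B + 1, 1, B + 2, 1⟩, pv (M.io c)) :: EG)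
      = (⟨e.h, e.k + 1, B + 1, 1⟩, nx (M.io c)) :: (⟨B + 1, 1, e.v, e.l + 1⟩, pv (M.io c)) :: EG := by
    simp only [updG, map_cons, up1]
    have : EG.map (fun p => (up1 (B + 2) (e.k + 1) (B + 2) (e.l + 1) e.h e.v p.1, p.2)) = EG := by
      conv_rhs => rw [← List.map_id EG]
      apply map_congr_left
      rintro ⟨p, x⟩ hp
      have := qe _ hp
      simp only at this
      simp only [up1, id]
      rw [if_neg (by omega), if_neg (by omega), if_neg (by omega), if_neg (by omega)]
    simp only [up1] at this
    rw [this]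
    simp
  have eO : updG e.h (e.k + 1) e.v (e.l + 1) e.h e.v ((⟨B + 1, 1, B + 1, 1⟩, rv (M.io c)) :: OG)
      = (⟨B + 1, 1, B + 1, 1⟩, rv (M.io c)) :: updG e.h (e.k + 1) e.v (e.l + 1) e.h e.v OG := by
    simp only [updG, map_cons, up1]
    rw [if_neg (by omega), if_neg (by omega), if_neg (by omega), if_neg (by omega)]
  simp only at I2
  rw [eE, eO] at I2
  have n1 := nx_ne_pv (M.io c)
  have slR : ∀ x, isE x → x.1 ∈ R.map Prod.fst → (fun x => if (if x = nx (M.io c) then B + 2 else if x = pv (M.io c) then B + 1 else sl x) = e.h ∨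
      (if x = nx (M.io c) then B + 2 else if x = pv (M.io c) then B + 1 else sl x) = B + 2 then e.h else
      (if x = nx (M.io c) then B + 2 else if x = pv (M.io c) then B + 1 else sl x)) x = sl x := by
    intro x hx hxR
    have h1 : x ≠ nx (M.io c) := fun h => hdR (by rw [h] at hxR; exact hxR)
    have h2 : x ≠ pv (M.io c) := fun h => hdR (by rw [h] at hxR; exact hxR)
    have h3 := I.sU x hx hxR
    simp only [h1, h2, if_false]
    split_ifs with h
    · rcases h with h | h
      · exact h.symm
      · omega
    · rfl
  have v1 : (fun x => if (if x = nx (M.io c) then B + 2 else if x = pv (M.io c) then B + 1 else sl x) = e.h ∨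
      (if x = nx (M.io c) then B + 2 else if x = pv (M.io c) then B + 1 else sl x) = B + 2 then e.h else
      (if x = nx (M.io c) then B + 2 else if x = pv (M.io c) then B + 1 else sl x)) (pv (M.io c)) = B + 1 := by
    simp only [n1, if_false, if_true]
    rw [if_neg (by omega)]
  have v2 : (fun x => if (if x = nx (M.io c) then B + 2 else if x = pv (M.io c) then B + 1 else sl x) = e.h ∨
      (if x = nx (M.io c) then B + 2 else if x = pv (M.io c) then B + 1 else sl x) = B + 2 then e.h else
      (if x = nx (M.io c) then B + 2 else if x = pv (M.io c) then B + 1 else sl x)) (nx (M.io c)) = e.h := by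
    simp
  refine ⟨k1, k2, (fun x => if (if x = nx (M.io c) then B + 2 else if x = pv (M.io c) then B + 1 else sl x) = e.h ∨
      (if x = nx (M.io c) then B + 2 else if x = pv (M.io c) then B + 1 else sl x) = B + 2 then e.h else
      (if x = nx (M.io c) then B + 2 else if x = pv (M.io c) then B + 1 else sl x)), ⟨I2.eN, I2.oN, I2.eM, I2.oM, I2.gU, I2.gI, I2.hp, I2.vp, I2.rE, I2.rN, ?_, ?_, I2.sG, ?_, I2.sV, I2.s34, I2.b1, I2.b2,
    I2.b3, I2.b4⟩, v1, v2, slR⟩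
  · intro p hp
    refine ⟨(I2.eL p hp).1, ?_⟩
    rcases List.mem_cons.1 hp with rfl | hp
    · simp
    rcases List.mem_cons.1 hp with rfl | hp
    · simp only; omega
    · have := (qe p hp).2; omega
  · intro p hp
    refine ⟨(I2.oL p hp).1, ?_⟩
    rcases List.mem_cons.1 hp with rfl | hp
    · simp
    · obtain ⟨q, hq, rfl⟩ := List.mem_map.1 hp
      have := (I.oL q hq).2
      simp only [up1]
      split_ifs <;> omega
  · intro x hx hxR
    rw [map_cons, mem_cons] at hxR
    rcases hxR with h | h
    · rcases (quadE hd (h : x.1 = (M.io c).1)).1 hx with rfl | rfl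
      · exact v2.le.trans (by omega)
      · exact v1.le
    · exact (slR x hx h).le.trans (by have := I.sU x hx h; omega)
end Fin
end SqMap
namespace SqMap
open Srch
variable {n : ℕ} {Q : Type} {M : SqMap n Q}
section Fin
open Classical
variable [Fintype Q]
theorem Inv.leaf {OG G R sl B b} (I : M.Inv [] OG G R sl B b) (hn : n = 42) (hR : R ≠ []) :
    R.length = card Q ∧ leafOK (R.map fun c => (sl c, sl (rv c))) ≠ true := by
  have hO : OG = [] := by
    cases OG with
    | nil => rfl
    | cons p t =>
      obtain ⟨t, ⟨q, hq, _⟩, _⟩ := I.hp.st (p.1.h, p.1.k, p.2) ⟨p, by simp, rfl⟩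
      simp at hq
  subst hO
  have hG : ∀ c : Cn Q, c.1 ∈ R.map Prod.fst → c ∈ G := by
    intro c hc
    by_contra hg
    by_cases hE : isE c
    · have := (I.eM c).2 ⟨hE, hc, hg⟩; simp at this
    · have := (I.oM c).2 ⟨hE, hc, hg⟩; simp at this
  have hU := M.conn {q | q ∈ R.map Prod.fst} (by
      cases R with
      | nil => exact absurd rfl hR
      | cons a t => exact ⟨a.1, by simp⟩) (by
      intro c hc
      exact I.gU _ (I.gI c (hG c hc)))
  have hall : ∀ q, q ∈ R.map Prod.fst := by
    intro q
    have : q ∈ {q | q ∈ R.map Prod.fst} := by rw [hU]; trivial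
    exact this
  refine ⟨?_, M.leaf_contra hn R I.rE I.rN hall sl ?_⟩
  · have h1 := List.toFinset_card_of_nodup I.rN
    have h2 : (R.map Prod.fst).toFinset = Finset.univ := by ext q; simp only [List.mem_toFinset, hall, mem_univ]
    rw [h2, card_univ, length_map] at h1
    exact h1.symm
  · intro c d hc hd
    constructor
    · intro h
      exact M.inv_of_rho sl isE (M.isE_rho) (fun c hc => I.sG c (hG c (hall _)) hc) hc h
    · exact I.sV c d hc hd (hall _) (hall _)
theorem go_sound (hn : n = 42) (hQ : card Q = 16) (st : List (Nat × Nat)) (fuel : ℕ) :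
    ∀ EG OG G R sl b lg, M.Inv EG OG G R sl R.length b → R ≠ [] →
      cur st lg = R.map (fun c => (sl c, sl (rv c))) →
      go (fun lg => leafOK (cur st lg)) 16 fuel R.length (EG.map Prod.fst) (OG.map Prod.fst) b lg = true → False := by
  induction fuel with
  | zero => intro EG OG G R sl b lg I hR hc h; simp [go] at h
  | succ k ih =>
    intro EG OG G R sl b lg I hR hcur h
    cases EG with
    | nil =>
      obtain ⟨h1, h2⟩ := I.leaf hn hR
      rw [List.map_nil, go] at h
      rw [h1, hQ] at h
      simp only [Nat.beq_refl, cond_true, hcur] at h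
      exact h2 h
    | cons p t =>
      rw [map_cons, go] at h
      simp only [and_eq_true] at h
      obtain ⟨hA, hB⟩ := h
      obtain ⟨g', hg1, hg2⟩ := perm_lift Prod.fst (best_perm p.1 (t.map Prod.fst)).symm (p :: t) (by simp)
      cases g' with
      | nil => simp at hg2
      | cons ec EG' =>
        obtain ⟨e, c⟩ := ec
        simp only [map_cons, List.cons.injEq] at hg2
        rw [← hg2.1, ← hg2.2] at hA hB
        have I1 := I.perm hg1 (List.Perm.refl _)
        have hc := (I1.eM c).1 (by simp)
        have hdo : ¬ isE (M.io c) := by rw [M.par]; exact not_not.2 hc.1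
        by_cases hdR : (M.io c).1 ∈ R.map Prod.fst
        · have hdG : M.io c ∉ G := fun h => hc.2.2 (by have := I.gI _ h; rwa [M.inv] at this)
          obtain ⟨⟨f, d⟩, hf, hfd⟩ := List.mem_map.1 ((I.oM _).2 ⟨hdo, hdR, hdG⟩)
          simp only at hfd
          obtain ⟨A, C, rfl⟩ := List.append_of_mem hf
          have I2 := I1.perm (List.Perm.refl _) (OG' := (f, d) :: (A.reverse ++ C)) (by
            refine List.Perm.trans ?_ List.perm_middle.symm
            exact List.Perm.cons _ (List.Perm.append_right _ (List.reverse_perm A)))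
          obtain ⟨l1, l2, -, -, I3⟩ := I2.glue hfd.symm f.h f.v (Or.inr rfl) (Or.inl rfl)
          have := tries_spec _ _ _ _ _ _ _ hB (A.map Prod.fst) f (C.map Prod.fst) (by simp) l1 l2
          refine ih _ _ _ _ _ _ (Ev.mrg e.h f.h :: lg) I3 hR ?_ ?_
          · rw [cur, hcur, map_map]
            apply map_congr_left
            intro x hx
            simp only [comp, cond_beq]
            have key : ∀ a : ℕ, (if a = e.h then f.h else a) = if a = e.h ∨ a = f.h then f.h else a := by
              intro a; split_ifs <;> omega
            rw [key, key]
          · rw [updG_fst, updG_fst]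
            simpa using this
        · obtain ⟨k1, k2, sl', I2, s1, s2, s3⟩ := I1.new hdR
          have hlen : R.length + 1 ≤ 16 := by
            have h1 := List.Nodup.length_le_card I2.rN
            rw [hQ, length_map, length_cons] at h1
            exact h1
          have hlt : R.length < 16 := hlen
          rw [show Nat.ble (R.length + 1) 16 = true from ble_eq_true_of_le hlen, ble_eq_true_of_le k1, ble_eq_true_of_le k2] at hA
          simp only [Bool.and_self, cond_true] at hA
          refine ih _ _ _ _ _ _ (Ev.new (R.length + 1) e.h :: lg) I2 (by simp) ?_ ?_
          · rw [cur, hcur, map_cons, s1]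
            have : rv (pv (M.io c)) = nx (M.io c) := by
              rw [← nx_rv_pv, rv_nx, rv_rv]
            rw [this, s2]
            congr 1
            apply map_congr_left
            intro x hx
            have hxR : x.1 ∈ R.map Prod.fst := List.mem_map.2 ⟨x, hx, rfl⟩
            rw [s3 x (I.rE x hx) hxR, s3 (rv x) ((isE_rv x).2 (I.rE x hx)) hxR]
          · simp only [map_cons, updG_fst, length_cons]
            exact hA
end Fin
end SqMap
theorem quadEE {Q : Type} {c d : Cn Q} (hc : isE c) (hd : isE d) (h : c.1 = d.1) : c = d ∨ c = rv d := by
  obtain ⟨q, i⟩ := c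
  obtain ⟨q', j⟩ := d
  simp only at h; subst h
  simp only [isE, rv, Prod.mk.injEq, true_and] at *
  revert i j; decide
theorem quadEO {Q : Type} {c d : Cn Q} (hc : ¬ isE c) (hd : isE d) (h : c.1 = d.1) : c = nx d ∨ c = pv d := by
  obtain ⟨q, i⟩ := c
  obtain ⟨q', j⟩ := d
  simp only at h; subst h
  simp only [isE, nx, pv, Prod.mk.injEq, true_and] at *
  revert i j; decide
namespace SqMap
open Srch
variable {n : ℕ} {Q : Type} (M : SqMap n Q)
section Fin
open Classical
variable [Fintype Q]
theorem star_inv (c0 : Cn Q) (hc0 : isE c0) (d : ℕ) (hd : M.sz (M.vert c0) = d)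
    (h34 : ∀ w, w ≠ M.vert c0 → M.sz w = 3 ∨ M.sz w = 4) (b : Bd)
    (b1 : (Finset.univ.filter fun w : M.W => (M.wE w ∧ M.sz w = 3) ∧ w ≠ M.vert c0).card ≤ b.h3)
    (b2 : (Finset.univ.filter fun w : M.W => (M.wE w ∧ M.sz w = 4) ∧ w ≠ M.vert c0).card ≤ b.h4)
    (b3 : (Finset.univ.filter fun w : M.W => (¬ M.wE w ∧ M.sz w = 3) ∧ w ≠ M.vert c0).card ≤ b.v3)
    (b4 : (Finset.univ.filter fun w : M.W => (¬ M.wE w ∧ M.sz w = 4) ∧ w ≠ M.vert c0).card ≤ b.v4) :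
    ∃ EG OG G R sl, M.Inv EG OG G R sl R.length b ∧ R.length = d ∧ EG.map Prod.fst = initE d d ∧
      OG.map Prod.fst = initO d ∧ initQ d = R.map (fun c => (sl c, sl (rv c))) := by
  obtain ⟨s1, s2, s3⟩ := M.sz_spec c0
  rw [hd] at s1 s2 s3
  set c : ℕ → Cn Q := fun j => (M.rho ^ j) c0 with hcdef
  have cv : ∀ j, M.vert (c j) = M.vert c0 := fun j => M.vert_pow c0 j
  have cE : ∀ j, isE (c j) := fun j => (M.isE_of_vert (cv j)).2 hc0
  have cs : ∀ j, M.rho (c j) = c (j + 1) := fun j => by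
    simp only [hcdef]; rw [pow_succ', Equiv.Perm.mul_apply]
  have cper : ∀ i j, c (j + d * i) = c j := by
    intro i j
    induction i with
    | zero => rfl
    | succ i ih =>
      rw [← ih]; simp only [hcdef]
      rw [show j + d * (i + 1) = (j + d * i) + d by ring, pow_add, Equiv.Perm.mul_apply, s2]
  have cm : ∀ j, c (j % d) = c j := by
    intro j
    conv_rhs => rw [← mod_add_div j d]
    rw [cper]
  have cinj' : ∀ i j, i ≤ j → j < d → c i = c j → i = j := by
    intro i j hij hj h
    by_contra hne
    refine s3 (j - i) (by omega) (by omega) ?_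
    simp only [hcdef] at h
    rw [show j = i + (j - i) by omega, pow_add, Equiv.Perm.mul_apply] at h
    exact ((M.rho ^ i).injective h).symm
  have cinj : ∀ i j, i < d → j < d → c i = c j → i = j := by
    intro i j hi hj h
    rcases le_total i j with hij | hij
    · exact cinj' i j hij hj h
    · exact (cinj' j i hij hi h.symm).symm
  have crv : ∀ i j, c i ≠ rv (c j) := by
    intro i j h
    apply M.vert_ne_rv (cE j)
    rw [← h, cv, cv]
  have cq : ∀ i j, (c i).1 = (c j).1 → c i = c j := by
    intro i j h
    exact (quadEE (cE i) (cE j) h).resolve_right (crv i j)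
  have cio : ∀ j, M.io (c j) = pv (c (j + 1)) := by
    intro j
    rw [← cs, rho_apply, pv_nx]
  have call : ∀ x, M.vert x = M.vert c0 → ∃ j, j < d ∧ x = c j := by
    intro x hx
    obtain ⟨i, hi⟩ := M.exists_pow hx.symm
    exact ⟨i % d, mod_lt _ s1, by rw [cm]; exact hi.symm⟩
  have rvi : ∀ x y : Cn Q, rv x = rv y → x = y := fun x y h => by rw [← rv_rv x, h, rv_rv]
  have nxi : ∀ x y : Cn Q, nx x = nx y → x = y := fun x y h => by rw [← pv_nx x, h, pv_nx]
  set G : Set (Cn Q) := {x | ∃ j, x = c j ∨ x = pv (c j)} with hG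
  set sl : Cn Q → ℕ := fun x => ∑ k ∈ Finset.range d, if x = rv (c k) then k + 1 else 0 with hsl
  have sl0 : ∀ j, sl (c j) = 0 := by
    intro j
    apply sum_eq_zero
    intro k _
    rw [if_neg (crv j k)]
  have sl1 : ∀ j, j < d → sl (rv (c j)) = j + 1 := by
    intro j hj
    simp only [hsl]
    rw [sum_eq_single j]
    · simp
    · intro k hk hkj
      rw [if_neg]
      intro h
      exact hkj (cinj k j (Finset.mem_range.1 hk) hj (rvi _ _ h).symm)
    · intro h; exact absurd (Finset.mem_range.2 hj) h
  set I := (List.range d).reverse with hI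
  have mI : ∀ j, j ∈ I ↔ j < d := by intro j; simp [hI]
  have nI : I.Nodup := List.nodup_reverse.2 List.nodup_range
  set EG : List (En × (Cn Q)) := I.map (fun k => (⟨k + 1, 1, (k + d - 1) % d, 2⟩, rv (c k))) with hEG
  set OG : List (En × (Cn Q)) := I.map (fun k => (⟨k + 1, 1, k, 2⟩, nx (c k))) with hOG
  set R := I.map c with hRdef
  have hRl : R.length = d := by simp [hRdef, hI]
  have mR : ∀ x : Cn Q, x.1 ∈ R.map Prod.fst ↔ ∃ j, j < d ∧ x.1 = (c j).1 := by
    intro x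
    simp only [hRdef, map_map, mem_map, mI, comp]
    constructor
    · rintro ⟨j, h1, h2⟩; exact ⟨j, h1, h2.symm⟩
    · rintro ⟨j, h1, h2⟩; exact ⟨j, h1, h2.symm⟩
  have rvG : ∀ j, rv (c j) ∉ G := by
    rintro j ⟨i, h | h⟩
    · exact crv i j h.symm
    · have h1 : isE (rv (c j)) := (isE_rv _).2 (cE j)
      rw [h, isE_pv] at h1
      exact h1 (cE i)
  have nxG : ∀ j, nx (c j) ∉ G := by
    rintro j ⟨i, h | h⟩
    · have h1 := cE i
      rw [← h, isE_nx] at h1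
      exact h1 (cE j)
    · have h1 := cq j i (show (nx (c j)).1 = (pv (c i)).1 from congrArg Prod.fst h)
      rw [h1] at h
      exact nx_ne_pv _ h.symm
  have EE : ∀ x, isE x → x.1 ∈ R.map Prod.fst → ∃ j, j < d ∧ (x = c j ∨ x = rv (c j)) := by
    intro x hx hxR
    obtain ⟨j, hj, h⟩ := (mR x).1 hxR
    exact ⟨j, hj, quadEE hx (cE j) h⟩
  have memG : ∀ x, x ∈ G → ∃ j, j < d ∧ (x = c j ∨ x = pv (c j)) := by
    rintro x ⟨j, h⟩
    exact ⟨j % d, mod_lt _ s1, by rw [cm]; exact h⟩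
  have hbud : ∀ (P : M.W → Prop) (k : ℕ), M.cnt P G k ≤ (Finset.univ.filter fun w : M.W => (P w ∧ M.sz w = k) ∧ w ≠ M.vert c0).card := by
    intro P k
    apply card_le_card
    intro w
    simp only [mem_filter, mem_univ, true_and]
    rintro ⟨h1, h2, x, h3, h4⟩
    refine ⟨⟨h1, h2⟩, ?_⟩
    rintro rfl
    obtain ⟨j, _, hj⟩ := call x h3
    exact h4 ⟨j, Or.inl hj⟩
  refine ⟨EG, OG, G, R, sl, ?_, hRl, ?_, ?_, ?_⟩
  · refine ⟨?_, ?_, ?_, ?_, ?_, ?_, ?_, ?_, ?_, ?_, ?_, ?_, ?_, ?_, ?_, ?_, (hbud _ _).trans b1, (hbud _ _).trans b2,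
      ?_, ?_⟩
    · rw [hEG, map_map]
      refine List.Nodup.map_on ?_ nI
      intro x hx y hy h
      exact cinj x y ((mI x).1 hx) ((mI y).1 hy) (rvi _ _ h)
    · rw [hOG, map_map]
      refine List.Nodup.map_on ?_ nI
      intro x hx y hy h
      exact cinj x y ((mI x).1 hx) ((mI y).1 hy) (nxi _ _ h)
    · intro x
      have hm : x ∈ EG.map Prod.snd ↔ ∃ j, j < d ∧ rv (c j) = x := by
        rw [hEG, map_map]
        simp only [mem_map, mI, comp]
      rw [hm]
      constructor
      · rintro ⟨j, hj, rfl⟩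
        exact ⟨(isE_rv _).2 (cE j), (mR _).2 ⟨j, hj, rfl⟩, rvG j⟩
      · rintro ⟨h1, h2, h3⟩
        obtain ⟨j, hj, h | h⟩ := EE x h1 h2
        · exact absurd ⟨j, Or.inl h⟩ h3
        · exact ⟨j, hj, h.symm⟩
    · intro x
      have hm : x ∈ OG.map Prod.snd ↔ ∃ j, j < d ∧ nx (c j) = x := by
        rw [hOG, map_map]
        simp only [mem_map, mI, comp]
      rw [hm]
      constructor
      · rintro ⟨j, hj, rfl⟩
        exact ⟨by rw [isE_nx]; exact not_not.2 (cE j), (mR _).2 ⟨j, hj, rfl⟩, nxG j⟩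
      · rintro ⟨h1, h2, h3⟩
        obtain ⟨j, hj, h⟩ := (mR x).1 h2
        rcases quadEO h1 (cE j) h with h | h
        · exact ⟨j, hj, h.symm⟩
        · exact absurd ⟨j, Or.inr h⟩ h3
    · intro x hx
      obtain ⟨j, hj, rfl | rfl⟩ := memG x hx <;> exact (mR _).2 ⟨j, hj, rfl⟩
    · intro x hx
      obtain ⟨j, hj, rfl | rfl⟩ := memG x hx
      · exact ⟨j + 1, Or.inr (cio j)⟩
      · refine ⟨j + d - 1, Or.inl ?_⟩
        have := cio (j + d - 1)
        have h2 : c (j + d - 1 + 1) = c j := by rw [← cm (j + d - 1 + 1), show j + d - 1 + 1 = j + d by omega, add_mod_right, cm]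
        rw [h2] at this
        rw [← this, M.inv]
    · refine ⟨?_, ?_, ?_, ?_, ?_⟩
      · rintro s ⟨p, hp, rfl⟩
        obtain ⟨j, hj, rfl⟩ := List.mem_map.1 hp
        exact ⟨_, ⟨_, List.mem_map.2 ⟨j, hj, rfl⟩, rfl⟩, rfl⟩
      · rintro s ⟨p, hp, rfl⟩
        obtain ⟨j, hj, rfl⟩ := List.mem_map.1 hp
        exact ⟨_, ⟨_, List.mem_map.2 ⟨j, hj, rfl⟩, rfl⟩, rfl⟩
      · rintro s ⟨p, hp, rfl⟩ t ⟨q, hq, rfl⟩ h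
        obtain ⟨j, hj, rfl⟩ := List.mem_map.1 hp
        obtain ⟨i, hi, rfl⟩ := List.mem_map.1 hq
        simp only at h ⊢
        obtain rfl : j = i := by omega
        exact ⟨trivial, 0, rfl, by simp [nx_nx], by simp⟩
      · rintro s ⟨p, hp, rfl⟩ t ⟨q, hq, rfl⟩ h
        obtain ⟨j, hj, rfl⟩ := List.mem_map.1 hp
        obtain ⟨i, hi, rfl⟩ := List.mem_map.1 hq
        simp only at h ⊢
        rw [cinj j i ((mI _).1 hj) ((mI _).1 hi) (nxi _ _ h)]
      · rintro s ⟨p, hp, rfl⟩ t ⟨q, hq, rfl⟩ h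
        obtain ⟨j, hj, rfl⟩ := List.mem_map.1 hp
        obtain ⟨i, hi, rfl⟩ := List.mem_map.1 hq
        simp only at h ⊢
        rw [cinj j i ((mI _).1 hj) ((mI _).1 hi) (rvi _ _ h)]
    · refine ⟨?_, ?_, ?_, ?_, ?_⟩
      · rintro s ⟨p, hp, rfl⟩
        obtain ⟨j, hj, rfl⟩ := List.mem_map.1 hp
        exact ⟨_, ⟨_, List.mem_map.2 ⟨(j + d - 1) % d, (mI _).2 (mod_lt _ s1), rfl⟩, rfl⟩, rfl⟩
      · rintro s ⟨p, hp, rfl⟩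
        obtain ⟨j, hj, rfl⟩ := List.mem_map.1 hp
        refine ⟨_, ⟨_, List.mem_map.2 ⟨(j + 1) % d, (mI _).2 (mod_lt _ s1), rfl⟩, rfl⟩, ?_⟩
        simp only
        have hj' := (mI _).1 hj
        by_cases h : j + 1 = d
        · rw [h, Nat.mod_self, mod_eq_of_lt (by omega)]; omega
        · rw [mod_eq_of_lt (by omega : j + 1 < d), show j + 1 + d - 1 = j + d by omega, add_mod_right,
            mod_eq_of_lt hj']
      · rintro s ⟨p, hp, rfl⟩ t ⟨q, hq, rfl⟩ h
        obtain ⟨j, hj, rfl⟩ := List.mem_map.1 hp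
        obtain ⟨i, hi, rfl⟩ := List.mem_map.1 hq
        simp only at h ⊢
        have hci : c i = c (j + d - 1) := by rw [← h, cm]
        have h2 : c (j + d - 1 + 1) = c j := by rw [← cm (j + d - 1 + 1), show j + d - 1 + 1 = j + d by omega, add_mod_right, cm]
        refine ⟨trivial, 1, rfl, ?_, ?_⟩
        · rw [pow_one, nx_rv_pv, ← h2, ← cio, ← hci, M.rho_io]
        · intro t ht
          obtain rfl : t = 0 := by omega
          simp only [pow_zero, Equiv.Perm.coe_one, id, nx_rv_pv]
          exact ⟨j, Or.inr rfl⟩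
      · rintro s ⟨p, hp, rfl⟩ t ⟨q, hq, rfl⟩ h
        obtain ⟨j, hj, rfl⟩ := List.mem_map.1 hp
        obtain ⟨i, hi, rfl⟩ := List.mem_map.1 hq
        simp only at h ⊢
        rw [cinj j i ((mI _).1 hj) ((mI _).1 hi) (rvi _ _ h)]
      · rintro s ⟨p, hp, rfl⟩ t ⟨q, hq, rfl⟩ h
        obtain ⟨j, hj, rfl⟩ := List.mem_map.1 hp
        obtain ⟨i, hi, rfl⟩ := List.mem_map.1 hq
        simp only at h ⊢
        rw [cinj j i ((mI _).1 hj) ((mI _).1 hi) (nxi _ _ h)]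
    · intro x hx
      obtain ⟨j, hj, rfl⟩ := List.mem_map.1 hx
      exact cE j
    · rw [hRdef, map_map]
      refine List.Nodup.map_on ?_ nI
      intro x hx y hy h
      exact cinj x y ((mI x).1 hx) ((mI y).1 hy) (cq _ _ h)
    · intro p hp
      obtain ⟨j, hj, rfl⟩ := List.mem_map.1 hp
      simp only [hRl]
      exact ⟨(sl1 j ((mI _).1 hj)).symm, (mod_lt _ s1).le⟩
    · intro p hp
      obtain ⟨j, hj, rfl⟩ := List.mem_map.1 hp
      simp only [hRl, nx_nx]
      exact ⟨(sl1 j ((mI _).1 hj)).symm, ((mI _).1 hj).le⟩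
    · intro x hx hE
      obtain ⟨j, hj, rfl | rfl⟩ := memG x hx
      · rw [cs, sl0, sl0]
      · rw [isE_pv] at hE; exact absurd (cE j) hE
    · intro x hx hxR
      rw [hRl]
      obtain ⟨j, hj, rfl | rfl⟩ := EE x hx hxR
      · rw [sl0]; omega
      · rw [sl1 j hj]; omega
    · intro x y hx hy hxR hyR h
      obtain ⟨j, hj, rfl | rfl⟩ := EE x hx hxR <;> obtain ⟨i, hi, rfl | rfl⟩ := EE y hy hyR
      · rw [cv, cv]
      · rw [sl0, sl1 i hi] at h; omega
      · rw [sl0, sl1 j hj] at h; omega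
      · rw [sl1 i hi, sl1 j hj] at h
        obtain rfl : j = i := by omega
        rfl
    · intro x hx
      apply h34
      intro h
      obtain ⟨j, _, hj⟩ := call x h
      exact hx ⟨j, Or.inl hj⟩
    · refine le_trans (hbud _ _) (le_trans (le_of_eq ?_) b3)
      congr
    · refine le_trans (hbud _ _) (le_trans (le_of_eq ?_) b4)
      congr
  · rw [hEG, map_map, hI]
    have : ∀ m, (List.range m).reverse.map (fun k => (⟨k + 1, 1, (k + d - 1) % d, 2⟩ : En)) = initE d m := by
      intro m
      induction m with
      | zero => rfl
      | succ m ih => rw [range_succ, reverse_append, reverse_singleton, singleton_append, map_cons, ih]; rfl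
    exact this d
  · rw [hOG, map_map, hI]
    have : ∀ m, (List.range m).reverse.map (fun k => (⟨k + 1, 1, k, 2⟩ : En)) = initO m := by
      intro m
      induction m with
      | zero => rfl
      | succ m ih => rw [range_succ, reverse_append, reverse_singleton, singleton_append, map_cons, ih]; rfl
    exact this d
  · rw [hRdef, map_map]
    have : ∀ m, (List.range m).reverse.map (fun k => ((0 : ℕ), k + 1)) = initQ m := by
      intro m
      induction m with
      | zero => rfl
      | succ m ih => rw [range_succ, reverse_append, reverse_singleton, singleton_append, map_cons, ih]; rfl
    rw [← this d]
    apply map_congr_left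
    intro k hk
    simp only [comp]
    rw [sl0, sl1 k ((mI _).1 hk)]
end Fin
end SqMap
namespace Srch
set_option maxRecDepth 100000
theorem run1 : run 4 ⟨0, 7, 8, 2⟩ = true := by decide +kernel
theorem run2 : run 5 ⟨5, 3, 4, 5⟩ = true := by decide +kernel
theorem run3 : run 3 ⟨3, 5, 4, 5⟩ = true := by decide +kernel
end Srch
namespace SqMap
open Srch
variable {n : ℕ} {Q : Type} (M : SqMap n Q)
section Fin
open Classical
variable [Fintype Q]
theorem star_run (hn : n = 42) (hQ : card Q = 16) (c0 : Cn Q) (hc0 : isE c0) (d : ℕ) (hd : M.sz (M.vert c0) = d)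
    (h34 : ∀ w, w ≠ M.vert c0 → M.sz w = 3 ∨ M.sz w = 4) (b : Bd) (hrun : run d b = true)
    (b1 : (Finset.univ.filter fun w : M.W => (M.wE w ∧ M.sz w = 3) ∧ w ≠ M.vert c0).card ≤ b.h3)
    (b2 : (Finset.univ.filter fun w : M.W => (M.wE w ∧ M.sz w = 4) ∧ w ≠ M.vert c0).card ≤ b.h4)
    (b3 : M.nv 3 ≤ b.v3) (b4 : M.nv 4 ≤ b.v4) : False := by
  have hd0 : 0 < d := hd ▸ (M.sz_spec c0).1
  have sub : ∀ P : M.W → Prop, (Finset.univ.filter fun w : M.W => P w ∧ w ≠ M.vert c0).card ≤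
      (Finset.univ.filter fun w : M.W => P w).card := by
    intro P
    apply card_le_card
    intro w
    simp only [mem_filter, mem_univ, true_and]
    exact fun h => h.1
  obtain ⟨EG, OG, G, R, sl, I, h1, h2, h3, h4⟩ := M.star_inv c0 hc0 d hd h34 b b1 b2
    (by
      refine le_trans ?_ b3
      refine le_trans (le_of_eq ?_) (le_trans (sub (fun w => ¬ M.wE w ∧ M.sz w = 3)) (le_of_eq ?_))
      · congr
      · unfold nv; congr)
    (by
      refine le_trans ?_ b4
      refine le_trans (le_of_eq ?_) (le_trans (sub (fun w => ¬ M.wE w ∧ M.sz w = 4)) (le_of_eq ?_))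
      · congr
      · unfold nv; congr)
  refine go_sound hn hQ (initQ d) 33 EG OG G R sl b [] I ?_ ?_ ?_
  · rintro rfl; simp at h1; omega
  · exact h4
  · rw [h1, h2, h3]; exact hrun
theorem exists_root {k : ℕ} (h : 0 < M.nh k) : ∃ c0, isE c0 ∧ M.sz (M.vert c0) = k := by
  obtain ⟨w, hw⟩ := Finset.card_pos.1 h
  simp only [mem_filter, mem_univ, true_and] at hw
  obtain ⟨⟨c, hc, he⟩, hs⟩ := hw
  exact ⟨c, he, hc ▸ hs⟩
theorem nh_erase {c0 : Cn Q} (hc0 : isE c0) {k : ℕ} (hk : M.sz (M.vert c0) = k) :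
    (Finset.univ.filter fun w : M.W => (M.wE w ∧ M.sz w = k) ∧ w ≠ M.vert c0).card = M.nh k - 1 := by
  unfold nh
  rw [← Finset.card_erase_of_mem (a := M.vert c0)]
  · congr 1
    ext w
    simp only [mem_filter, mem_univ, true_and, Finset.mem_erase]
    tauto
  · simp only [mem_filter, mem_univ, true_and]
    exact ⟨(M.wE_vert c0).2 hc0, hk⟩
theorem nh_le (c0 : Cn Q) (k : ℕ) :
    (Finset.univ.filter fun w : M.W => (M.wE w ∧ M.sz w = k) ∧ w ≠ M.vert c0).card ≤ M.nh k := by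
  unfold nh
  apply card_le_card
  intro w
  simp only [mem_filter, mem_univ, true_and]
  exact fun h => h.1
theorem no_map (hn : 41 < n) (hQ : card Q ≤ 16) (hE : card M.W = card Q + 2) : False := by
  obtain ⟨h42, h16, N, hc⟩ := M.classes hn hQ hE
  have nzv : N.nv 5 = 0 → ∀ w, ¬ N.wE w → N.sz w = 5 → False := by
    intro h w h1 h2
    unfold nv at h
    rw [card_eq_zero] at h
    have : w ∈ Finset.univ.filter fun w : N.W => ¬ N.wE w ∧ N.sz w = 5 := by simp [h1, h2]
    rw [h] at this
    simp at this
  have nzh : N.nh 5 = 0 → ∀ w, N.wE w → N.sz w = 5 → False := by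
    intro h w h1 h2
    unfold nh at h
    rw [card_eq_zero] at h
    have : w ∈ Finset.univ.filter fun w : N.W => N.wE w ∧ N.sz w = 5 := by simp [h1, h2]
    rw [h] at this
    simp at this
  rcases hc with ⟨h0, a3, a4, a5, e3, e4, e5⟩ | ⟨h0, a3, a4, a5, e3, e4, e5⟩ | ⟨h0, a3, a4, a5, e3, e4, e5⟩
  · obtain ⟨c0, hc0, hs⟩ := N.exists_root (k := 5) (by omega)
    refine N.star_run h42 h16 c0 hc0 5 hs ?_ ⟨5, 3, 4, 5⟩ run2 ?_ ?_ e3.le e4.le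
    · intro w hw
      have := h0 w
      by_contra hne
      have h5 : N.sz w = 5 := by omega
      by_cases hwE : N.wE w
      · have h1 := N.nh_erase hc0 hs
        rw [a5] at h1
        rw [Nat.sub_self, card_eq_zero] at h1
        have h2 : w ∈ Finset.univ.filter fun w : N.W => (N.wE w ∧ N.sz w = 5) ∧ w ≠ N.vert c0 := by simp [hwE, h5, hw]
        rw [h1] at h2
        simp at h2
      · exact nzv e5 w hwE h5
    · exact (N.nh_le c0 3).trans a3.le
    · exact (N.nh_le c0 4).trans a4.le
  · obtain ⟨c0, hc0, hs⟩ := N.exists_root (k := 3) (by omega)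
    refine N.star_run h42 h16 c0 hc0 3 hs ?_ ⟨3, 5, 4, 5⟩ run3 ?_ ?_ e3.le e4.le
    · intro w hw
      have := h0 w
      by_contra hne
      have h5 : N.sz w = 5 := by omega
      by_cases hwE : N.wE w
      · exact nzh a5 w hwE h5
      · exact nzv e5 w hwE h5
    · rw [N.nh_erase hc0 hs, a3]
    · exact (N.nh_le c0 4).trans a4.le
  · obtain ⟨c0, hc0, hs⟩ := N.exists_root (k := 4) (by omega)
    refine N.star_run h42 h16 c0 hc0 4 hs ?_ ⟨0, 7, 8, 2⟩ run1 ?_ ?_ e3.le e4.le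
    · intro w hw
      have := h0 w
      by_contra hne
      have h5 : N.sz w = 5 := by omega
      by_cases hwE : N.wE w
      · exact nzh a5 w hwE h5
      · exact nzv e5 w hwE h5
    · exact (N.nh_le c0 3).trans a3.le
    · rw [N.nh_erase hc0 hs, a4]
end Fin
end SqMap
namespace SqMap
variable {n : ℕ} {Q : Type} (M : SqMap n Q)
def en (c : Cn Q) : ℤ := if isE c then crX M.x M.w c else crY M.y M.h c
def st (c : Cn Q) : ℤ := if isE c then crX M.x M.w (pv c) else crY M.y M.h (pv c)
def ac (c : Cn Q) : ℤ := if isE c then crY M.y M.h c else crX M.x M.w c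
def dr (c : Cn Q) : Prop := M.st c < M.en c
theorem st_rho (c : Cn Q) : M.st (M.rho c) = M.en c := by
  unfold st en
  simp only [M.isE_rho]
  rw [M.rho_apply, pv_nx, M.ptX, M.ptY]
theorem ac_pv (c : Cn Q) : M.ac c = if isE c then crY M.y M.h (pv c) else crX M.x M.w (pv c) := by
  obtain ⟨q, i⟩ := c
  unfold ac
  simp only [isE, crX, crY, pv]
  fin_cases i <;> simp
theorem ac_rho (c : Cn Q) : M.ac (M.rho c) = M.ac c := by
  rw [ac_pv]
  unfold ac
  simp only [M.isE_rho]
  rw [M.rho_apply, pv_nx, M.ptX, M.ptY]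
theorem st_ne (c : Cn Q) : M.st c ≠ M.en c := by
  have hn : (0 : ℤ) < n := by have := M.hpos M.b; rw [M.hbh] at this; exact this
  have hw : M.w c.1 ≠ 0 := by
    by_cases h : c.1 = M.b
    · rw [h, M.hbw]; omega
    · rw [M.hwh _ h]; have := M.hpos c.1; omega
  have hh := M.hpos c.1
  obtain ⟨q, i⟩ := c
  simp only at hw hh
  unfold st en
  simp only [isE, crX, crY, pv]
  fin_cases i <;> simp <;> omega
theorem minturn_le (hov : ∀ c c', (isE c ↔ isE c') → (M.dr c ↔ M.dr c') → M.ac c = M.ac c' →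
      min (M.st c) (M.en c) < max (M.st c') (M.en c') → min (M.st c') (M.en c') < max (M.st c) (M.en c) → c = c')
    (m : Cn Q) (h1 : ¬ M.dr m) (h2 : M.dr (M.rho m)) (c : Cn Q) (hac : M.ac c = M.ac m) (hE : isE c ↔ isE m) :
    M.en m ≤ min (M.st c) (M.en c) ↔ M.en m ≤ min (M.st (M.rho c)) (M.en (M.rho c)) := by
  have n1 := M.st_ne m
  have n2 := M.st_ne c
  have n4 := M.st_ne (M.rho c)
  have hE' := hE.symm
  have o1 : M.en c < M.st c → M.en m < M.st c → M.en c < M.st m → M.en m = M.en c ∧ M.en (M.rho m) = M.en (M.rho c) := by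
    intro a1 a2 a3
    have : m = c := hov m c hE' (iff_of_false h1 (by unfold dr; omega)) hac.symm (by unfold dr at h1; omega) (by unfold dr at h1; omega)
    rw [this]; exact ⟨rfl, rfl⟩
  have o2 : M.en (M.rho c) < M.en c → M.en m < M.en c → M.en (M.rho c) < M.st m → M.en m = M.en (M.rho c) := by
    intro a1 a2 a3
    rw [← M.st_rho c] at a1 a2
    have : m = M.rho c := hov m _ (by rw [M.isE_rho]; exact hE') (iff_of_false h1 (by unfold dr; omega)) (by rw [ac_rho]; exact hac.symm)
      (by unfold dr at h1; omega) (by unfold dr at h1; omega)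
    rw [← this]
  have o3 : M.st c < M.en c → M.en m < M.en c → M.st c < M.en (M.rho m) → M.en m = M.st c := by
    intro a1 a2 a3
    rw [← M.st_rho m] at a2 ⊢
    have : M.rho m = c := hov _ c (by rw [M.isE_rho]; exact hE') (iff_of_true h2 (by unfold dr; omega)) (by rw [ac_rho]; exact hac.symm)
      (by unfold dr at h2; omega) (by unfold dr at h2; omega)
    rw [this]
  have o4 : M.en c < M.en (M.rho c) → M.en m < M.en (M.rho c) → M.en c < M.en (M.rho m) → M.st m = M.st c ∧ M.en m = M.en c := by
    intro a1 a2 a3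
    rw [← M.st_rho c] at a1 a3
    rw [← M.st_rho m] at a2
    have : M.rho m = M.rho c := hov _ _ (by rw [M.isE_rho, M.isE_rho]; exact hE') (iff_of_true h2 (by unfold dr; omega))
      (by rw [ac_rho, ac_rho]; exact hac.symm)
      (by unfold dr at h2; omega) (by unfold dr at h2; omega)
    rw [M.rho.injective this]; exact ⟨rfl, rfl⟩
  unfold dr at h1 h2
  rw [st_rho] at *
  generalize M.st m = sm at *
  generalize M.st c = sc at *
  generalize M.en m = em at *
  generalize M.en c = ec at *
  generalize M.en (M.rho m) = em' at *
  generalize M.en (M.rho c) = ec' at *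
  clear hov hac hE hE'
  have h1' : em < sm := by omega
  rcases lt_or_gt_of_ne n2 with a | a <;> rcases lt_or_gt_of_ne n4 with e | e
  · rw [min_eq_left a.le, min_eq_left e.le]
    by_cases hh : em ≤ sc
    · exact iff_of_true hh (by omega)
    · refine iff_of_false hh fun h => ?_
      rcases lt_or_eq_of_le h with h | h
      · have := o3 a h (by omega); omega
      · have := o4 e (by omega) (by omega); omega
  · rw [min_eq_left a.le, min_eq_right (by omega)]
    constructor
    · intro h
      by_contra hh
      have := o2 e (by omega) (by omega); omega
    · intro h
      by_contra hh
      have := o3 a (by omega) (by omega); omega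
  · rw [min_eq_right (by omega), min_eq_left e.le]
  · rw [min_eq_right (by omega), min_eq_right (by omega)]
    constructor
    · intro h
      by_contra hh
      rcases lt_or_eq_of_le h with h | h
      · have := o2 e (by omega) (by omega); omega
      · have := o1 (by omega) (by omega) (by omega); omega
    · intro h; omega
section Fin
open Classical
variable [Fintype Q]
noncomputable def tn (c : Cn Q) : ℕ := if (M.dr c ↔ M.dr (M.rho c)) then 0 else 1
theorem euler (hov : ∀ c c', (isE c ↔ isE c') → (M.dr c ↔ M.dr c') → M.ac c = M.ac c' →
      min (M.st c) (M.en c) < max (M.st c') (M.en c') → min (M.st c') (M.en c') < max (M.st c) (M.en c) → c = c')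
    (ht : ∀ c, M.tn c + M.tn (M.io c) = 1 + (if c.1 = M.b then 1 else 0) + (if (M.io c).1 = M.b then 1 else 0)) :
    card M.W = card Q + 2 := by
  set T := Finset.univ.filter fun c : Cn Q => ¬ M.dr c ∧ M.dr (M.rho c) with hT
  set T' := Finset.univ.filter fun c : Cn Q => M.dr c ∧ ¬ M.dr (M.rho c) with hT'
  have c1 : T.card = card M.W := by
    rw [← card_univ]
    apply card_bij (fun c _ => M.vert c)
    · intro c _; exact mem_univ _
    · intro m hm m' hm' h
      simp only [hT, mem_filter, mem_univ, true_and] at hm hm'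
      have key : ∀ m m' : Cn Q, (¬ M.dr m ∧ M.dr (M.rho m)) → (¬ M.dr m' ∧ M.dr (M.rho m')) → M.vert m = M.vert m' →
          M.en m ≤ M.en m' ∧ M.ac m = M.ac m' := by
        intro m m' hm hm' h
        have h0 := M.inv_of_rho (fun c => (M.ac c)) (fun c => True) (fun c => Iff.rfl) (fun c _ => M.ac_rho c) trivial h
        have h1 := M.inv_of_rho (fun c => (M.en m ≤ min (M.st c) (M.en c))) (fun c => M.ac c = M.ac m ∧ (isE c ↔ isE m))
          (fun c => by rw [M.ac_rho, M.isE_rho]) (fun c hc => (propext (M.minturn_le hov m hm.1 hm.2 c hc.1 hc.2)).symm)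
          ⟨rfl, Iff.rfl⟩ h
        beta_reduce at h0 h1
        have a1 := hm.1
        have a2 := hm'.1
        unfold dr at a1 a2
        have : M.en m ≤ min (M.st m) (M.en m) := by omega
        rw [h1] at this
        exact ⟨by omega, h0⟩
      have k1 := key m m' hm hm' h
      have k2 := key m' m hm' hm h.symm
      have n1 := M.st_ne m
      have n2 := M.st_ne m'
      refine hov m m' (M.isE_of_vert h) (iff_of_false hm.1 hm'.1) k1.2 ?_ ?_
      · have a1 := hm.1
        have a2 := hm'.1
        unfold dr at a1 a2
        omega
      · have a1 := hm.1
        have a2 := hm'.1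
        unfold dr at a1 a2
        omega
    · intro w _
      obtain ⟨c, rfl⟩ := Quotient.exists_rep w
      obtain ⟨m, hm, hmin⟩ := Finset.exists_min_image (Finset.univ.filter fun x : Cn Q => M.vert x = M.vert c) M.en
        ⟨c, by simp⟩
      simp only [mem_filter, mem_univ, true_and] at hm hmin
      refine ⟨m, ?_, hm⟩
      simp only [hT, mem_filter, mem_univ, true_and]
      have a1 := hmin (M.rho m) (by rw [M.vert_rho]; exact hm)
      have a2 := hmin (M.rho.symm m) (by rw [← M.vert_rho, Equiv.apply_symm_apply]; exact hm)
      have a3 := M.st_rho (M.rho.symm m)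
      rw [Equiv.apply_symm_apply] at a3
      have n1 := M.st_ne (M.rho m)
      unfold dr
      rw [M.st_rho] at *
      omega
  have c2 : T.card = T'.card := by
    have e1 : (Finset.univ.filter fun c : Cn Q => M.dr c).card = (Finset.univ.filter fun c : Cn Q => M.dr (M.rho c)).card := by
      symm
      apply card_bij (fun c _ => M.rho c)
      · intro c hc; simpa using hc
      · intro a _ b _ h; exact M.rho.injective h
      · intro c hc
        refine ⟨M.rho.symm c, ?_, by simp⟩
        simpa using hc
    have e2 := card_filter_add_card_filter_not (s := Finset.univ.filter fun c : Cn Q => M.dr c) (fun c => M.dr (M.rho c))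
    have e3 := card_filter_add_card_filter_not (s := Finset.univ.filter fun c : Cn Q => M.dr (M.rho c)) (fun c => M.dr c)
    rw [Finset.filter_filter, Finset.filter_filter] at e2 e3
    have e4 : (Finset.univ.filter fun c : Cn Q => M.dr c ∧ M.dr (M.rho c)) = Finset.univ.filter fun c : Cn Q => M.dr (M.rho c) ∧ M.dr c := by
      ext c; simp [and_comm]
    have e5 : T = (Finset.univ.filter fun c : Cn Q => M.dr (M.rho c) ∧ ¬ M.dr c) := by
      ext c; simp [hT, and_comm]
    rw [e4] at e2
    have e6 : T' = (Finset.univ.filter fun c : Cn Q => M.dr c ∧ ¬ M.dr (M.rho c)) := by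
      ext c; simp [hT']
    rw [e5, e6]
    clear_value T T'
    have e7 := e2.trans (e1.trans e3.symm)
    have e8 := Nat.add_left_cancel e7
    convert e8.symm using 2
  have c3 : ∑ c, M.tn c = T.card + T'.card := by
    rw [← Finset.card_union_of_disjoint, Finset.card_eq_sum_ones, ← Finset.sum_filter_add_sum_filter_not Finset.univ (fun c => c ∈ T ∪ T')]
    · have z1 : ∑ c ∈ Finset.univ.filter (fun c => c ∈ T ∪ T'), M.tn c = ∑ c ∈ T ∪ T', 1 := by
        rw [Finset.filter_mem_eq_inter, Finset.univ_inter]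
        apply sum_congr rfl
        intro c hc
        simp only [hT, hT', Finset.mem_union, mem_filter, mem_univ, true_and] at hc
        unfold tn
        rw [if_neg (by tauto)]
      have z2 : ∑ c ∈ Finset.univ.filter (fun c => ¬ c ∈ T ∪ T'), M.tn c = 0 := by
        apply sum_eq_zero
        intro c hc
        simp only [hT, hT', Finset.mem_union, mem_filter, mem_univ, true_and] at hc
        unfold tn
        rw [if_pos (by tauto)]
      rw [z1, z2, add_zero]
    · rw [Finset.disjoint_left]
      intro c
      simp only [hT, hT', mem_filter, mem_univ, true_and]
      tauto
  have ioeq : ∀ f : Cn Q → ℕ, ∑ c, f (M.io c) = ∑ c, f c := by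
    intro f
    exact Equiv.sum_comp (⟨M.io, M.io, M.inv, M.inv⟩ : Equiv.Perm (Cn Q)) f
  have c4 : ∑ c, M.tn c + ∑ c, M.tn c = 4 * card Q + 8 := by
    nth_rewrite 2 [← ioeq]
    rw [← sum_add_distrib, sum_congr rfl (fun c _ => ht c), sum_add_distrib, sum_add_distrib,
      ioeq (fun c => if c.1 = M.b then 1 else 0)]
    have : ∑ c : Cn Q, (if c.1 = M.b then 1 else 0) = 4 := by
      rw [sum_prod_type, sum_eq_single M.b]
      · simp
      · intro q _ hq; simp [hq]
      · intro h; exact absurd (mem_univ _) h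
    rw [this]
    simp [Fintype.card_prod]
    ring
  omega
end Fin
end SqMap
structure Til (n : ℕ) (K : Type) where
  X : K → ℤ
  Y : K → ℤ
  S : K → ℤ
  npos : 0 < n
  pos : ∀ q, 0 < S q
  x0 : ∀ q, 0 ≤ X q
  x1 : ∀ q, X q + S q ≤ n
  y0 : ∀ q, 0 ≤ Y q
  y1 : ∀ q, Y q + S q ≤ n
  own : ∀ a b : ℤ, 0 ≤ a → a < n → 0 ≤ b → b < n → ∃ q, X q ≤ a ∧ a < X q + S q ∧ Y q ≤ b ∧ b < Y q + S q
  uniq : ∀ (a b : ℤ) q q', X q ≤ a → a < X q + S q → Y q ≤ b → b < Y q + S q →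
    X q' ≤ a → a < X q' + S q' → Y q' ≤ b → b < Y q' + S q' → q = q'
  gcd : ∀ d : ℕ, (∀ q, (d : ℤ) ∣ S q) → d = 1
def inn (X S p : ℤ) (s : Bool) : Prop := X ≤ (if s then p else p - 1) ∧ (if s then p else p - 1) < X + S
def cnr (X S p : ℤ) (s : Bool) : Prop := (if s then X else X + S) = p
theorem cnr_inn {X S p : ℤ} {s : Bool} (hS : 0 < S) (h : cnr X S p s) : inn X S p s := by
  unfold cnr at h; unfold inn; cases s <;> simp at * <;> omega
theorem cnr_not {X S p : ℤ} {s : Bool} (h : cnr X S p s) : ¬ inn X S p (!s) := by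
  unfold cnr at h; unfold inn; cases s <;> simp at * <;> omega
theorem inn_or {X S p : ℤ} {s : Bool} (h : inn X S p s) : cnr X S p s ∨ inn X S p (!s) := by
  unfold inn at *; unfold cnr; cases s <;> simp at * <;> omega
def tsx (i : Fin 4) : Bool := if i = 2 ∨ i = 3 then true else false
def tsy (i : Fin 4) : Bool := if i = 0 ∨ i = 3 then true else false
def hr (i : Fin 4) : Fin 4 := 3 - i
def vr (i : Fin 4) : Fin 4 := if i = 0 then 1 else if i = 1 then 0 else if i = 2 then 3 else 2
theorem tsx_hr (i) : tsx (hr i) = !tsx i := by revert i; decide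
theorem tsy_hr (i) : tsy (hr i) = tsy i := by revert i; decide
theorem tsx_vr (i) : tsx (vr i) = tsx i := by revert i; decide
theorem tsy_vr (i) : tsy (vr i) = !tsy i := by revert i; decide
theorem hr_hr (i) : hr (hr i) = i := by revert i; decide
theorem vr_vr (i) : vr (vr i) = i := by revert i; decide
namespace Til
variable {n : ℕ} {K : Type} (T : Til n K)
def qx : Option K → ℤ | none => n | some q => T.X q
def qy : Option K → ℤ | none => 0 | some q => T.Y q
def qw : Option K → ℤ | none => -n | some q => T.S q
def qh : Option K → ℤ | none => n | some q => T.S q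
def cX (c : Option K × Fin 4) : ℤ := crX T.qx T.qw c
def cY (c : Option K × Fin 4) : ℤ := crY T.qy T.qh c
def I (q : K) (p p' : ℤ) (s t : Bool) : Prop := inn (T.X q) (T.S q) p s ∧ inn (T.Y q) (T.S q) p' t
theorem I_uniq {q q' : K} {p p' : ℤ} {s t : Bool} (h : T.I q p p' s t) (h' : T.I q' p p' s t) : q = q' :=
  T.uniq _ _ q q' h.1.1 h.1.2 h.2.1 h.2.2 h'.1.1 h'.1.2 h'.2.1 h'.2.2
theorem cX_some (q : K) (i : Fin 4) (p : ℤ) : T.cX (some q, i) = p ↔ cnr (T.X q) (T.S q) p (tsx i) := by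
  unfold cX crX cnr tsx; fin_cases i <;> simp [qx, qw]
theorem cY_some (q : K) (i : Fin 4) (p : ℤ) : T.cY (some q, i) = p ↔ cnr (T.Y q) (T.S q) p (tsy i) := by
  unfold cY crY cnr tsy; fin_cases i <;> simp [qy, qh]
def smp (c c' : Option K × Fin 4) : Prop := T.cX c' = T.cX c ∧ T.cY c' = T.cY c
theorem smp_symm {c c' : Option K × Fin 4} (h : T.smp c c') : T.smp c' c := ⟨h.1.symm, h.2.symm⟩
theorem smp_trans {c c' c'' : Option K × Fin 4} (h : T.smp c c') (h' : T.smp c' c'') : T.smp c c'' :=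
  ⟨h'.1.trans h.1, h'.2.trans h.2⟩
theorem smp_nn {i j : Fin 4} (h : T.smp (none, i) (none, j)) : j = i := by
  have := T.npos
  revert h; unfold smp cX cY crX crY
  fin_cases i <;> fin_cases j <;> simp [qx, qw, qy, qh] <;> omega
theorem smp_ns {q : K} {i j : Fin 4} (h : T.smp (none, i) (some q, j)) : j = hr i := by
  have := T.npos
  have a1 := T.pos q
  have a2 := T.x0 q
  have a3 := T.x1 q
  have a4 := T.y0 q
  have a5 := T.y1 q
  revert h; unfold smp cX cY crX crY
  fin_cases i <;> fin_cases j <;> simp [qx, qw, qy, qh, hr] <;> first | decide | omega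
theorem cI {q : K} {i : Fin 4} {p p' : ℤ} (h : T.cX (some q, i) = p) (h' : T.cY (some q, i) = p') : T.I q p p' (tsx i) (tsy i) :=
  ⟨cnr_inn (T.pos q) ((T.cX_some q i p).1 h), cnr_inn (T.pos q) ((T.cY_some q i p').1 h')⟩
theorem smp_uniq {c c' : Option K × Fin 4} (hi : c'.2 = c.2) (h : T.smp c c') : c' = c := by
  obtain ⟨_ | q, i⟩ := c <;> obtain ⟨_ | q', j⟩ := c' <;> simp only at hi <;> subst hi
  · rfl
  · have := T.smp_ns h; exfalso; revert this; clear * -; revert j; decide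
  · have := T.smp_ns (T.smp_symm h); exfalso; revert this; clear * -; revert j; decide
  · rw [T.I_uniq (T.cI rfl rfl) (T.cI h.1 h.2)]
def HP (c c' : Option K × Fin 4) : Prop := c'.2 = hr c.2 ∧ T.smp c c'
def VP (c c' : Option K × Fin 4) : Prop := c'.2 = vr c.2 ∧ T.smp c c'
theorem HP_symm {c c' : Option K × Fin 4} (h : T.HP c c') : T.HP c' c :=
  ⟨by rw [h.1, hr_hr], T.smp_symm h.2⟩
theorem VP_symm {c c' : Option K × Fin 4} (h : T.VP c c') : T.VP c' c :=
  ⟨by rw [h.1, vr_vr], T.smp_symm h.2⟩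
theorem exI {p p' : ℤ} {s t : Bool} (h : inn 0 n p s) (h' : inn 0 n p' t) : ∃ q, T.I q p p' s t := by
  obtain ⟨q, h1, h2, h3, h4⟩ := T.own _ _ h.1 (by have := h.2; omega) h'.1 (by have := h'.2; omega)
  exact ⟨q, ⟨h1, h2⟩, ⟨h3, h4⟩⟩
theorem I_bx {q : K} {p p' : ℤ} {s t : Bool} (h : T.I q p p' s t) : inn 0 n p s := by
  have := T.x0 q; have := T.x1 q
  have h1 := h.1.1; have h2 := h.1.2
  exact ⟨by omega, by omega⟩
theorem I_by {q : K} {p p' : ℤ} {s t : Bool} (h : T.I q p p' s t) : inn 0 n p' t := by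
  have := T.y0 q; have := T.y1 q
  have h1 := h.2.1; have h2 := h.2.2
  exact ⟨by omega, by omega⟩
theorem none_HP (i : Fin 4) : ∃ c', T.HP (none, i) c' := by
  have hn := T.npos
  set p := T.cX (none, i) with hp
  set p' := T.cY (none, i) with hp'
  have b1 : inn 0 n p (!tsx i) ∧ ¬ inn 0 n p (tsx i) := by
    rw [hp]; unfold cX crX inn tsx; fin_cases i <;> simp [qx, qw] <;> omega
  have b2 : inn 0 n p' (tsy i) ∧ ¬ inn 0 n p' (!tsy i) := by
    rw [hp']; unfold cY crY inn tsy; fin_cases i <;> simp [qy, qh] <;> omega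
  obtain ⟨q, hq⟩ := T.exI b1.1 b2.1
  refine ⟨(some q, hr i), rfl, ?_, ?_⟩
  · rw [← hp, cX_some, tsx_hr]
    refine (inn_or hq.1).resolve_right fun h => ?_
    rw [Bool.not_not] at h
    exact b1.2 (T.I_bx ⟨h, hq.2⟩)
  · rw [← hp', cY_some, tsy_hr]
    refine (inn_or hq.2).resolve_right fun h => ?_
    exact b2.2 (T.I_by ⟨hq.1, h⟩)
theorem exVP (c : Option K × Fin 4) (hno : ¬ ∃ c', T.HP c c') : ∃ c', T.VP c c' := by
  obtain ⟨_ | q, i⟩ := c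
  · exact absurd (T.none_HP i) hno
  set p := T.cX (some q, i) with hp
  set p' := T.cY (some q, i) with hp'
  have hq := T.cI hp.symm hp'.symm
  have hx := (T.cX_some q i p).1 hp.symm
  have hy := (T.cY_some q i p').1 hp'.symm
  have bx := T.I_bx hq
  have by' := T.I_by hq
  have fin : ∀ r, T.I r p p' (tsx i) (!tsy i) → ¬ T.I r p p' (!tsx i) (!tsy i) → ∃ c', T.VP (some q, i) c' := by
    intro r hr1 hr2
    refine ⟨(some r, vr i), rfl, ?_, ?_⟩
    · rw [← hp, cX_some, tsx_vr]
      exact (inn_or hr1.1).resolve_right fun h => hr2 ⟨h, hr1.2⟩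
    · rw [← hp', cY_some, tsy_vr]
      refine (inn_or hr1.2).resolve_right fun h => ?_
      rw [Bool.not_not] at h
      have := T.I_uniq hq ⟨hr1.1, h⟩
      subst this
      exact cnr_not hy hr1.2
  by_cases b1 : inn 0 n p (!tsx i)
  · obtain ⟨r, hr'⟩ := T.exI b1 by'
    have k1 : ¬ inn (T.X r) (T.S r) p (tsx i) := fun h => by
      have := T.I_uniq hq ⟨h, hr'.2⟩
      subst this
      exact cnr_not hx hr'.1
    have k2 : cnr (T.X r) (T.S r) p (!tsx i) := (inn_or hr'.1).resolve_right (by rwa [Bool.not_not])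
    have k3 : ¬ cnr (T.Y r) (T.S r) p' (tsy i) := fun h => hno ⟨(some r, hr i), rfl, by
      rw [← hp, cX_some, tsx_hr]; exact k2, by rw [← hp', cY_some, tsy_hr]; exact h⟩
    have k4 := (inn_or hr'.2).resolve_left k3
    have b2 : inn 0 n p' (!tsy i) := T.I_by ⟨hr'.1, k4⟩
    obtain ⟨q', hq'⟩ := T.exI bx b2
    refine fin q' hq' fun h => ?_
    have := T.I_uniq h ⟨hr'.1, k4⟩
    subst this
    exact k1 hq'.1
  · by_cases b2 : inn 0 n p' (!tsy i)
    · obtain ⟨q', hq'⟩ := T.exI bx b2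
      exact fin q' hq' fun h => b1 (T.I_bx h)
    · exfalso
      apply hno
      refine ⟨(none, hr i), rfl, ?_, ?_⟩
      · rw [← hp]
        clear_value p p'
        clear hno fin hq hx hy b2 by'
        revert bx b1; unfold cX crX inn tsx hr; fin_cases i <;> simp [qx, qw] <;> omega
      · rw [← hp']
        clear_value p p'
        clear hno fin hq hx hy b1 bx
        revert by' b2; unfold cY crY inn tsy hr; fin_cases i <;> simp [qy, qh] <;> omega
theorem VP_some {c c' : Option K × Fin 4} (h : T.VP c c') : c.1 ≠ none ∧ c'.1 ≠ none := by
  have e1 : ∀ i, vr i ≠ i := by decide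
  have e2 : ∀ i, vr i ≠ hr i := by decide
  obtain ⟨_ | q, i⟩ := c <;> obtain ⟨_ | q', j⟩ := c' <;> obtain ⟨h1, h2⟩ := h <;> simp only at h1 <;> subst h1
  · exact absurd (T.smp_nn h2) (e1 i)
  · exact absurd (T.smp_ns h2) (e2 i)
  · have := T.smp_ns (T.smp_symm h2)
    exfalso; revert this; clear * -; revert i; decide
  · simp
theorem HP_of_VP {c c' c'' : Option K × Fin 4} (h : T.VP c c') (h' : T.HP c' c'') : ∃ d, T.HP c d := by
  have hs := T.VP_some h
  have hs' : c''.1 ≠ none := by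
    intro e
    obtain ⟨a, i⟩ := c
    obtain ⟨a'', k⟩ := c''
    simp only at e hs
    subst e
    obtain ⟨q, rfl⟩ := Option.ne_none_iff_exists'.1 hs.1
    have := T.smp_ns (T.smp_symm (T.smp_trans h.2 h'.2))
    have e1 := h'.1
    have e2 := h.1
    simp only at e1 e2
    rw [e1, e2] at this
    revert this; clear * -; revert i; decide
  obtain ⟨a, i⟩ := c
  obtain ⟨a', j⟩ := c'
  obtain ⟨a'', k⟩ := c''
  simp only at hs hs'
  obtain ⟨q, rfl⟩ := Option.ne_none_iff_exists'.1 hs.1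
  obtain ⟨q', rfl⟩ := Option.ne_none_iff_exists'.1 hs.2
  obtain ⟨q'', rfl⟩ := Option.ne_none_iff_exists'.1 hs'
  obtain ⟨e1, e2⟩ := h
  obtain ⟨e3, e4⟩ := h'
  have e5 := T.smp_trans e2 e4
  simp only at e1 e3
  subst e1 e3
  set p := T.cX (some q, i) with hp
  set p' := T.cY (some q, i) with hp'
  have hq := T.cI hp.symm hp'.symm
  have hx := (T.cX_some q i p).1 hp.symm
  have hq'' := T.cI e5.1 e5.2
  rw [← hp, ← hp', tsx_hr, tsy_hr, tsx_vr, tsy_vr] at hq''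
  have hy'' := (T.cY_some _ _ p').1 (e5.2.trans hp'.symm)
  rw [tsy_hr, tsy_vr] at hy''
  obtain ⟨r, hr'⟩ := T.exI (T.I_bx hq'') (T.I_by hq)
  refine ⟨(some r, hr i), rfl, ?_, ?_⟩
  · rw [← hp, cX_some, tsx_hr]
    refine (inn_or hr'.1).resolve_right fun h => ?_
    rw [Bool.not_not] at h
    have := T.I_uniq hq ⟨h, hr'.2⟩
    subst this
    exact cnr_not hx hr'.1
  · rw [← hp', cY_some, tsy_hr]
    refine (inn_or hr'.2).resolve_right fun h => ?_
    have := T.I_uniq hq'' ⟨hr'.1, h⟩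
    subst this
    have := cnr_not hy''
    rw [Bool.not_not] at this
    exact this hr'.2
def Gl (c c' : Option K × Fin 4) : Prop := T.HP c c' ∨ ((¬ ∃ d, T.HP c d) ∧ T.VP c c')
theorem Gl_ex (c) : ∃ c', T.Gl c c' := by
  by_cases h : ∃ d, T.HP c d
  · obtain ⟨d, hd⟩ := h; exact ⟨d, Or.inl hd⟩
  · obtain ⟨d, hd⟩ := T.exVP c h; exact ⟨d, Or.inr ⟨h, hd⟩⟩
theorem Gl_symm {c c'} (h : T.Gl c c') : T.Gl c' c := by
  rcases h with h | ⟨h, h'⟩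
  · exact Or.inl (T.HP_symm h)
  · exact Or.inr ⟨fun ⟨d, hd⟩ => h (T.HP_of_VP h' hd), T.VP_symm h'⟩
theorem Gl_uniq {c d e} (h : T.Gl c d) (h' : T.Gl c e) : d = e := by
  rcases h with h | ⟨h, hv⟩ <;> rcases h' with h' | ⟨h', hv'⟩
  · exact T.smp_uniq (by rw [h.1, h'.1]) (T.smp_trans (T.smp_symm h'.2) h.2)
  · exact absurd ⟨_, h⟩ h'
  · exact absurd ⟨_, h'⟩ h
  · exact T.smp_uniq (by rw [hv.1, hv'.1]) (T.smp_trans (T.smp_symm hv'.2) hv.2)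
theorem Gl_smp {c c'} (h : T.Gl c c') : T.smp c c' := by
  rcases h with h | ⟨_, h⟩ <;> exact h.2
theorem Gl_par {c c'} (h : T.Gl c c') : isE c' ↔ ¬ isE c := by
  unfold isE
  rcases h with h | ⟨_, h⟩ <;> rw [h.1] <;> generalize c.2 = i <;> revert i <;> decide
noncomputable def gio (c : Option K × Fin 4) : Option K × Fin 4 := (T.Gl_ex c).choose
theorem gio_spec (c) : T.Gl c (T.gio c) := (T.Gl_ex c).choose_spec
theorem gio_gio (c) : T.gio (T.gio c) = c := T.Gl_uniq (T.gio_spec _) (T.Gl_symm (T.gio_spec c))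
theorem conn_aux [Fintype K] (S : Set (Option K)) (hS : S.Nonempty)
    (hc : ∀ c : Option K × Fin 4, c.1 ∈ S → (T.gio c).1 ∈ S) : none ∈ S := by
  classical
  by_contra hno
  obtain ⟨m, hm, hmin⟩ := Finset.exists_min_image (Finset.univ.filter fun q : K => some q ∈ S) (fun q => T.X q + T.Y q) (by
    obtain ⟨a, ha⟩ := hS
    cases a with
    | none => exact absurd ha hno
    | some q => exact ⟨q, by simpa using ha⟩)
  simp only [mem_filter, mem_univ, true_and] at hm hmin
  have h1 := hc (some m, 3) hm
  have h2 := T.gio_spec (some m, 3)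
  generalize T.gio (some m, 3) = c at *
  obtain ⟨a, j⟩ := c
  cases a with
  | none => exact hno h1
  | some q =>
    have h3 := hmin q h1
    have h4 := T.Gl_smp h2
    have h5 := (T.Gl_par h2)
    have := T.pos q
    have := T.pos m
    revert h4 h5
    unfold smp cX cY crX crY isE
    fin_cases j <;> simp [qx, qy, qw, qh] <;> omega
noncomputable def toMap [Fintype K] : SqMap n (Option K) where
  b := none
  io := T.gio
  inv := T.gio_gio
  par c := T.Gl_par (T.gio_spec c)
  x := T.qx
  y := T.qy
  w := T.qw
  h := T.qh
  ptX c := (T.Gl_smp (T.gio_spec c)).1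
  ptY c := (T.Gl_smp (T.gio_spec c)).2
  hbw := rfl
  hbh := rfl
  hpos q := by
    cases q with
    | none => exact Int.natCast_pos.2 T.npos
    | some q => exact T.pos q
  hwh q hq := by
    cases q with
    | none => exact absurd rfl hq
    | some q => rfl
  hgcd d hd := T.gcd d fun q => hd (some q)
  conn S hS hc := by
    have h1 := T.conn_aux S hS hc
    by_contra hne
    have h2 := T.conn_aux Sᶜ (Set.nonempty_compl.2 hne) (fun c h h' => h (by
      have := hc _ h'
      rwa [T.gio_gio] at this))
    exact h2 h1
section F
variable [Fintype K]
theorem dr_none (i : Fin 4) : T.toMap.dr (none, i) ↔ (i = 1 ∨ i = 2) := by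
  have := T.npos
  unfold SqMap.dr SqMap.st SqMap.en crX crY isE pv
  fin_cases i <;> simp [toMap, qx, qy, qw, qh] <;> omega
theorem dr_some (q : K) (i : Fin 4) : T.toMap.dr (some q, i) ↔ (i = 0 ∨ i = 1) := by
  have := T.pos q
  unfold SqMap.dr SqMap.st SqMap.en crX crY isE pv
  fin_cases i <;> simp [toMap, qx, qy, qw, qh] <;> omega
open Classical in
theorem ht (c : Option K × Fin 4) : T.toMap.tn c + T.toMap.tn (T.toMap.io c) =
    1 + (if c.1 = T.toMap.b then 1 else 0) + (if (T.toMap.io c).1 = T.toMap.b then 1 else 0) := by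
  classical
  unfold SqMap.tn
  rw [SqMap.rho_io, SqMap.rho_apply]
  have h : T.Gl c (T.toMap.io c) := T.gio_spec c
  generalize T.toMap.io c = c' at *
  have hb : T.toMap.b = none := rfl
  rw [hb]
  obtain ⟨a, i⟩ := c
  obtain ⟨a', j⟩ := c'
  rcases h with h | ⟨_, h⟩
  · have h1 := h.1
    simp only at h1
    subst h1
    cases a <;> cases a'
    · exfalso
      have := T.smp_nn h.2
      revert this; clear * -; revert i; decide
    all_goals simp only [dr_none, dr_some, nx]; clear * -; revert i; simp; decide
  · have h1 := h.1
    have h2 := T.VP_some h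
    simp only at h1 h2
    subst h1
    obtain ⟨q, rfl⟩ := Option.ne_none_iff_exists'.1 h2.1
    obtain ⟨q', rfl⟩ := Option.ne_none_iff_exists'.1 h2.2
    simp only [dr_none, dr_some, nx]; clear * -; revert i; simp; decide
theorem hov (c c' : Option K × Fin 4) (h1 : isE c ↔ isE c') (h2 : T.toMap.dr c ↔ T.toMap.dr c') (h3 : T.toMap.ac c = T.toMap.ac c')
    (h4 : min (T.toMap.st c) (T.toMap.en c) < max (T.toMap.st c') (T.toMap.en c'))
    (h5 : min (T.toMap.st c') (T.toMap.en c') < max (T.toMap.st c) (T.toMap.en c)) : c = c' := by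
  obtain ⟨a, i⟩ := c
  obtain ⟨a', j⟩ := c'
  have hn := T.npos
  unfold SqMap.ac at h3
  unfold SqMap.st SqMap.en at h4 h5
  cases a with
  | none =>
    cases a' with
    | none =>
      rw [dr_none, dr_none] at h2
      unfold isE at h1
      have : i = j := by
        simp only at h1
        clear * - h1 h2
        revert i j; decide
      rw [this]
    | some q =>
      exfalso
      rw [dr_none, dr_some] at h2
      have a1 := T.pos q
      have a2 := T.x0 q
      have a3 := T.x1 q
      have a4 := T.y0 q
      have a5 := T.y1 q
      revert h1 h2 h3 h4 h5
      unfold isE crX crY pv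
      fin_cases i <;> fin_cases j <;> simp [toMap, qx, qy, qw, qh] <;> omega
  | some q =>
    have a1 := T.pos q
    have a2 := T.x0 q
    have a3 := T.x1 q
    have a4 := T.y0 q
    have a5 := T.y1 q
    cases a' with
    | none =>
      exfalso
      rw [dr_none, dr_some] at h2
      revert h1 h2 h3 h4 h5
      unfold isE crX crY pv
      fin_cases i <;> fin_cases j <;> simp [toMap, qx, qy, qw, qh] <;> omega
    | some q' =>
      rw [dr_some, dr_some] at h2
      have : i = j := by
        unfold isE at h1
        simp only at h1
        clear * - h1 h2
        revert i j; decide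
      subst this
      have b1 := T.pos q'
      have : q = q' := by
        clear h1 h2
        revert h3 h4 h5
        unfold isE crX crY pv
        fin_cases i <;> simp [toMap, qx, qy, qw, qh] <;> intro h3 h4 h5
        · exact T.uniq (max (T.X q) (T.X q')) (T.Y q) q q' (by omega) (by omega) (by omega) (by omega) (by omega) (by omega) (by omega) (by omega)
        · exact T.uniq (T.X q + T.S q - 1) (max (T.Y q) (T.Y q')) q q' (by omega) (by omega) (by omega) (by omega) (by omega) (by omega) (by omega) (by omega)
        · exact T.uniq (max (T.X q) (T.X q')) (T.Y q + T.S q - 1) q q' (by omega) (by omega) (by omega) (by omega) (by omega) (by omega) (by omega) (by omega)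
        · exact T.uniq (T.X q) (max (T.Y q) (T.Y q')) q q' (by omega) (by omega) (by omega) (by omega) (by omega) (by omega) (by omega) (by omega)
      rw [this]
open Classical in
theorem map_euler : card T.toMap.W = card (Option K) + 2 := T.toMap.euler T.hov (fun c => by convert T.ht c)
end F
end Til
theorem bnd_of_dis {n : ℕ} {D : Finset (ℕ × ℕ × ℕ)} (h : IsDissection n D) {q : ℕ × ℕ × ℕ} (hq : q ∈ D) :
    q.1 + q.2.2 ≤ n ∧ q.2.1 + q.2.2 ≤ n := by
  have h1 : ((q.1 + q.2.2 : ℝ), (q.2.1 + q.2.2 : ℝ)) ∈ Set.Icc (0 : ℝ) (n : ℝ) ×ˢ Set.Icc (0 : ℝ) (n : ℝ) := by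
    rw [← h.2.1]
    simp only [mem_iUnion]
    refine ⟨q, hq, ?_⟩
    simp [closedSq]
  have h2 := h1.1.2
  have h3 := h1.2.2
  simp only at h2 h3
  exact ⟨by exact_mod_cast h2, by exact_mod_cast h3⟩
def tilOf {n : ℕ} {D : Finset (ℕ × ℕ × ℕ)} (hn : 0 < n) (h : IsPrimeDissection n D) : Til n {q // q ∈ D} where
  X q := (q.1.1 : ℤ)
  Y q := (q.1.2.1 : ℤ)
  S q := (q.1.2.2 : ℤ)
  npos := hn
  pos q := by have := h.1.1 q.1 q.2; omega
  x0 q := by omega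
  y0 q := by omega
  x1 q := by have := bnd_of_dis h.1 q.2; omega
  y1 q := by have := bnd_of_dis h.1 q.2; omega
  own a b ha ha' hb hb' := by
    have e1 : (0 : ℝ) ≤ a := by exact_mod_cast ha
    have e2 : (a : ℝ) + 1 ≤ n := by exact_mod_cast (show a + 1 ≤ (n : ℤ) by omega)
    have e3 : (0 : ℝ) ≤ b := by exact_mod_cast hb
    have e4 : (b : ℝ) + 1 ≤ n := by exact_mod_cast (show b + 1 ≤ (n : ℤ) by omega)
    have h1 : ((a + 1 / 2 : ℝ), (b + 1 / 2 : ℝ)) ∈ Set.Icc (0 : ℝ) (n : ℝ) ×ˢ Set.Icc (0 : ℝ) (n : ℝ) :=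
      ⟨⟨by simp only; linarith, by simp only; linarith⟩, ⟨by simp only; linarith, by simp only; linarith⟩⟩
    rw [← h.1.2.1] at h1
    simp only [mem_iUnion] at h1
    obtain ⟨q, hq, ⟨k1, k2⟩, ⟨k3, k4⟩⟩ := h1
    simp only at k1 k2 k3 k4
    refine ⟨⟨q, hq⟩, ?_, ?_, ?_, ?_⟩ <;> simp only
    · have : ((q.1 : ℤ) : ℝ) < (a + 1 : ℤ) := by push_cast; linarith
      have := Int.cast_lt.1 this
      omega
    · have : (a : ℝ) < ((q.1 + q.2.2 : ℤ) : ℝ) := by push_cast; linarith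
      exact Int.cast_lt.1 this
    · have : ((q.2.1 : ℤ) : ℝ) < (b + 1 : ℤ) := by push_cast; linarith
      have := Int.cast_lt.1 this
      omega
    · have : (b : ℝ) < ((q.2.1 + q.2.2 : ℤ) : ℝ) := by push_cast; linarith
      exact Int.cast_lt.1 this
  uniq a b q q' h1 h2 h3 h4 k1 k2 k3 k4 := by
    by_contra hne
    have hd := h.1.2.2 q.1 q.2 q'.1 q'.2 (fun e => hne (Subtype.ext e))
    have mem : ∀ r : {q // q ∈ D}, (r.1.1 : ℤ) ≤ a → a < (r.1.1 : ℤ) + r.1.2.2 → (r.1.2.1 : ℤ) ≤ b → b < (r.1.2.1 : ℤ) + r.1.2.2 →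
        ((a + 1 / 2 : ℝ), (b + 1 / 2 : ℝ)) ∈ openSq r.1 := by
      intro r l1 l2 l3 l4
      have m1 : ((r.1.1 : ℤ) : ℝ) ≤ a := by exact_mod_cast l1
      have m2 : (a : ℝ) + 1 ≤ (((r.1.1 : ℤ) + (r.1.2.2 : ℤ) : ℤ) : ℝ) := by exact_mod_cast (show a + 1 ≤ (r.1.1 : ℤ) + r.1.2.2 by omega)
      have m3 : ((r.1.2.1 : ℤ) : ℝ) ≤ b := by exact_mod_cast l3
      have m4 : (b : ℝ) + 1 ≤ (((r.1.2.1 : ℤ) + (r.1.2.2 : ℤ) : ℤ) : ℝ) := by exact_mod_cast (show b + 1 ≤ (r.1.2.1 : ℤ) + r.1.2.2 by omega)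
      push_cast at m1 m2 m3 m4
      exact ⟨⟨by simp only; linarith, by simp only; linarith⟩, ⟨by simp only; linarith, by simp only; linarith⟩⟩
    have := Set.mem_inter (mem q h1 h2 h3 h4) (mem q' k1 k2 k3 k4)
    rw [hd] at this
    exact this
  gcd d hd := by
    have : d ∣ D.gcd (fun q => q.2.2) := Finset.dvd_gcd fun q hq => Int.natCast_dvd_natCast.1 (hd ⟨q, hq⟩)
    rw [h.2] at this
    exact Nat.dvd_one.1 this
def dis41 : Finset (ℕ × ℕ × ℕ) :=
  {(0,0,12),(12,0,11),(23,0,18),(12,11,1),(13,11,3),(16,11,7),(0,12,11),(11,12,2),(11,14,5),(16,18,2),(18,18,23),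
    (11,19,4),(15,19,1),(15,20,3),(0,23,18)}
theorem dis41_cell : ∀ i : Fin 41, ∀ j : Fin 41, ∃ q ∈ dis41, q.1 ≤ i.1 ∧ i.1 + 1 ≤ q.1 + q.2.2 ∧ q.2.1 ≤ j.1 ∧ j.1 + 1 ≤ q.2.1 + q.2.2 := by
  decide +kernel
theorem dis41_sep : ∀ q ∈ dis41, ∀ q' ∈ dis41, q ≠ q' → q.1 + q.2.2 ≤ q'.1 ∨ q'.1 + q'.2.2 ≤ q.1 ∨ q.2.1 + q.2.2 ≤ q'.2.1 ∨ q'.2.1 + q'.2.2 ≤ q.2.1 := by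
  decide +kernel
theorem dis41_bd : ∀ q ∈ dis41, q.1 + q.2.2 ≤ 41 ∧ q.2.1 + q.2.2 ≤ 41 ∧ 0 < q.2.2 := by
  decide +kernel
theorem fl41 {x : ℝ} (h0 : 0 ≤ x) (h1 : x ≤ 41) : ∃ i : Fin 41, (i.1 : ℝ) ≤ x ∧ x ≤ ((i.1 + 1 : ℕ) : ℝ) := by
  by_cases h : x < 41
  · refine ⟨⟨⌊x⌋₊, (Nat.floor_lt h0).2 (by exact_mod_cast h)⟩, Nat.floor_le h0, ?_⟩
    push_cast
    exact (Nat.lt_floor_add_one x).le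
  · exact ⟨40, by norm_num; linarith, by norm_num; linarith⟩
theorem dis41_dis : IsPrimeDissection 41 dis41 := by
  refine ⟨⟨fun q hq => (dis41_bd q hq).2.2, ?_, ?_⟩, by decide +kernel⟩
  · apply Set.Subset.antisymm
    · intro z hz
      simp only [mem_iUnion] at hz
      obtain ⟨q, hq, ⟨k1, k2⟩, ⟨k3, k4⟩⟩ := hz
      obtain ⟨b1, b2, _⟩ := dis41_bd q hq
      have c1 : (q.1 : ℝ) + q.2.2 ≤ (41 : ℕ) := by exact_mod_cast b1
      have c2 : (q.2.1 : ℝ) + q.2.2 ≤ (41 : ℕ) := by exact_mod_cast b2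
      have c3 : (0 : ℝ) ≤ q.1 := cast_nonneg _
      have c4 : (0 : ℝ) ≤ q.2.1 := cast_nonneg _
      exact ⟨⟨by linarith, by linarith⟩, ⟨by linarith, by linarith⟩⟩
    · rintro z ⟨⟨k1, k2⟩, ⟨k3, k4⟩⟩
      obtain ⟨i, i1, i2⟩ := fl41 k1 (by exact_mod_cast k2)
      obtain ⟨j, j1, j2⟩ := fl41 k3 (by exact_mod_cast k4)
      obtain ⟨q, hq, h1, h2, h3, h4⟩ := dis41_cell i j
      simp only [mem_iUnion]
      have c1 : (q.1 : ℝ) ≤ (i.1 : ℝ) := by exact_mod_cast h1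
      have c2 : ((i.1 + 1 : ℕ) : ℝ) ≤ (q.1 : ℝ) + q.2.2 := by exact_mod_cast h2
      have c3 : (q.2.1 : ℝ) ≤ (j.1 : ℝ) := by exact_mod_cast h3
      have c4 : ((j.1 + 1 : ℕ) : ℝ) ≤ (q.2.1 : ℝ) + q.2.2 := by exact_mod_cast h4
      exact ⟨q, hq, ⟨⟨by linarith, by linarith⟩, ⟨by linarith, by linarith⟩⟩⟩
  · intro q hq q' hq' hne
    rw [Set.eq_empty_iff_forall_notMem]
    rintro z ⟨⟨⟨a1, a2⟩, ⟨a3, a4⟩⟩, ⟨⟨b1, b2⟩, ⟨b3, b4⟩⟩⟩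
    rcases dis41_sep q hq q' hq' hne with h | h | h | h
    · have : (q.1 : ℝ) + q.2.2 ≤ q'.1 := by exact_mod_cast h
      linarith
    · have : (q'.1 : ℝ) + q'.2.2 ≤ q.1 := by exact_mod_cast h
      linarith
    · have : (q.2.1 : ℝ) + q.2.2 ≤ q'.2.1 := by exact_mod_cast h
      linarith
    · have : (q'.2.1 : ℝ) + q'.2.2 ≤ q.2.1 := by exact_mod_cast h
      linarith
theorem greatest_size_order_fifteen :
    (∃ D : Finset (ℕ × ℕ × ℕ), IsPrimeDissection 41 D ∧ D.card = 15) ∧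
    (∀ n : ℕ, 41 < n → ∀ D : Finset (ℕ × ℕ × ℕ), IsPrimeDissection n D → 16 ≤ D.card) := by
  refine ⟨⟨dis41, dis41_dis, by decide +kernel⟩, ?_⟩
  intro n hn D hD
  by_contra hlt
  have hc : card (Option {q // q ∈ D}) ≤ 16 := by
    rw [Fintype.card_option, Fintype.card_coe]; omega
  exact SqMap.no_map (tilOf (by omega) hD).toMap hn hc (by convert (tilOf (by omega) hD).map_euler)
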